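/- Let n ≥ 2, let Λ ≤ SL(n,ℝ) be a discrete subgroup, and let μ be a probability measure on the left-coset space SL(n,ℝ)⧸Λ invariant under the left-translation action of SL(n,ℝ). Let F'' ≤ SL(n,ℝ) be a subgroup generated by unipotent elements, and let F' ≤ F'' be a subgroup that is a lattice in F'': F' is discrete and there exists an F''-invariant probability measure on the coset space F''⧸F'. Assume F' acts ergodically on (SL(n,ℝ)⧸Λ, μ). Suppose φ : SL(n,ℝ)⧸Λ → SL(n,ℝ)⧸Λ is a measurable, measure-preserving map that is injective on a μ-conull set, whose image contains a μ-conull set, and that commutes with F' in the sense that for every f ∈ F' and μ-almost every x, φ(f•x) = f•φ(x). Then there exist a continuous group automorphism A of SL(n,ℝ) with A(Λ) = Λ and an element h ∈ SL(n,ℝ) such that φ(gΛ) = h·A(g)·Λ for μ-almost every coset gΛ; moreover the map gΛ ↦ h·A(g)·Λ commutes with the left-translation action of every element of F'. -/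

import Mathlib

open Matrix MeasureTheory
open scoped Pointwise

abbrev SLR (n : ℕ) : Type := Matrix.SpecialLinearGroup (Fin n) ℝ

instance (n : ℕ) : TopologicalSpace (SLR n) :=
  TopologicalSpace.induced (fun g => (g : Matrix (Fin n) (Fin n) ℝ)) inferInstance

noncomputable instance (n : ℕ) : MeasurableSpace (SLR n) := borel _

/-- `u ∈ SL(n,ℝ)` is unipotent if `(u - I)ⁿ = 0` as a matrix. -/
def IsUnipotent (n : ℕ) (u : SLR n) : Prop :=
  ((u : Matrix (Fin n) (Fin n) ℝ) - 1) ^ n = 0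

open Filter Topology Set

instance (n : ℕ) : IsTopologicalGroup (SLR n) :=
  Matrix.SpecialLinearGroup.topologicalGroup

instance (n : ℕ) : PolishSpace (Matrix (Fin n) (Fin n) ℝ) :=
  inferInstanceAs (PolishSpace (Fin n → Fin n → ℝ))

instance (n : ℕ) : LocallyCompactSpace (Matrix (Fin n) (Fin n) ℝ) :=
  inferInstanceAs (LocallyCompactSpace (Fin n → Fin n → ℝ))

theorem SLR.isClosedEmbedding_val (n : ℕ) :
    IsClosedEmbedding (fun g : SLR n => (g : Matrix (Fin n) (Fin n) ℝ)) :=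
  Matrix.SpecialLinearGroup.isClosedEmbedding_val

instance (n : ℕ) : SecondCountableTopology (SLR n) :=
  TopologicalSpace.Subtype.secondCountableTopology _

instance (n : ℕ) : PolishSpace (SLR n) := (SLR.isClosedEmbedding_val n).polishSpace

instance (n : ℕ) : LocallyCompactSpace (SLR n) :=
  (SLR.isClosedEmbedding_val n).locallyCompactSpace

instance (n : ℕ) : BorelSpace (SLR n) := ⟨rfl⟩

attribute [local instance] Matrix.linftyOpNormedRing Matrix.linftyOpNormedAlgebra

@[fun_prop]
theorem SLR.continuous_val (n : ℕ) :
    Continuous (fun g : SLR n => (g : Matrix (Fin n) (Fin n) ℝ)) :=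
  (SLR.isClosedEmbedding_val n).continuous

/-- The distance of `g` to the identity, in the `ℓ^∞` operator norm. -/
noncomputable def dst {n : ℕ} (g : SLR n) : ℝ := ‖(g : Matrix (Fin n) (Fin n) ℝ) - 1‖

@[fun_prop]
theorem continuous_dst (n : ℕ) : Continuous (dst : SLR n → ℝ) := by
  unfold dst; fun_prop

@[simp] theorem dst_one {n : ℕ} : dst (1 : SLR n) = 0 := by simp [dst]

theorem dst_nonneg {n : ℕ} (g : SLR n) : 0 ≤ dst g := norm_nonneg _

theorem dst_eq_zero {n : ℕ} {g : SLR n} : dst g = 0 ↔ g = 1 := by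
  rw [dst, norm_eq_zero, sub_eq_zero]
  constructor
  · intro h; ext i j; simp [h]
  · rintro rfl; simp

/-- The closed ball of radius `r` about the identity. -/
def bal (n : ℕ) (r : ℝ) : Set (SLR n) := {g | dst g ≤ r}

theorem isClosed_bal (n : ℕ) (r : ℝ) : IsClosed (bal n r) :=
  isClosed_le (continuous_dst n) continuous_const

instance (n : ℕ) : ProperSpace (Matrix (Fin n) (Fin n) ℝ) :=
  FiniteDimensional.proper ℝ _

theorem isCompact_bal (n : ℕ) (r : ℝ) : IsCompact (bal n r) := by
  have : bal n r = (fun g : SLR n => (g : Matrix (Fin n) (Fin n) ℝ)) ⁻¹'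
      (Metric.closedBall 1 r) := by
    ext g; simp [bal, dst, dist_eq_norm]
  rw [this]
  exact (SLR.isClosedEmbedding_val n).isCompact_preimage (isCompact_closedBall _ _)

theorem bal_mem_nhds (n : ℕ) {r : ℝ} (hr : 0 < r) : bal n r ∈ 𝓝 (1 : SLR n) := by
  have : ∀ᶠ g in 𝓝 (1 : SLR n), dst g < r :=
    (continuous_dst n).continuousAt.eventually_lt_const (by simpa using hr)
  filter_upwards [this] with g hg using hg.le

theorem exists_bal_subset {n : ℕ} {s : Set (SLR n)} (hs : s ∈ 𝓝 (1 : SLR n)) :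
    ∃ r > 0, bal n r ⊆ s := by
  rw [(SLR.isClosedEmbedding_val n).isInducing.nhds_eq_comap, mem_comap] at hs
  obtain ⟨t, ht, hts⟩ := hs
  obtain ⟨r, hr, hrt⟩ := Metric.nhds_basis_closedBall.mem_iff.1 ht
  refine ⟨r, hr, fun g hg => hts (hrt ?_)⟩
  simpa [bal, dst, dist_eq_norm] using hg

theorem bal_mono {n : ℕ} {r s : ℝ} (h : r ≤ s) : bal n r ⊆ bal n s :=
  fun _ hg => le_trans (show dst _ ≤ r from hg) h

theorem one_mem_bal {n : ℕ} {r : ℝ} (h : 0 ≤ r) : (1 : SLR n) ∈ bal n r := by simpa [bal] using h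

/-- The properties of the homogeneous space `SL(n,ℝ)/Λ`, `Λ` discrete, that are used. -/
class HomSpace (n : ℕ) (X : Type*) [TopologicalSpace X] [MeasurableSpace X]
    [MulAction (SLR n) X] : Prop extends T2Space X, SecondCountableTopology X, BorelSpace X,
    ContinuousSMul (SLR n) X, LocallyCompactSpace X, MulAction.IsPretransitive (SLR n) X where
  open_orbit : ∀ x : X, IsOpenMap (fun g : SLR n => g • x)
  discrete_stab : ∀ x : X, ∃ r > 0, ∀ g : SLR n, g ∈ bal n r → g • x = x → g = 1

instance (n : ℕ) (Λ : Subgroup (SLR n)) [DiscreteTopology Λ] : HomSpace n (SLR n ⧸ Λ) where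
  open_orbit x := by
    induction x using QuotientGroup.induction_on with | H x
    have : (fun g : SLR n => g • (x : SLR n ⧸ Λ)) = (QuotientGroup.mk ∘ (· * x)) := by
      ext g; rfl
    rw [this]
    exact QuotientGroup.isOpenMap_coe.comp (isOpenMap_mul_right x)
  discrete_stab x := by
    induction x using QuotientGroup.induction_on with | H x
    have h1 : ({(1 : Λ)} : Set Λ) ∈ 𝓝 (1 : Λ) := by simp
    rw [nhds_subtype_eq_comap, mem_comap] at h1
    obtain ⟨t, ht, hts⟩ := h1
    have h2 : (fun g : SLR n => x⁻¹ * g * x) ⁻¹' t ∈ 𝓝 (1 : SLR n) := by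
      have : ContinuousAt (fun g : SLR n => x⁻¹ * g * x) 1 := by fun_prop
      apply this
      simpa using ht
    obtain ⟨r, hr, hrt⟩ := exists_bal_subset h2
    refine ⟨r, hr, fun g hg hgx => ?_⟩
    have h3 : x⁻¹ * g * x ∈ Λ := by
      have : (QuotientGroup.mk x : SLR n ⧸ Λ) = QuotientGroup.mk (g * x) := hgx.symm
      rw [QuotientGroup.eq] at this
      simpa [mul_assoc] using this
    have h4 : (⟨_, h3⟩ : Λ) ∈ ({1} : Set Λ) := hts (hrt hg)
    have h5 : x⁻¹ * g * x = 1 := congrArg Subtype.val (mem_singleton_iff.1 h4)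
    have h6 : g = x * 1 * x⁻¹ := by rw [← h5]; group
    simpa using h6

set_option linter.unusedSectionVars false
set_option linter.unusedSimpArgs false

theorem exists_nhds_one_mul_inv_mem {G : Type*} [Group G] [TopologicalSpace G]
    [IsTopologicalGroup G] {V : Set G} (hV : V ∈ 𝓝 (1 : G)) :
    ∃ U ∈ 𝓝 (1 : G), ∀ a ∈ U, ∀ b ∈ U, b * a⁻¹ ∈ V := by
  have h : Continuous (fun p : G × G => p.2 * p.1⁻¹) := by fun_prop
  have h' : Tendsto (fun p : G × G => p.2 * p.1⁻¹) (𝓝 (1, 1)) (𝓝 1) := by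
    simpa using h.tendsto (1, 1)
  have h := h' hV
  rw [nhds_prod_eq, mem_map, mem_prod_same_iff] at h
  obtain ⟨U, hU, hUs⟩ := h
  exact ⟨U, hU, fun a ha b hb => hUs (mk_mem_prod ha hb)⟩

section Relations

variable {n : ℕ} {X : Type*} [TopologicalSpace X] [MeasurableSpace X] [MulAction (SLR n) X]

/-- Pairs of points related by an element of `F`. -/
def GRel (X : Type*) [MulAction (SLR n) X] (F : Set (SLR n)) : Set (X × X) :=
  {p | ∃ g ∈ F, g • p.1 = p.2}

theorem GRel_mono {F F' : Set (SLR n)} (h : F ⊆ F') : GRel X F ⊆ GRel X F' :=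
  fun _ ⟨g, hg, hp⟩ => ⟨g, h hg, hp⟩

/-- Points whose stabilizer meets the ball of radius `r` trivially. -/
def Inj (n : ℕ) (X : Type*) [MulAction (SLR n) X] (r : ℝ) : Set X :=
  {p | ∀ g : SLR n, g ∈ bal n r → g • p = p → g = 1}

theorem Inj_anti {r s : ℝ} (h : r ≤ s) : Inj n X s ⊆ Inj n X r :=
  fun _ hp g hg => hp g (bal_mono h hg)

variable [HomSpace n X]

instance : MeasurableConstSMul (SLR n) X := ⟨fun g => (continuous_const_smul g).measurable⟩

theorem isClosed_GRel {F : Set (SLR n)} (hF : IsCompact F) : IsClosed (GRel X F) := by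
  have hc : IsClosed {p : F × (X × X) | (p.1 : SLR n) • p.2.1 = p.2.2} :=
    isClosed_eq (by fun_prop) (by fun_prop)
  have : CompactSpace F := isCompact_iff_compactSpace.1 hF
  have h := (isClosedMap_snd_of_compactSpace (X := F) (Y := X × X)) _ hc
  convert h using 1
  ext p
  constructor
  · rintro ⟨g, hg, hp⟩; exact ⟨⟨⟨g, hg⟩, p⟩, hp, rfl⟩
  · rintro ⟨⟨g, q⟩, hp, rfl⟩; exact ⟨g, g.2, hp⟩

theorem measurableSet_GRel {F : Set (SLR n)} (hF : IsCompact F) : MeasurableSet (GRel X F) :=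
  (isClosed_GRel hF).measurableSet

theorem measurableSet_Inj (r : ℝ) : MeasurableSet (Inj n X r) := by
  have h : Inj n X r = ⋂ m : ℕ, (fun p : X => (p, p)) ⁻¹'
      (GRel X (bal n r ∩ {g : SLR n | 1 / ((m : ℝ) + 1) ≤ dst g}))ᶜ := by
    ext p
    simp only [mem_iInter, mem_preimage, mem_compl_iff]
    constructor
    · rintro hp m ⟨g, ⟨hg, hgm⟩, hgp⟩
      have := hp g hg hgp
      subst this
      have h0 : (0 : ℝ) < 1 / ((m : ℝ) + 1) := by positivity
      simp only [mem_ofPred_eq, dst_one] at hgm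
      linarith
    · intro hp g hg hgp
      by_contra hne
      have h0 : 0 < dst g := lt_of_le_of_ne (dst_nonneg g) fun h => hne (dst_eq_zero.1 h.symm)
      obtain ⟨m, hm⟩ := exists_nat_one_div_lt h0
      exact hp m ⟨g, ⟨hg, hm.le⟩, hgp⟩
  rw [h]
  refine MeasurableSet.iInter fun m => ?_
  refine (Continuous.measurable (by fun_prop)) (MeasurableSet.compl (measurableSet_GRel ?_))
  exact (isCompact_bal n r).inter_right (isClosed_le continuous_const (continuous_dst n))

theorem exists_Inj_compl_le (μ : Measure X) [IsProbabilityMeasure μ] {ε : ENNReal} (hε : 0 < ε) :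
    ∃ r > 0, μ (Inj n X r)ᶜ ≤ ε := by
  have h1 : Tendsto (fun m : ℕ => μ (Inj n X (1 / ((m : ℝ) + 1)))ᶜ) atTop
      (𝓝 (μ (⋂ m : ℕ, (Inj n X (1 / ((m : ℝ) + 1)))ᶜ))) := by
    apply tendsto_measure_iInter_atTop
    · exact fun m => (measurableSet_Inj _).compl.nullMeasurableSet
    · intro a b hab
      refine compl_subset_compl.2 (Inj_anti ?_)
      have : (a : ℝ) ≤ b := by exact_mod_cast hab
      gcongr
    · exact ⟨0, measure_ne_top _ _⟩
  have h2 : (⋂ m : ℕ, (Inj n X (1 / ((m : ℝ) + 1)))ᶜ) = ∅ := by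
    rw [eq_empty_iff_forall_notMem]
    intro x hx
    obtain ⟨r, hr, h⟩ := HomSpace.discrete_stab (n := n) x
    obtain ⟨m, hm⟩ := exists_nat_one_div_lt hr
    exact (mem_iInter.1 hx m) fun g hg => h g (bal_mono hm.le hg)
  rw [h2, measure_empty] at h1
  obtain ⟨m, hm⟩ := ((ENNReal.tendsto_nhds_zero.1 h1) ε hε).exists
  exact ⟨1 / ((m : ℝ) + 1), by positivity, hm⟩

theorem tendsto_measure_smul_diff (μ : Measure X) [IsProbabilityMeasure μ]
    [SMulInvariantMeasure (SLR n) X μ] {A : Set X} (hA : MeasurableSet A) :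
    Tendsto (fun g : SLR n => μ (A \ (fun x => g • x) ⁻¹' A)) (𝓝 1) (𝓝 0) := by
  have : LocallyCompactSpace X := HomSpace.toLocallyCompactSpace n
  have : BorelSpace X := HomSpace.toBorelSpace n
  have : T2Space X := HomSpace.toT2Space n
  have : SecondCountableTopology X := HomSpace.toSecondCountableTopology n
  let f : C(SLR n, C(X, X)) := ContinuousMap.curry ⟨fun p : SLR n × X => p.1 • p.2, by fun_prop⟩
  have hf : Tendsto (fun g => f g) (𝓝 1) (𝓝 (f 1)) := f.continuous.tendsto 1
  have hmp : ∀ g, MeasurePreserving (f g) μ μ := fun g => measurePreserving_smul g μ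
  have h := tendsto_measure_symmDiff_preimage_nhds_zero hf (.of_forall hmp) (hmp 1)
    hA.nullMeasurableSet (measure_ne_top _ _)
  refine tendsto_of_tendsto_of_tendsto_of_le_of_le tendsto_const_nhds h (fun _ => zero_le)
    fun g => measure_mono fun x hx => ?_
  right
  simpa [f] using hx

theorem measurableSet_notNear {Z : Type*} [MeasurableSpace Z] (δ : ℝ) {f g : Z → X}
    (hf : Measurable f) (hg : Measurable g) :
    MeasurableSet {z | (f z, g z) ∉ GRel X (bal n δ)} := by
  have : BorelSpace X := HomSpace.toBorelSpace n
  have : SecondCountableTopology X := HomSpace.toSecondCountableTopology n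
  exact (hf.prodMk hg) (measurableSet_GRel (isCompact_bal n δ)).compl

theorem near_continuous (μ : Measure X) [IsProbabilityMeasure μ]
    [SMulInvariantMeasure (SLR n) X μ] {ψ : X → X} (hψ : Measurable ψ) {δ : ℝ} (hδ : 0 < δ) :
    Tendsto (fun g : SLR n => μ {x | (ψ x, ψ (g • x)) ∉ GRel X (bal n δ)}) (𝓝 1) (𝓝 0) := by
  have : BorelSpace X := HomSpace.toBorelSpace n
  have : SecondCountableTopology X := HomSpace.toSecondCountableTopology n
  have hU := exists_nhds_one_mul_inv_mem (bal_mem_nhds n hδ)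
  obtain ⟨U, hU, hUδ⟩ := hU
  have hV : ∀ y : X, (fun g : SLR n => g • y) '' interior U ∈ 𝓝 y := fun y =>
    (HomSpace.open_orbit (n := n) y _ isOpen_interior).mem_nhds
      ⟨1, mem_interior_iff_mem_nhds.2 hU, one_smul _ _⟩
  obtain ⟨s, hs, hsU⟩ := TopologicalSpace.countable_cover_nhds hV
  have hsn : s.Nonempty ∨ s = ∅ := s.eq_empty_or_nonempty.symm
  rcases hsn with hsn | hsn
  swap
  · have : IsEmpty X := by
      subst hsn
      simp only [mem_empty_iff_false, iUnion_of_empty, iUnion_empty] at hsU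
      exact ⟨fun x => (hsU ▸ mem_univ x : x ∈ (∅ : Set X))⟩
    exact (IsProbabilityMeasure.ne_zero μ (Measure.eq_zero_of_isEmpty μ)).elim
  obtain ⟨y, rfl⟩ := hs.exists_eq_range hsn
  let A : ℕ → Set X := fun i => ψ ⁻¹' ((fun g : SLR n => g • y i) '' interior U)
  have hA : ∀ i, MeasurableSet (A i) := fun i =>
    hψ (HomSpace.open_orbit (n := n) (y i) _ isOpen_interior).measurableSet
  have hcov : ∀ x, ∃ i, x ∈ A i := by
    intro x
    have : ψ x ∈ ⋃ x ∈ range y, (fun g : SLR n => g • x) '' interior U := hsU ▸ mem_univ _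
    simpa [A] using this
  have h1 : Tendsto (fun N : ℕ => μ (⋂ i ∈ Finset.range N, (A i)ᶜ)) atTop (𝓝 0) := by
    have h2 : Tendsto (fun N : ℕ => μ (⋂ i ∈ Finset.range N, (A i)ᶜ)) atTop
        (𝓝 (μ (⋂ N : ℕ, ⋂ i ∈ Finset.range N, (A i)ᶜ))) := by
      apply tendsto_measure_iInter_atTop
      · exact fun N => (Finset.measurableSet_biInter _ fun i _ => (hA i).compl).nullMeasurableSet
      · intro a b hab
        exact biInter_subset_biInter_left fun i hi =>
          Finset.mem_range.2 ((Finset.mem_range.1 hi).trans_le hab)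
      · exact ⟨0, measure_ne_top _ _⟩
    have h3 : (⋂ N : ℕ, ⋂ i ∈ Finset.range N, (A i)ᶜ) = ∅ := by
      rw [eq_empty_iff_forall_notMem]
      intro x hx
      obtain ⟨i, hi⟩ := hcov x
      simp only [mem_iInter] at hx
      exact hx (i + 1) i (Finset.mem_range.2 (Nat.lt_succ_self i)) hi
    rwa [h3, measure_empty] at h2
  rw [ENNReal.tendsto_nhds_zero]
  intro ε hε
  have hε2 : 0 < ε / 2 := ENNReal.half_pos hε.ne'
  obtain ⟨N, hN⟩ := ((ENNReal.tendsto_nhds_zero.1 h1) _ hε2).exists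
  have h4 : Tendsto (fun g : SLR n => ∑ i ∈ Finset.range N,
      μ (A i \ (fun x => g • x) ⁻¹' A i)) (𝓝 1) (𝓝 0) := by
    simpa using tendsto_finsetSum (Finset.range N)
      fun i _ => tendsto_measure_smul_diff (n := n) μ (hA i)
  filter_upwards [(ENNReal.tendsto_nhds_zero.1 h4) _ hε2] with g hg
  calc μ {x | (ψ x, ψ (g • x)) ∉ GRel X (bal n δ)}
      ≤ μ ((⋂ i ∈ Finset.range N, (A i)ᶜ) ∪
          ⋃ i ∈ Finset.range N, (A i \ (fun x => g • x) ⁻¹' A i)) := by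
        refine measure_mono fun x hx => ?_
        by_contra hcon
        simp only [mem_union, mem_iInter, mem_iUnion, not_or, not_forall, not_exists,
          mem_compl_iff, not_not, Set.mem_sdiff, not_and] at hcon
        obtain ⟨⟨i, hi, hxi⟩, h5⟩ := hcon
        have h6 := h5 i hi hxi
        simp only [mem_preimage, A] at h6 hxi
        obtain ⟨a, ha, hae⟩ := hxi
        obtain ⟨b, hb, hbe⟩ := h6
        refine hx ⟨b * a⁻¹, hUδ a (interior_subset ha) b (interior_subset hb), ?_⟩
        simp only at hae hbe ⊢
        rw [← hae, ← hbe, smul_smul]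
        simp
    _ ≤ ε / 2 + ε / 2 := (measure_union_le _ _).trans
        (add_le_add hN ((measure_biUnion_finset_le _ _).trans hg))
    _ = ε := ENNReal.add_halves ε

end Relations

section Dominated

variable {G : Type*} (good : ℕ → Prop) (cls : ℕ → G)

open Classical in
/-- The good times in `[a, b)` of class `g`. -/
noncomputable def clsTimes (g : G) (a b : ℕ) : Finset ℕ :=
  (Finset.Ico a b).filter fun j => good j ∧ cls j = g

open Classical in
/-- The good times in `[a, b)`. -/
noncomputable def goodTimes (a b : ℕ) : Finset ℕ := (Finset.Ico a b).filter good

theorem card_goodTimes_le_of_not_dominated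
    (hdom : ∀ (g : G) (a b : ℕ), a < b → b - a ≤ 8 * (clsTimes good cls g a b).card →
      ∀ j ∈ Finset.Ico a b, good j → cls j = g) (N : ℕ)
    (hno : ¬ ∃ (g : G) (a : ℕ), 2 * a ≤ N ∧ a < N ∧ N - a ≤ 8 * (clsTimes good cls g a N).card) :
    ∀ k a : ℕ, N = a + k → 4 * (goodTimes good a N).card ≤ k + 2 * N := by
  classical
  intro k
  induction k using Nat.strong_induction_on with
  | _ k ih =>
    intro a hak
    by_cases hg : ∃ j, j ∈ goodTimes good a N
    swap
    · have : goodTimes good a N = ∅ := Finset.eq_empty_of_forall_notMem (by simpa using hg)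
      simp [this]
    obtain ⟨j0, hj0, hmin⟩ : ∃ j0 ∈ goodTimes good a N, ∀ j ∈ goodTimes good a N, j0 ≤ j := by
      have hne : (goodTimes good a N).Nonempty := hg
      exact ⟨_, Finset.min'_mem _ hne, fun j hj => Finset.min'_le _ j hj⟩
    simp only [goodTimes, Finset.mem_filter, Finset.mem_Ico] at hj0
    set g := cls j0 with hgdef
    let P : ℕ → Prop := fun b => j0 < b ∧ b ≤ N ∧ b - j0 ≤ 8 * (clsTimes good cls g j0 b).card
    have hP0 : P (j0 + 1) := by
      refine ⟨by omega, by omega, ?_⟩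
      have : j0 ∈ clsTimes good cls g j0 (j0 + 1) := by
        simp [clsTimes, hj0.2, hgdef]
      have := Finset.card_pos.2 ⟨j0, this⟩
      omega
    obtain ⟨b, hb, hbmax⟩ : ∃ b, P b ∧ ∀ c, P c → c ≤ b := by
      refine ⟨Nat.findGreatest P N, Nat.findGreatest_spec (P := P) hP0.2.1 hP0, fun c hc =>
        Nat.le_findGreatest hc.2.1 hc⟩
    have hsub : goodTimes good j0 b ⊆ clsTimes good cls g j0 b := by
      intro j hj
      simp only [goodTimes, clsTimes, Finset.mem_filter] at hj ⊢
      exact ⟨hj.1, hj.2, hdom g j0 b hb.1 hb.2.2 j hj.1 hj.2⟩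
    have hsplit : goodTimes good a N ⊆ goodTimes good j0 b ∪ goodTimes good b N := by
      intro j hj
      have hmj := hmin j hj
      simp only [goodTimes, Finset.mem_filter, Finset.mem_union, Finset.mem_Ico] at hj ⊢
      rcases lt_or_ge j b with h | h
      · exact Or.inl ⟨⟨hmj, h⟩, hj.2⟩
      · exact Or.inr ⟨⟨h, hj.1.2⟩, hj.2⟩
    have hcard := (Finset.card_le_card hsplit).trans (Finset.card_union_le _ _)
    have hcard1 := Finset.card_le_card hsub
    rcases hb.2.1.eq_or_lt with hbN | hbN
    · have h2 : N < 2 * j0 := by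
        by_contra hcon
        exact hno ⟨g, j0, by omega, by omega, hbN ▸ hb.2.2⟩
      have h3 : (goodTimes good j0 b).card ≤ b - j0 := by
        rw [goodTimes]
        exact (Finset.card_filter_le _ _).trans (by simp)
      have h4 : (goodTimes good b N).card = 0 := by simp [goodTimes, hbN]
      omega
    · have hnP : ¬ P (b + 1) := fun h => by have := hbmax _ h; omega
      have h5 : 8 * (clsTimes good cls g j0 (b + 1)).card < b + 1 - j0 := by
        by_contra hcon
        exact hnP ⟨by omega, by omega, by omega⟩
      have h6 : clsTimes good cls g j0 b ⊆ clsTimes good cls g j0 (b + 1) := by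
        intro j hj
        simp only [clsTimes, Finset.mem_filter, Finset.mem_Ico] at hj ⊢
        exact ⟨⟨hj.1.1, by omega⟩, hj.2⟩
      have h7 := Finset.card_le_card h6
      have h8 := ih (N - b) (by omega) b (by omega)
      have := hb.1
      omega

theorem exists_dominated
    (hdom : ∀ (g : G) (a b : ℕ), a < b → b - a ≤ 8 * (clsTimes good cls g a b).card →
      ∀ j ∈ Finset.Ico a b, good j → cls j = g) (N : ℕ) (hN : 0 < N)
    (hmany : 7 * N ≤ 8 * (goodTimes good 0 N).card) :
    ∃ g : G, N ≤ 16 * (clsTimes good cls g 0 N).card := by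
  classical
  by_contra hcon
  have hno : ¬ ∃ (g : G) (a : ℕ), 2 * a ≤ N ∧ a < N ∧
      N - a ≤ 8 * (clsTimes good cls g a N).card := by
    rintro ⟨g, a, h1, h2, h3⟩
    refine hcon ⟨g, ?_⟩
    have h6 : clsTimes good cls g a N ⊆ clsTimes good cls g 0 N := by
      intro j hj
      simp only [clsTimes, Finset.mem_filter, Finset.mem_Ico] at hj ⊢
      exact ⟨⟨by omega, hj.1.2⟩, hj.2⟩
    have := Finset.card_le_card h6
    omega
  have := card_goodTimes_le_of_not_dominated good cls hdom N hno N 0 (by omega)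
  omega

end Dominated

section Remez

open Polynomial

theorem exists_spaced_nodes (D : ℕ) (J : Finset ℕ) (hJ : D + 1 ≤ J.card) :
    ∃ v : ℕ → ℕ, (∀ i < D + 1, v i ∈ J) ∧ ∀ i < D + 1, ∀ k < D + 1, i ≠ k →
      (J.card : ℝ) ≤ 2 * (D + 1) * |(v i : ℝ) - v k| := by
  set m := J.card with hm
  set s := m / (D + 1) with hs
  have hs1 : 1 ≤ s := (Nat.one_le_div_iff (by omega)).2 hJ
  have hsm : (D + 1) * s ≤ m := Nat.mul_div_le _ _
  have hms : m < (D + 1) * (s + 1) := by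
    have := Nat.lt_mul_div_succ m (show 0 < D + 1 by omega)
    simpa [hs] using this
  let e := J.orderEmbOfFin hm.symm
  have hidx : ∀ i, i < D + 1 → i * s < m := fun i hi => by nlinarith
  let v : ℕ → ℕ := fun i => if h : i < D + 1 then e ⟨i * s, hidx i h⟩ else 0
  have hlin : ∀ a b : Fin m, a ≤ b → (b : ℕ) - a ≤ e b - e a := by
    have : ∀ d : ℕ, ∀ a b : Fin m, (b : ℕ) = a + d → e a + d ≤ e b := by
      intro d
      induction d with
      | zero => intro a b h; have : a = b := Fin.ext (by omega); simp [this]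
      | succ d ih =>
        intro a b h
        let b' : Fin m := ⟨a + d, by omega⟩
        have h1 := ih a b' rfl
        have h2 : e b' < e b := e.strictMono (by rw [Fin.lt_def]; simp [b']; omega)
        omega
    intro a b hab
    have h := this (b - a) a b (by have : (a : ℕ) ≤ b := hab; omega)
    omega
  have key : ∀ i < D + 1, ∀ k < D + 1, i < k → (m : ℝ) ≤ 2 * (D + 1) * ((v k : ℝ) - v i) := by
    intro i hi k hk hik
    have h1 := hlin ⟨i * s, hidx i hi⟩ ⟨k * s, hidx k hk⟩
      (by rw [Fin.le_def]; exact Nat.mul_le_mul_right s hik.le)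
    have h3 : s + i * s ≤ k * s := by nlinarith
    have hmono : e ⟨i * s, hidx i hi⟩ ≤ e ⟨k * s, hidx k hk⟩ :=
      e.monotone (by rw [Fin.le_def]; exact Nat.mul_le_mul_right s hik.le)
    have h2 : s + v i ≤ v k := by
      simp only [v, hi, hk, dif_pos]
      simp only at h1
      omega
    have h4 : (s : ℝ) + v i ≤ v k := by exact_mod_cast h2
    have h5 : (m : ℝ) ≤ (D + 1) * (s + 1) := by exact_mod_cast hms.le
    have h6 : (1 : ℝ) ≤ s := by exact_mod_cast hs1
    have h7 : (0 : ℝ) ≤ D := by positivity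
    nlinarith
  refine ⟨v, fun i hi => ?_, fun i hi k hk hik => ?_⟩
  · simp only [v, hi, dif_pos]
    exact J.orderEmbOfFin_mem _ _
  · rcases lt_or_gt_of_ne hik with h | h
    · rw [abs_sub_comm]
      exact (key i hi k hk h).trans (by gcongr; exact le_abs_self _)
    · exact (key k hk i hi h).trans (by gcongr; exact le_abs_self _)

theorem remez (D : ℕ) {θ : ℝ} (hθ : 0 < θ) :
    ∃ C > 0, ∀ p : ℝ[X], p.natDegree ≤ D → ∀ (a b : ℕ) (J : Finset ℕ), J ⊆ Finset.Ico a b →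
      D + 1 ≤ J.card → θ * ((b : ℝ) - a) ≤ J.card → ∀ c : ℝ, (∀ j ∈ J, |p.eval (j : ℝ)| ≤ c) →
      ∀ j ∈ Finset.Ico a b, |p.eval (j : ℝ)| ≤ C * c := by
  refine ⟨(D + 1) * (2 * (D + 1) / θ) ^ D, by positivity, ?_⟩
  intro p hp a b J hJ hJD hJθ c hc j hj
  obtain ⟨v, hvJ, hv⟩ := exists_spaced_nodes D J hJD
  have hJ0 : (0 : ℝ) < J.card := by
    have : 0 < J.card := by omega
    exact_mod_cast this
  have hinj : Set.InjOn (fun i => (v i : ℝ)) (Finset.range (D + 1) : Set ℕ) := by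
    intro i hi k hk hik
    by_contra hne
    have := hv i (by simpa using hi) k (by simpa using hk) hne
    simp only at hik
    rw [hik, sub_self, abs_zero, mul_zero] at this
    linarith
  have hint := Lagrange.eq_interpolate (s := Finset.range (D + 1)) (v := fun i => (v i : ℝ)) (f := p)
    hinj (by
      rw [Finset.card_range]
      refine lt_of_le_of_lt degree_le_natDegree ?_
      exact_mod_cast Nat.lt_succ_of_le hp)
  have hab : (a : ℝ) < b := by
    have := Finset.mem_Ico.1 hj
    exact_mod_cast lt_of_le_of_lt this.1 this.2
  rw [hint, Lagrange.interpolate_apply, eval_finsetSum]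
  have hc0 : 0 ≤ c := (abs_nonneg _).trans (hc (v 0) (hvJ 0 (by omega)))
  have hterm : ∀ i ∈ Finset.range (D + 1),
      |(C (p.eval (v i : ℝ)) * Lagrange.basis (Finset.range (D + 1)) (fun i => (v i : ℝ)) i).eval
        (j : ℝ)| ≤ (2 * (D + 1) / θ) ^ D * c := by
    intro i hi
    rw [eval_mul, eval_C, abs_mul, Lagrange.basis, eval_prod, Finset.abs_prod, mul_comm]
    refine mul_le_mul ?_ (hc _ (hvJ i (Finset.mem_range.1 hi))) (abs_nonneg _) (by positivity)
    have hcard : ((Finset.range (D + 1)).erase i).card = D := by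
      rw [Finset.card_erase_of_mem hi, Finset.card_range]; rfl
    have hpow : (2 * ((D : ℝ) + 1) / θ) ^ D =
        ∏ _k ∈ (Finset.range (D + 1)).erase i, 2 * ((D : ℝ) + 1) / θ := by
      rw [Finset.prod_const, hcard]
    rw [hpow]
    refine Finset.prod_le_prod (fun _ _ => abs_nonneg _) fun k hk => ?_
    obtain ⟨hki, hk⟩ := Finset.mem_erase.1 hk
    simp only [Lagrange.basisDivisor, eval_mul, eval_C, eval_sub, eval_X]
    have h1 := hv i (Finset.mem_range.1 hi) k (Finset.mem_range.1 hk) (Ne.symm hki)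
    have hvk := Finset.mem_Ico.1 (hJ (hvJ k (Finset.mem_range.1 hk)))
    have hj' := Finset.mem_Ico.1 hj
    have h2 : |(j : ℝ) - v k| ≤ b - a := by
      rw [abs_le]
      have e1 : (a : ℝ) ≤ v k := by exact_mod_cast hvk.1
      have e2 : (v k : ℝ) ≤ b := by exact_mod_cast hvk.2.le
      have e3 : (a : ℝ) ≤ j := by exact_mod_cast hj'.1
      have e4 : (j : ℝ) ≤ b := by exact_mod_cast hj'.2.le
      constructor <;> linarith
    have h3 : 0 < |(v i : ℝ) - v k| := by
      by_contra hcon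
      have : |(v i : ℝ) - v k| = 0 := le_antisymm (not_lt.1 hcon) (abs_nonneg _)
      rw [this, mul_zero] at h1
      linarith
    rw [abs_mul, abs_inv, inv_mul_eq_div, div_le_div_iff₀ h3 hθ]
    calc |(j : ℝ) - v k| * θ ≤ (b - a) * θ := by gcongr
      _ ≤ J.card := by linarith
      _ ≤ _ := h1
  calc |∑ i ∈ Finset.range (D + 1), _| ≤ ∑ i ∈ Finset.range (D + 1), _ :=
        Finset.abs_sum_le_sum_abs _ _
    _ ≤ ∑ i ∈ Finset.range (D + 1), (2 * (D + 1) / θ) ^ D * c := Finset.sum_le_sum hterm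
    _ = _ := by rw [Finset.sum_const, Finset.card_range, nsmul_eq_mul]; push_cast; ring

end Remez

section PolySeq

open Polynomial

/-- Sequences given by a real polynomial of degree at most `D`. -/
def IsPolySeq (D : ℕ) (f : ℕ → ℝ) : Prop :=
  ∃ p : ℝ[X], p.natDegree ≤ D ∧ ∀ j : ℕ, f j = p.eval (j : ℝ)

theorem IsPolySeq.mono {D D' : ℕ} {f : ℕ → ℝ} (h : IsPolySeq D f) (hD : D ≤ D') :
    IsPolySeq D' f := let ⟨p, hp, hf⟩ := h; ⟨p, hp.trans hD, hf⟩

theorem IsPolySeq.const (D : ℕ) (c : ℝ) : IsPolySeq D (fun _ => c) := ⟨C c, by simp, by simp⟩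

theorem IsPolySeq.mul {D D' : ℕ} {f g : ℕ → ℝ} (hf : IsPolySeq D f) (hg : IsPolySeq D' g) :
    IsPolySeq (D + D') (fun j => f j * g j) := by
  obtain ⟨p, hp, hf⟩ := hf
  obtain ⟨q, hq, hg⟩ := hg
  exact ⟨p * q, natDegree_mul_le.trans (by omega), fun j => by simp [hf, hg]⟩

theorem IsPolySeq.sum {ι : Type*} (s : Finset ι) {D : ℕ} {f : ι → ℕ → ℝ}
    (hf : ∀ i ∈ s, IsPolySeq D (f i)) : IsPolySeq D (fun j => ∑ i ∈ s, f i j) := by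
  classical
  choose! p hp hf using hf
  refine ⟨∑ i ∈ s, p i, natDegree_sum_le_of_forall_le _ _ hp, fun j => ?_⟩
  rw [eval_finsetSum]
  exact Finset.sum_congr rfl fun i hi => hf i hi j

theorem isPolySeq_choose (i : ℕ) : IsPolySeq i (fun j => (j.choose i : ℝ)) := by
  refine ⟨C ((i.factorial : ℝ)⁻¹) * descPochhammer ℝ i, ?_, fun j => ?_⟩
  · refine (natDegree_C_mul_le _ _).trans (descPochhammer_natDegree ℝ i).le
  · rw [eval_mul, eval_C, descPochhammer_eval_eq_descFactorial,
      Nat.descFactorial_eq_factorial_mul_choose]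
    have : (i.factorial : ℝ) ≠ 0 := by positivity
    push_cast
    field_simp

theorem one_add_pow_eq_sum_choose {R : Type*} [Ring R] {N : R} {m : ℕ} (hN : N ^ m = 0) (j : ℕ) :
    (1 + N) ^ j = ∑ i ∈ Finset.range m, (j.choose i) • N ^ i := by
  rw [add_comm, (Commute.one_right N).add_pow]
  have h0 : ∀ i, m ≤ i → N ^ i = 0 := fun i hi => pow_eq_zero_of_le hi hN
  have e1 : ∑ i ∈ Finset.range (j + 1), N ^ i * 1 ^ (j - i) * (j.choose i : R) =
      ∑ i ∈ Finset.range (max (j + 1) m), (j.choose i) • N ^ i := by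
    rw [← Finset.sum_subset (Finset.range_mono (le_max_left (j + 1) m))]
    · refine Finset.sum_congr rfl fun i _ => ?_
      rw [one_pow, mul_one, nsmul_eq_mul, Nat.cast_comm]
    · intro i _ hi
      rw [Nat.choose_eq_zero_of_lt (by simpa using hi), zero_smul]
  rw [e1]
  refine (Finset.sum_subset (Finset.range_mono (le_max_right (j + 1) m)) ?_).symm
  intro i _ hi
  rw [h0 i (by simpa using hi), smul_zero]

end PolySeq

section Conj

variable {n : ℕ}

/-- Unipotent elements. -/
def Unip (w : SLR n) : Prop := IsNilpotent ((w : Matrix (Fin n) (Fin n) ℝ) - 1)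

theorem Unip.inv {w : SLR n} (hw : Unip w) : Unip w⁻¹ := by
  have h1 : ((w⁻¹ : SLR n) : Matrix (Fin n) (Fin n) ℝ) * (w : Matrix (Fin n) (Fin n) ℝ) = 1 := by
    rw [← Matrix.SpecialLinearGroup.coe_mul, inv_mul_cancel, Matrix.SpecialLinearGroup.coe_one]
  have h2 : (w : Matrix (Fin n) (Fin n) ℝ) * ((w⁻¹ : SLR n) : Matrix (Fin n) (Fin n) ℝ) = 1 := by
    rw [← Matrix.SpecialLinearGroup.coe_mul, mul_inv_cancel, Matrix.SpecialLinearGroup.coe_one]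
  have h3 : ((w⁻¹ : SLR n) : Matrix (Fin n) (Fin n) ℝ) - 1 =
      -(((w⁻¹ : SLR n) : Matrix (Fin n) (Fin n) ℝ) * ((w : Matrix (Fin n) (Fin n) ℝ) - 1)) := by
    rw [mul_sub, h1, mul_one]; abel
  unfold Unip at *
  rw [h3]
  refine IsNilpotent.neg ?_
  refine Commute.isNilpotent_mul_left ?_ hw
  rw [commute_iff_eq, mul_sub, sub_mul, h1, h2]; simp

theorem Unip.isPolySeq_pow {w : SLR n} (hw : Unip w) :
    ∃ D, ∀ a b, IsPolySeq D fun j => ((w ^ j : SLR n) : Matrix (Fin n) (Fin n) ℝ) a b := by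
  obtain ⟨m, hm⟩ := hw
  refine ⟨m, fun a b => ?_⟩
  have h : ∀ j : ℕ, ((w ^ j : SLR n) : Matrix (Fin n) (Fin n) ℝ) a b =
      ∑ i ∈ Finset.range m, (j.choose i : ℝ) *
        (((w : Matrix (Fin n) (Fin n) ℝ) - 1) ^ i) a b := by
    intro j
    have := one_add_pow_eq_sum_choose hm j
    rw [add_sub_cancel] at this
    rw [Matrix.SpecialLinearGroup.coe_pow, this, Matrix.sum_apply]
    refine Finset.sum_congr rfl fun i _ => ?_
    rw [Matrix.smul_apply, nsmul_eq_mul]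
  simp_rw [h]
  refine IsPolySeq.sum _ fun i hi => ?_
  exact ((isPolySeq_choose i).mul (IsPolySeq.const 0 _)).mono
    (by have := Finset.mem_range.1 hi; omega)

/-- Conjugation of a matrix by `g`. -/
def cnj (g : SLR n) (Z : Matrix (Fin n) (Fin n) ℝ) : Matrix (Fin n) (Fin n) ℝ :=
  (g : Matrix (Fin n) (Fin n) ℝ) * Z * ((g⁻¹ : SLR n) : Matrix (Fin n) (Fin n) ℝ)

theorem SLR.coe_mul_coe_inv (g : SLR n) : (g : Matrix (Fin n) (Fin n) ℝ) *
    ((g⁻¹ : SLR n) : Matrix (Fin n) (Fin n) ℝ) = 1 := by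
  rw [← Matrix.SpecialLinearGroup.coe_mul, mul_inv_cancel, Matrix.SpecialLinearGroup.coe_one]

theorem SLR.coe_inv_mul_coe (g : SLR n) : ((g⁻¹ : SLR n) : Matrix (Fin n) (Fin n) ℝ) *
    (g : Matrix (Fin n) (Fin n) ℝ) = 1 := by
  rw [← Matrix.SpecialLinearGroup.coe_mul, inv_mul_cancel, Matrix.SpecialLinearGroup.coe_one]

theorem cnj_mul (g h : SLR n) (Z : Matrix (Fin n) (Fin n) ℝ) :
    cnj (g * h) Z = cnj g (cnj h Z) := by
  simp only [cnj, _root_.mul_inv_rev, Matrix.SpecialLinearGroup.coe_mul]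
  simp only [mul_assoc]

theorem cnj_sub_one (g h : SLR n) :
    cnj g ((h : Matrix (Fin n) (Fin n) ℝ) - 1) =
      ((g * h * g⁻¹ : SLR n) : Matrix (Fin n) (Fin n) ℝ) - 1 := by
  simp only [cnj, mul_sub, sub_mul, mul_one, SLR.coe_mul_coe_inv,
    Matrix.SpecialLinearGroup.coe_mul]

theorem norm_cnj_le (g : SLR n) (Z : Matrix (Fin n) (Fin n) ℝ) :
    ‖cnj g Z‖ ≤ ‖(g : Matrix (Fin n) (Fin n) ℝ)‖ * ‖Z‖ *
      ‖((g⁻¹ : SLR n) : Matrix (Fin n) (Fin n) ℝ)‖ :=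
  (norm_mul_le _ _).trans (by gcongr; exact norm_mul_le _ _)

theorem Unip.isPolySeq_cnj {w : SLR n} (hw : Unip w) :
    ∃ D, ∀ Z a b, IsPolySeq D fun j => cnj (w ^ j) Z a b := by
  obtain ⟨D, hD⟩ := hw.isPolySeq_pow
  obtain ⟨D', hD'⟩ := hw.inv.isPolySeq_pow
  refine ⟨D + 0 + D', fun Z a b => ?_⟩
  simp only [cnj, Matrix.mul_apply, Finset.sum_mul]
  refine IsPolySeq.sum _ fun c _ => IsPolySeq.sum _ fun d _ => ?_
  refine ((hD a d).mul (IsPolySeq.const 0 (Z d c))).mul ?_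
  simpa using hD' c b

theorem abs_entry_le_norm (Z : Matrix (Fin n) (Fin n) ℝ) (a b : Fin n) : |Z a b| ≤ ‖Z‖ := by
  rw [Matrix.linfty_opNorm_def, ← Real.norm_eq_abs, ← coe_nnnorm]
  refine NNReal.coe_le_coe.2 ?_
  calc ‖Z a b‖₊ ≤ ∑ j, ‖Z a j‖₊ :=
        Finset.single_le_sum (f := fun j => ‖Z a j‖₊) (fun _ _ => zero_le) (Finset.mem_univ b)
    _ ≤ _ := Finset.le_sup (f := fun i => ∑ j, ‖Z i j‖₊) (Finset.mem_univ a)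

theorem norm_le_of_entries {Z : Matrix (Fin n) (Fin n) ℝ} {c : ℝ} (hc : 0 ≤ c)
    (h : ∀ a b, |Z a b| ≤ c) : ‖Z‖ ≤ n * c := by
  lift c to NNReal using hc
  rw [Matrix.linfty_opNorm_def]
  have : (Finset.univ.sup fun i => ∑ j, ‖Z i j‖₊) ≤ n * c := by
    refine Finset.sup_le fun i _ => ?_
    calc ∑ j, ‖Z i j‖₊ ≤ ∑ j : Fin n, c := Finset.sum_le_sum fun j _ => by
          rw [← NNReal.coe_le_coe, coe_nnnorm, Real.norm_eq_abs]; exact h i j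
      _ = n * c := by simp
  exact_mod_cast this

theorem Unip.remez {w : SLR n} (hw : Unip w) {θ : ℝ} (hθ : 0 < θ) :
    ∃ C > 0, ∀ (Z : Matrix (Fin n) (Fin n) ℝ) (a b : ℕ) (J : Finset ℕ), J ⊆ Finset.Ico a b →
      J.Nonempty → θ * ((b : ℝ) - a) ≤ J.card → ∀ c : ℝ, (∀ j ∈ J, ‖cnj (w ^ j) Z‖ ≤ c) →
      ∀ j ∈ Finset.Ico a b, ‖cnj (w ^ j) Z‖ ≤ C * c := by
  obtain ⟨D, hD⟩ := hw.isPolySeq_cnj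
  obtain ⟨C, hC0, hC⟩ := _root_.remez D hθ
  obtain ⟨L, hL⟩ := exists_nat_gt ((D : ℝ) / θ)
  let B : ℝ := ∑ k ∈ Finset.range (L + 1), (‖((w ^ k : SLR n) : Matrix (Fin n) (Fin n) ℝ)‖ *
    ‖(((w ^ k)⁻¹ : SLR n) : Matrix (Fin n) (Fin n) ℝ)‖)
  have hB0 : 0 ≤ B := Finset.sum_nonneg fun _ _ => by positivity
  have hB : ∀ k ≤ L, ‖((w ^ k : SLR n) : Matrix (Fin n) (Fin n) ℝ)‖ *
      ‖(((w ^ k)⁻¹ : SLR n) : Matrix (Fin n) (Fin n) ℝ)‖ ≤ B := fun k hk =>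
    Finset.single_le_sum (f := fun k => ‖((w ^ k : SLR n) : Matrix (Fin n) (Fin n) ℝ)‖ *
    ‖(((w ^ k)⁻¹ : SLR n) : Matrix (Fin n) (Fin n) ℝ)‖) (fun _ _ => by positivity)
      (Finset.mem_range.2 (Nat.lt_succ_of_le hk))
  refine ⟨n * C + B + 1, by positivity, ?_⟩
  intro Z a b J hJ hJne hJθ c hc j hj
  have hc0 : 0 ≤ c := by
    obtain ⟨i, hi⟩ := hJne
    exact (norm_nonneg _).trans (hc i hi)
  by_cases hcard : D + 1 ≤ J.card
  · have : ‖cnj (w ^ j) Z‖ ≤ n * (C * c) := by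
      refine norm_le_of_entries (by positivity) fun x y => ?_
      obtain ⟨p, hp, hpe⟩ := hD Z x y
      replace hpe : ∀ j : ℕ, cnj (w ^ j) Z x y = p.eval (j : ℝ) := hpe
      rw [hpe]
      refine hC p hp a b J hJ hcard hJθ c (fun i hi => ?_) j hj
      rw [← hpe]
      exact (abs_entry_le_norm _ _ _).trans (hc i hi)
    have : 0 ≤ B * c := by positivity
    nlinarith
  · obtain ⟨i, hi⟩ := hJne
    have hba : (b : ℝ) - a < L := by
      refine lt_of_le_of_lt ?_ hL
      rw [le_div_iff₀ hθ]
      have : (J.card : ℝ) ≤ D := by exact_mod_cast (by omega : J.card ≤ D)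
      linarith
    have hi' := Finset.mem_Ico.1 (hJ hi)
    have hj' := Finset.mem_Ico.1 hj
    have hbL : b < L + a := by
      have : (b : ℝ) < L + a := by linarith
      exact_mod_cast this
    have hkey : ‖cnj (w ^ j) Z‖ ≤ B * c := by
      rcases le_total i j with hij | hij
      · obtain ⟨k, rfl⟩ := Nat.exists_eq_add_of_le hij
        rw [add_comm, pow_add, cnj_mul]
        refine (norm_cnj_le _ _).trans ?_
        rw [mul_right_comm]
        exact mul_le_mul (hB k (by omega)) (hc i hi) (norm_nonneg _) hB0
      · obtain ⟨k, rfl⟩ := Nat.exists_eq_add_of_le hij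
        have : cnj (w ^ j) Z = cnj ((w ^ k)⁻¹) (cnj (w ^ (j + k)) Z) := by
          rw [← cnj_mul, add_comm j k, pow_add, inv_mul_cancel_left]
        rw [this]
        refine (norm_cnj_le _ _).trans ?_
        rw [inv_inv, mul_right_comm, mul_comm ‖(((w ^ k)⁻¹ : SLR n) : Matrix (Fin n) (Fin n) ℝ)‖]
        exact mul_le_mul (hB k (by omega)) (hc _ hi) (norm_nonneg _) hB0
    have : 0 ≤ n * C * c := by positivity
    nlinarith

end Conj

theorem exists_nhds_one_inv_mul_mem {G : Type*} [Group G] [TopologicalSpace G]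
    [IsTopologicalGroup G] {V : Set G} (hV : V ∈ 𝓝 (1 : G)) :
    ∃ U ∈ 𝓝 (1 : G), ∀ a ∈ U, ∀ b ∈ U, a⁻¹ * b ∈ V := by
  have h : Continuous (fun p : G × G => p.1⁻¹ * p.2) := by fun_prop
  have h' : Tendsto (fun p : G × G => p.1⁻¹ * p.2) (𝓝 (1, 1)) (𝓝 1) := by
    simpa using h.tendsto (1, 1)
  have h := h' hV
  rw [nhds_prod_eq, mem_map, mem_prod_same_iff] at h
  obtain ⟨U, hU, hUs⟩ := h
  exact ⟨U, hU, fun a ha b hb => hUs (mk_mem_prod ha hb)⟩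

theorem exists_bal_inv_mul_mem {n : ℕ} {r : ℝ} (hr : 0 < r) :
    ∃ η > 0, ∀ a ∈ bal n η, ∀ b ∈ bal n η, a⁻¹ * b ∈ bal n r := by
  obtain ⟨U, hU, h⟩ := exists_nhds_one_inv_mul_mem (bal_mem_nhds n hr)
  obtain ⟨η, hη, hηU⟩ := exists_bal_subset hU
  exact ⟨η, hη, fun a ha b hb => h a (hηU ha) b (hηU hb)⟩

/-- The elements whose conjugates by `1, w, …, w ^ (N - 1)` are `δ`-close to the identity. -/
def cnjBal {n : ℕ} (w : SLR n) (δ : ℝ) (N : ℕ) : Set (SLR n) :=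
  {g | ∀ j < N, w ^ j * g * (w ^ j)⁻¹ ∈ bal n δ}

section

variable {n : ℕ} {X : Type*} [TopologicalSpace X] [MeasurableSpace X] [MulAction (SLR n) X]
variable [HomSpace n X]

theorem eq_of_mem_Inj {r η : ℝ} (hη : ∀ a ∈ bal n η, ∀ b ∈ bal n η, a⁻¹ * b ∈ bal n r)
    {p : X} (hp : p ∈ Inj n X r) {a b : SLR n} (ha : a ∈ bal n η) (hb : b ∈ bal n η)
    (hab : a • p = b • p) : a = b := by
  have := hp _ (hη a ha b hb) (by rw [mul_smul, ← hab, inv_smul_smul])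
  exact inv_mul_eq_one.1 this

theorem exists_cnjBal (X : Type*) [TopologicalSpace X] [MeasurableSpace X] [MulAction (SLR n) X]
    [HomSpace n X] {w : SLR n} (hw : Unip w) {r δ₀ : ℝ} (hr : 0 < r) (hδ₀ : 0 < δ₀) :
    ∃ δ > 0, ∀ N > 0, ∀ (p q : X) (good : ℕ → Prop),
      (∀ j, good j → w ^ j • p ∈ Inj n X r ∧ (w ^ j • p, w ^ j • q) ∈ GRel X (bal n δ)) →
      7 * N ≤ 8 * (goodTimes good 0 N).card → (p, q) ∈ GRel X (cnjBal w δ₀ N) := by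
  obtain ⟨C, hC0, hC⟩ := hw.remez (θ := 1 / 16) (by norm_num)
  obtain ⟨η, hη0, hη⟩ := exists_bal_inv_mul_mem (n := n) hr
  obtain ⟨δ, hδ0, hδη, hCη, hCδ₀⟩ : ∃ δ > 0, δ ≤ η ∧ C * δ ≤ η ∧ C * δ ≤ δ₀ := by
    refine ⟨min η (min (η / C) (δ₀ / C)), by positivity, min_le_left _ _, ?_, ?_⟩
    · rw [mul_comm, ← le_div_iff₀ hC0]; exact (min_le_right _ _).trans (min_le_left _ _)
    · rw [mul_comm, ← le_div_iff₀ hC0]; exact (min_le_right _ _).trans (min_le_right _ _)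
  refine ⟨δ, hδ0, ?_⟩
  intro N hN p q good hgood hmany
  have hb : ∀ j, ∃ b : SLR n, good j → b ∈ bal n δ ∧ b • w ^ j • p = w ^ j • q := by
    intro j
    by_cases hj : good j
    · obtain ⟨b, hb, hbp⟩ := (hgood j hj).2
      exact ⟨b, fun _ => ⟨hb, hbp⟩⟩
    · exact ⟨1, fun h => (hj h).elim⟩
  choose b hb using hb
  let cls : ℕ → SLR n := fun j => (w ^ j)⁻¹ * b j * w ^ j
  have hclsconj : ∀ j, w ^ j * cls j * (w ^ j)⁻¹ = b j := fun j => by simp only [cls]; group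
  have hclsp : ∀ j, good j → cls j • p = q := fun j hj => by
    simp only [cls, mul_smul, (hb j hj).2, inv_smul_smul]
  have hbound : ∀ (g : SLR n) (a c : ℕ), (clsTimes good cls g a c).Nonempty →
      c - a ≤ 16 * (clsTimes good cls g a c).card → ∀ j ∈ Finset.Ico a c,
      w ^ j * g * (w ^ j)⁻¹ ∈ bal n (C * δ) := by
    intro g a c hne hcard j hj
    have hac : a ≤ c := (Finset.mem_Ico.1 hj).1.trans (Finset.mem_Ico.1 hj).2.le
    have := hC ((g : Matrix (Fin n) (Fin n) ℝ) - 1) a c (clsTimes good cls g a c)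
      (fun i hi => by simp only [clsTimes, Finset.mem_filter] at hi; exact hi.1) hne ?_ δ ?_ j hj
    · rwa [cnj_sub_one] at this
    · have h1 : ((c - a : ℕ) : ℝ) ≤ 16 * (clsTimes good cls g a c).card := by exact_mod_cast hcard
      rw [Nat.cast_sub hac] at h1
      linarith
    · intro i hi
      simp only [clsTimes, Finset.mem_filter] at hi
      rw [cnj_sub_one, ← hi.2.2, hclsconj]
      exact (hb i hi.2.1).1
  have hgp : ∀ (g : SLR n) (a c : ℕ), (clsTimes good cls g a c).Nonempty → g • p = q := by
    rintro g a c ⟨i, hi⟩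
    simp only [clsTimes, Finset.mem_filter] at hi
    rw [← hi.2.2]; exact hclsp i hi.2.1
  obtain ⟨g, hg⟩ := exists_dominated good cls (fun g a c hac hcard j hj hgj => by
    have hne : (clsTimes good cls g a c).Nonempty := by
      rw [← Finset.card_pos]; omega
    have h1 := hbound g a c hne (by omega) j hj
    have h2 : b j = w ^ j * g * (w ^ j)⁻¹ := by
      refine eq_of_mem_Inj hη (hgood j hgj).1 (bal_mono hδη (hb j hgj).1) (bal_mono hCη h1) ?_
      rw [(hb j hgj).2, mul_smul, mul_smul, inv_smul_smul, hgp g a c hne]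
    simp only [cls, h2]; group) N hN hmany
  have hne : (clsTimes good cls g 0 N).Nonempty := by
    rw [← Finset.card_pos]; omega
  exact ⟨g, fun j hj => bal_mono hCδ₀ (hbound g 0 N hne (by omega) j (by simpa using hj)),
    hgp g 0 N hne⟩

theorem measure_many_bad_le {Y : Type*} [MeasurableSpace Y] (μ : Measure Y) {bad : ℕ → Set Y}
    (hbad : ∀ j, MeasurableSet (bad j)) {N : ℕ} (hN : 0 < N) {ε : ENNReal}
    (h : ∑ j ∈ Finset.range N, μ (bad j) ≤ ε * N) :
    μ {x | 8 * (goodTimes (fun j => x ∉ bad j) 0 N).card < 7 * N} ≤ 8 * ε := by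
  classical
  let f : Y → ENNReal := fun x => ∑ j ∈ Finset.range N, (bad j).indicator 1 x
  have hf : Measurable f := by
    refine Finset.measurable_sum _ fun j _ => ?_
    exact measurable_one.indicator (hbad j)
  have hint : ∫⁻ x, f x ∂μ ≤ ε * N := by
    rw [lintegral_finsetSum _ fun j _ => measurable_one.indicator (hbad j)]
    simpa [lintegral_indicator_one (hbad _)] using h
  have hfx : ∀ x, f x = (((Finset.range N).filter fun j => x ∈ bad j).card : ENNReal) := by
    intro x
    simp only [f, Set.indicator_apply, Pi.one_apply]
    rw [Finset.sum_ite, Finset.sum_const_zero, add_zero, Finset.sum_const, nsmul_one]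
  have hsub : {x | 8 * (goodTimes (fun j => x ∉ bad j) 0 N).card < 7 * N} ⊆
      {x | (N : ENNReal) ≤ 8 * f x} := by
    intro x hx
    have hx : 8 * (goodTimes (fun j => x ∉ bad j) 0 N).card < 7 * N := hx
    have h1 := Finset.card_filter_add_card_filter_not (s := Finset.range N) (fun j => x ∈ bad j)
    have h2 : (goodTimes (fun j => x ∉ bad j) 0 N).card =
        ((Finset.range N).filter fun j => ¬ x ∈ bad j).card := by
      rw [goodTimes, ← Finset.range_eq_Ico]
      congr
    rw [Finset.card_range] at h1
    show (N : ENNReal) ≤ 8 * f x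
    rw [hfx]
    have : N ≤ 8 * ((Finset.range N).filter fun j => x ∈ bad j).card := by omega
    exact_mod_cast this
  have hmark := mul_meas_ge_le_lintegral (μ := μ) (f := fun x => 8 * f x) (hf.const_mul _)
    (N : ENNReal)
  rw [lintegral_const_mul _ hf] at hmark
  have hN0 : (N : ENNReal) ≠ 0 := by exact_mod_cast hN.ne'
  have h3 : (N : ENNReal) * μ {x | (N : ENNReal) ≤ 8 * f x} ≤ N * (8 * ε) :=
    hmark.trans ((mul_le_mul_right hint 8).trans (by rw [mul_comm (N : ENNReal), mul_assoc]))
  exact (measure_mono hsub).trans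
    ((ENNReal.mul_le_mul_iff_right hN0 (ENNReal.natCast_ne_top N)).1 h3)

end

theorem SL_ext {ι F : Type*} [Fintype ι] [DecidableEq ι] [CommRing F]
    {g h : Matrix.SpecialLinearGroup ι F} (e : (g : Matrix ι ι F) = (h : Matrix ι ι F)) : g = h :=
  Subtype.ext e

theorem diag2n_eq_mul_transvection {ι F : Type*} [Fintype ι] [DecidableEq ι] [Field F] {i j : ι}
    (hij : i ≠ j) (a : F) (ha : a ≠ 0) :
    SpecialLinearGroup.diag2n hij a ha = SpecialLinearGroup.transvection hij a *
      SpecialLinearGroup.transvection hij.symm (-a⁻¹) *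
      SpecialLinearGroup.transvection hij (a - 1) *
      SpecialLinearGroup.transvection hij.symm 1 * SpecialLinearGroup.transvection hij (-1) := by
  apply SL_ext
  have h : (SpecialLinearGroup.diag2n hij a ha : Matrix ι ι F) =
      1 + single i i (a - 1) + single j j (a⁻¹ - 1) := by
    refine (SpecialLinearGroup.diag2n_coe hij a ha).trans ?_
    ext k l
    simp only [diagonal_apply, Matrix.add_apply, Matrix.one_apply, Matrix.single_apply]
    by_cases hkl : k = l
    · subst hkl
      by_cases hi : i = k
      · subst hi; simp [hij.symm]
      · by_cases hj : j = k
        · subst hj; simp [hij, hij.symm]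
        · simp [hi, hj, Ne.symm hi, Ne.symm hj]
    · have h1 : ¬ (i = k ∧ i = l) := fun h => hkl (h.1.symm.trans h.2)
      have h2 : ¬ (j = k ∧ j = l) := fun h => hkl (h.1.symm.trans h.2)
      simp [hkl, h1, h2]
  rw [h]
  simp only [Matrix.SpecialLinearGroup.coe_mul, Matrix.SpecialLinearGroup.transvection_coe, mul_add, add_mul,
    one_mul, mul_one, single_mul_single_same, single_mul_single_of_ne _ _ _ _ hij,
    single_mul_single_of_ne _ _ _ _ hij.symm, add_zero]
  ext k l
  simp only [Matrix.add_apply, Matrix.one_apply, Matrix.single_apply]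
  generalize (if k = l then (1 : F) else 0) = z
  split_ifs <;> field_simp <;> ring

theorem SLR.eq_top_of_transvection_mem {n : ℕ} (hn : 2 ≤ n) (S : Subgroup (SLR n))
    (h : ∀ (i j : Fin n) (hij : i ≠ j) (a : ℝ), SpecialLinearGroup.transvection hij a ∈ S) :
    S = ⊤ := by
  have : Nontrivial (Fin n) := Fin.nontrivial_iff_two_le.2 hn
  refine (Subgroup.eq_top_iff' S).2 fun g => ?_
  refine SpecialLinearGroup.diagonal_transvection_induction' (fun g => g ∈ S) g ?_ h
    fun A B => S.mul_mem
  intro i j hij c hc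
  rw [diag2n_eq_mul_transvection]
  exact S.mul_mem (S.mul_mem (S.mul_mem (S.mul_mem (h _ _ _ _) (h _ _ _ _)) (h _ _ _ _))
    (h _ _ _ _)) (h _ _ _ _)

/-- Nonzero matrices `α βᵀ` with `βᵀ α = 0`. -/
def IsR1 {n : ℕ} (Y : Matrix (Fin n) (Fin n) ℝ) : Prop :=
  Y ≠ 0 ∧ ∃ α β : Fin n → ℝ, β ⬝ᵥ α = 0 ∧ Y = vecMulVec α β

theorem IsR1.mul_self {n : ℕ} {Y : Matrix (Fin n) (Fin n) ℝ} (h : IsR1 Y) : Y * Y = 0 := by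
  obtain ⟨-, α, β, h, rfl⟩ := h
  rw [vecMulVec_mul_vecMulVec, h]; simp

theorem det_one_add_vecMulVec {n : ℕ} (α β : Fin n → ℝ) :
    (1 + vecMulVec α β).det = 1 + β ⬝ᵥ α := by
  rw [vecMulVec_eq Unit, det_one_add_replicateCol_mul_replicateRow]

theorem IsR1.det_eq {n : ℕ} {Y : Matrix (Fin n) (Fin n) ℝ} (h : IsR1 Y) (t : ℝ) :
    (1 + t • Y).det = 1 := by
  obtain ⟨-, α, β, h, rfl⟩ := h
  rw [← smul_vecMulVec, det_one_add_vecMulVec, dotProduct_smul, h]; simp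

theorem isR1_single {n : ℕ} {i j : Fin n} (hij : i ≠ j) {a : ℝ} (ha : a ≠ 0) :
    IsR1 (single i j a) := by
  refine ⟨fun h => ha (by simpa using congr_fun (congr_fun h i) j), Pi.single i a, Pi.single j 1,
    ?_, ?_⟩
  · simp [hij.symm]
  · ext k l
    simp only [single_apply, vecMulVec_apply, Pi.single_apply]
    by_cases h1 : i = k <;> by_cases h2 : j = l <;> simp [h1, h2, eq_comm]

/-- An element of `SL(n,ℝ)` from a matrix of determinant one. -/
def SLR.of {n : ℕ} (M : Matrix (Fin n) (Fin n) ℝ) (h : M.det = 1) : SLR n := ⟨M, h⟩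

@[simp] theorem SLR.coe_of {n : ℕ} (M : Matrix (Fin n) (Fin n) ℝ) (h : M.det = 1) :
    (SLR.of M h : Matrix (Fin n) (Fin n) ℝ) = M := rfl

/-- The multiple of `M` of determinant `1`, if `0 < det M`. -/
noncomputable def toSL {n : ℕ} (M : Matrix (Fin n) (Fin n) ℝ) : SLR n :=
  if h : (M.det ^ (-(1 / n) : ℝ) • M).det = 1 then SLR.of _ h else 1

theorem det_rpow_smul {n : ℕ} (hn : n ≠ 0) {M : Matrix (Fin n) (Fin n) ℝ} (hM : 0 < M.det) :
    (M.det ^ (-(1 / n) : ℝ) • M).det = 1 := by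
  rw [det_smul, Fintype.card_fin, ← Real.rpow_natCast, ← Real.rpow_mul hM.le,
    neg_mul, one_div, inv_mul_cancel₀ (by exact_mod_cast hn), Real.rpow_neg_one,
    inv_mul_cancel₀ hM.ne']

theorem coe_toSL {n : ℕ} (hn : n ≠ 0) {M : Matrix (Fin n) (Fin n) ℝ} (hM : 0 < M.det) :
    (toSL M : Matrix (Fin n) (Fin n) ℝ) = M.det ^ (-(1 / n) : ℝ) • M := by
  rw [toSL, dif_pos (det_rpow_smul hn hM), SLR.coe_of]

theorem coe_toSL_of_det_eq_one {n : ℕ} {M : Matrix (Fin n) (Fin n) ℝ} (hM : M.det = 1) :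
    (toSL M : Matrix (Fin n) (Fin n) ℝ) = M := by
  have h : (M.det ^ (-(1 / n) : ℝ) • M).det = 1 := by simp [hM]
  rw [toSL, dif_pos h]; simp [hM]

theorem toSL_coe {n : ℕ} (g : SLR n) : toSL (g : Matrix (Fin n) (Fin n) ℝ) = g :=
  SL_ext (coe_toSL_of_det_eq_one g.2)

theorem IsR1.coe_toSL {n : ℕ} {Y : Matrix (Fin n) (Fin n) ℝ} (h : IsR1 Y) (t : ℝ) :
    (toSL (1 + t • Y) : Matrix (Fin n) (Fin n) ℝ) = 1 + t • Y :=
  coe_toSL_of_det_eq_one (h.det_eq t)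

theorem toSL_one_add_single {n : ℕ} {i j : Fin n} (hij : i ≠ j) (a : ℝ) :
    toSL (1 + single i j a) = SpecialLinearGroup.transvection hij a :=
  toSL_coe (SpecialLinearGroup.transvection hij a)

theorem continuousAt_toSL {n : ℕ} (hn : n ≠ 0) {M : Matrix (Fin n) (Fin n) ℝ} (hM : 0 < M.det) :
    ContinuousAt (toSL : _ → SLR n) M := by
  rw [(SLR.isClosedEmbedding_val n).isInducing.continuousAt_iff]
  have hd : ContinuousAt (fun M : Matrix (Fin n) (Fin n) ℝ => M.det) M := by fun_prop
  have h1 : ∀ᶠ M' in 𝓝 M, (M'.det ^ (-(1 / n) : ℝ)) • M' =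
      ((fun g : SLR n => (g : Matrix (Fin n) (Fin n) ℝ)) ∘ toSL) M' := by
    filter_upwards [hd.eventually_const_lt hM] with M' hM'
    exact (_root_.coe_toSL hn hM').symm
  refine ContinuousAt.congr ?_ h1
  exact (hd.rpow_const (Or.inl hM.ne')).smul continuousAt_id

theorem mul_toSL_mul_inv {n : ℕ} (g : SLR n) (M : Matrix (Fin n) (Fin n) ℝ) :
    g * toSL M * g⁻¹ = toSL (cnj g M) := by
  have hd : (cnj g M).det = M.det := by
    have h1 : (g : Matrix (Fin n) (Fin n) ℝ).det = 1 := g.2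
    have h2 : (↑g⁻¹ : Matrix (Fin n) (Fin n) ℝ).det = 1 := (g⁻¹).2
    rw [cnj, det_mul, det_mul, h1, h2]; simp
  have hd' : ∀ c : ℝ, (c • cnj g M).det = (c • M).det := fun c => by
    rw [det_smul, det_smul, hd]
  by_cases h : (M.det ^ (-(1 / n) : ℝ) • M).det = 1
  · have h' : ((cnj g M).det ^ (-(1 / n) : ℝ) • cnj g M).det = 1 := by rw [hd, hd', h]
    rw [toSL, dif_pos h, toSL, dif_pos h']
    apply SL_ext
    simp only [Matrix.SpecialLinearGroup.coe_mul, SLR.coe_of, cnj, Matrix.mul_smul,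
      Matrix.smul_mul]
    rw [← cnj, hd]
  · have h' : ¬ ((cnj g M).det ^ (-(1 / n) : ℝ) • cnj g M).det = 1 := by rwa [hd, hd']
    rw [toSL, dif_neg h, toSL, dif_neg h', mul_one]
    exact mul_inv_cancel g

theorem exists_dotProduct_eq_zero_two {n : ℕ} (hn : 3 ≤ n) (α α' : Fin n → ℝ) :
    ∃ β : Fin n → ℝ, β ≠ 0 ∧ β ⬝ᵥ α = 0 ∧ β ⬝ᵥ α' = 0 := by
  have h := LinearMap.ker_ne_bot_of_finrank_lt (f := (Matrix.of ![α, α']).mulVecLin)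
    (by simp; omega)
  obtain ⟨β, hβ, h0⟩ := Submodule.exists_mem_ne_zero_of_ne_bot h
  refine ⟨β, h0, ?_, ?_⟩
  · simpa [mulVec, dotProduct_comm] using congr_fun (LinearMap.mem_ker.1 hβ) 0
  · simpa [mulVec, dotProduct_comm] using congr_fun (LinearMap.mem_ker.1 hβ) 1

theorem exists_dotProduct_eq {n : ℕ} {α : Fin n → ℝ} (h : α ≠ 0) (c : ℝ) :
    ∃ β : Fin n → ℝ, β ⬝ᵥ α = c := by
  have : α ⬝ᵥ α ≠ 0 := fun h' => h (dotProduct_self_eq_zero.1 h')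
  exact ⟨(c / (α ⬝ᵥ α)) • α, by simp [this]⟩

theorem isR1_vecMulVec {n : ℕ} {α β : Fin n → ℝ} (hα : α ≠ 0) (hβ : β ≠ 0) (h : β ⬝ᵥ α = 0) :
    IsR1 (vecMulVec α β) :=
  ⟨fun h' => (vecMulVec_eq_zero.1 h').elim hα hβ, α, β, h, rfl⟩

/-- Any two matrices `α βᵀ` with `βᵀ α = 0` are linked by commutation relations if `3 ≤ n`. -/
theorem IsR1.chain {n : ℕ} (hn : 3 ≤ n) (P : Matrix (Fin n) (Fin n) ℝ → Prop)
    (step : ∀ Y X Y', IsR1 Y → IsR1 Y' → Y * Y' = 0 → Y' * Y = 0 →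
      (1 + Y) * X = (X + Y') * (1 + Y) → P Y → P Y')
    {Y Y' : Matrix (Fin n) (Fin n) ℝ} (hY : IsR1 Y) (hY' : IsR1 Y') (h : P Y) : P Y' := by
  obtain ⟨h0, α, β, hβα, rfl⟩ := hY
  obtain ⟨h0', α', β', hβα', rfl⟩ := hY'
  rw [Ne, vecMulVec_eq_zero, not_or] at h0 h0'
  have row : ∀ α β β' : Fin n → ℝ, α ≠ 0 → β ≠ 0 → β' ≠ 0 → β ⬝ᵥ α = 0 → β' ⬝ᵥ α = 0 →
      P (vecMulVec α β) → P (vecMulVec α β') := by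
    intro α β β' hα hβ hβ' h1 h2 hP
    obtain ⟨γ, hγ⟩ := exists_dotProduct_eq hβ 1
    refine step _ (vecMulVec γ β') _ (isR1_vecMulVec hα hβ h1) (isR1_vecMulVec hα hβ' h2)
      ?_ ?_ ?_ hP
    · simp [vecMulVec_mul_vecMulVec, h1]
    · simp [vecMulVec_mul_vecMulVec, h2]
    · rw [dotProduct_comm] at hγ
      simp [add_mul, mul_add, vecMulVec_mul_vecMulVec, hγ, h2]
  have col : ∀ α β α' : Fin n → ℝ, α ≠ 0 → β ≠ 0 → α' ≠ 0 → β ⬝ᵥ α = 0 → β ⬝ᵥ α' = 0 →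
      P (vecMulVec α β) → P (vecMulVec α' β) := by
    intro α β α' hα hβ hα' h1 h2 hP
    obtain ⟨δ, hδ⟩ := exists_dotProduct_eq hα (-1)
    refine step _ (vecMulVec α' δ) _ (isR1_vecMulVec hα hβ h1) (isR1_vecMulVec hα' hβ h2)
      ?_ ?_ ?_ hP
    · simp [vecMulVec_mul_vecMulVec, h2]
    · simp [vecMulVec_mul_vecMulVec, h1]
    · simp [add_mul, mul_add, vecMulVec_mul_vecMulVec, hδ, h2, h1]
  obtain ⟨b, hb, h1, h2⟩ := exists_dotProduct_eq_zero_two hn α α'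
  exact row _ _ _ h0'.1 hb h0'.2 h2 hβα' (col _ _ _ h0.1 hb h0'.1 h1 h2
    (row _ _ _ h0.1 h0.2 hb hβα h1 h))

theorem SLR.tendsto_iff {n : ℕ} {ι : Type*} {l : Filter ι} {g : ι → SLR n} {y : SLR n} :
    Tendsto g l (𝓝 y) ↔ ∀ i j, Tendsto (fun k => (g k : Matrix (Fin n) (Fin n) ℝ) i j) l
      (𝓝 ((y : Matrix (Fin n) (Fin n) ℝ) i j)) := by
  rw [(SLR.isClosedEmbedding_val n).isInducing.tendsto_nhds_iff]
  exact tendsto_pi_nhds.trans (forall_congr' fun i => tendsto_pi_nhds)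

theorem tendsto_toSL_one_add {n : ℕ} (hn : n ≠ 0) {ι : Type*} {l : Filter ι}
    {M : ι → Matrix (Fin n) (Fin n) ℝ} {L : Matrix (Fin n) (Fin n) ℝ}
    (h : Tendsto M l (𝓝 L)) (hL : L.det = 1) : Tendsto (fun k => toSL (M k)) l (𝓝 (toSL L)) :=
  (continuousAt_toSL hn (by rw [hL]; exact one_pos)).tendsto.comp h

theorem toSL_one {n : ℕ} : toSL (1 : Matrix (Fin n) (Fin n) ℝ) = 1 := toSL_coe 1

theorem cnj_add {n : ℕ} (g : SLR n) (A B : Matrix (Fin n) (Fin n) ℝ) :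
    cnj g (A + B) = cnj g A + cnj g B := by simp [cnj, mul_add, add_mul]

theorem cnj_smul {n : ℕ} (g : SLR n) (c : ℝ) (A : Matrix (Fin n) (Fin n) ℝ) :
    cnj g (c • A) = c • cnj g A := by simp [cnj]

theorem cnj_one {n : ℕ} (g : SLR n) : cnj g 1 = 1 := by
  rw [cnj, mul_one, SLR.coe_mul_coe_inv]

theorem cnj_one_left {n : ℕ} (A : Matrix (Fin n) (Fin n) ℝ) : cnj (1 : SLR n) A = A := by
  have : (↑(1 : SLR n)⁻¹ : Matrix (Fin n) (Fin n) ℝ) = 1 := by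
    rw [_root_.inv_one]; rfl
  rw [cnj, this]; simp

theorem cnj_eq_iff {n : ℕ} (g : SLR n) (A B : Matrix (Fin n) (Fin n) ℝ) :
    cnj g A = B ↔ (g : Matrix (Fin n) (Fin n) ℝ) * A = B * g := by
  constructor
  · rintro rfl
    rw [cnj, mul_assoc, mul_assoc, SLR.coe_inv_mul_coe, mul_one]
  · intro h
    rw [cnj, h, mul_assoc, SLR.coe_mul_coe_inv, mul_one]

/-- If `g X g⁻¹ = X + Y` and `Y` commutes with `g`, then `g ^ j X g ^ (-j) = X + j Y`. -/
theorem cnj_pow_eq {n : ℕ} {g : SLR n} {X Y : Matrix (Fin n) (Fin n) ℝ}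
    (hX : cnj g X = X + Y) (hY : cnj g Y = Y) (j : ℕ) : cnj (g ^ j) X = X + (j : ℝ) • Y := by
  induction j with
  | zero => rw [pow_zero, cnj_one_left]; simp
  | succ j ih =>
    rw [pow_succ', cnj_mul, ih, cnj_add, cnj_smul, hX, hY, Nat.cast_succ, add_smul, one_smul]
    abel

/-- The shearing computation behind Mautner's lemma. -/
theorem pow_mul_toSL_mul_inv {n : ℕ} {g : SLR n} {X Y : Matrix (Fin n) (Fin n) ℝ}
    (hX : cnj g X = X + Y) (hY : cnj g Y = Y) (j : ℕ) (t : ℝ) :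
    g ^ j * toSL (1 + t • X) * (g ^ j)⁻¹ = toSL (1 + t • X + (t * j) • Y) := by
  rw [mul_toSL_mul_inv, cnj_add, cnj_smul, cnj_one, cnj_pow_eq hX hY, smul_add, smul_smul,
    add_assoc]

theorem tendsto_shear {n : ℕ} (hn : n ≠ 0) {g : SLR n} {X Y : Matrix (Fin n) (Fin n) ℝ}
    (hX : cnj g X = X + Y) (hY : cnj g Y = Y) (hR : IsR1 Y) (t : ℝ) :
    Tendsto (fun j : ℕ => toSL (1 + (t / j) • X)) atTop (𝓝 1) ∧
    Tendsto (fun j : ℕ => g ^ j * toSL (1 + (t / j) • X) * (g ^ j)⁻¹) atTop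
      (𝓝 (toSL (1 + t • Y))) := by
  have h0 : Tendsto (fun j : ℕ => (1 : Matrix (Fin n) (Fin n) ℝ) + (t / j) • X) atTop (𝓝 1) := by
    simpa using tendsto_const_nhds.add
      ((tendsto_const_div_atTop_nhds_zero_nat t).smul_const X)
  constructor
  · rw [← toSL_one]
    exact tendsto_toSL_one_add hn h0 det_one
  · simp_rw [pow_mul_toSL_mul_inv hX hY]
    refine tendsto_toSL_one_add hn ?_ (hR.det_eq t)
    have : ∀ᶠ j : ℕ in atTop, (1 : Matrix (Fin n) (Fin n) ℝ) + (t / j) • X + t • Y =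
        1 + (t / j) • X + (t / j * j) • Y := by
      filter_upwards [eventually_gt_atTop 0] with j hj
      rw [div_mul_cancel₀ _ (by exact_mod_cast hj.ne')]
    exact (h0.add tendsto_const_nhds).congr' this

/-- Subgroups to which Mautner's argument applies, such as stabilizers of vectors in unitary
representations. -/
def IsMautner {n : ℕ} (S : Subgroup (SLR n)) : Prop :=
  ∀ (s g t : ℕ → SLR n) (y : SLR n), (∀ j, s j ∈ S) → (∀ j, t j ∈ S) →
    Tendsto g atTop (𝓝 1) → Tendsto (fun j => s j * g j * t j) atTop (𝓝 y) → y ∈ S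

theorem IsMautner.shear {n : ℕ} (hn : n ≠ 0) {S : Subgroup (SLR n)} (hS : IsMautner S) {u : SLR n}
    (hu : u ∈ S) {X Y : Matrix (Fin n) (Fin n) ℝ}
    (hX : cnj u X = X + Y) (hY : cnj u Y = Y) (hR : IsR1 Y) (t : ℝ) : toSL (1 + t • Y) ∈ S := by
  obtain ⟨h1, h2⟩ := tendsto_shear hn hX hY hR t
  exact hS _ _ _ _ (fun j => S.pow_mem hu j) (fun j => S.inv_mem (S.pow_mem hu j)) h1 h2

theorem IsR1.smul {n : ℕ} {Y : Matrix (Fin n) (Fin n) ℝ} (h : IsR1 Y) {c : ℝ} (hc : c ≠ 0) :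
    IsR1 (c • Y) := by
  obtain ⟨h0, α, β, h1, rfl⟩ := h
  refine ⟨smul_ne_zero hc h0, c • α, β, ?_, ?_⟩
  · rw [dotProduct_smul, h1, smul_zero]
  · rw [smul_vecMulVec]

theorem IsR1.cnj {n : ℕ} {Y : Matrix (Fin n) (Fin n) ℝ} (h : IsR1 Y) (g : SLR n) :
    IsR1 (cnj g Y) := by
  obtain ⟨h0, α, β, h1, rfl⟩ := h
  refine ⟨fun h => h0 ?_, (g : Matrix (Fin n) (Fin n) ℝ) *ᵥ α,
    β ᵥ* (↑g⁻¹ : Matrix (Fin n) (Fin n) ℝ), ?_, ?_⟩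
  · rw [cnj_eq_iff, zero_mul] at h
    have := congr_arg (fun M => (↑g⁻¹ : Matrix (Fin n) (Fin n) ℝ) * M) h
    rwa [← mul_assoc, SLR.coe_inv_mul_coe, one_mul, mul_zero] at this
  · rw [← dotProduct_mulVec, mulVec_mulVec, SLR.coe_inv_mul_coe, one_mulVec, h1]
  · rw [_root_.cnj, mul_vecMulVec, vecMulVec_mul]

theorem IsMautner.eq_top_of_three_le {n : ℕ} (hn : 3 ≤ n) {S : Subgroup (SLR n)}
    (hS : IsMautner S) {Y : Matrix (Fin n) (Fin n) ℝ} (hY : IsR1 Y)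
    (h : ∀ t : ℝ, toSL (1 + t • Y) ∈ S) : S = ⊤ := by
  refine SLR.eq_top_of_transvection_mem (by omega) S fun i j hij a => ?_
  have key : ∀ t : ℝ, toSL (1 + t • single i j (1 : ℝ)) ∈ S := by
    refine IsR1.chain hn (fun Y => ∀ t : ℝ, toSL (1 + t • Y) ∈ S) ?_ hY
      (isR1_single hij one_ne_zero) h
    intro Y X Y' hY hY' h1 h2 h3 hP t
    have hu : (toSL (1 + Y) : Matrix (Fin n) (Fin n) ℝ) = 1 + Y := by
      simpa using hY.coe_toSL 1
    refine hS.shear (u := toSL (1 + Y)) (by omega) (by simpa using hP 1) (X := X) ?_ ?_ hY' t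
    · rw [cnj_eq_iff, hu, h3]
    · rw [cnj_eq_iff, hu, mul_add, add_mul, h1, h2]; simp
  have := key a
  rwa [smul_single, smul_eq_mul, mul_one, toSL_one_add_single] at this

theorem IsR1.conj_two {Y : Matrix (Fin 2) (Fin 2) ℝ} (h : IsR1 Y) :
    ∃ (g : SLR 2) (c : ℝ), c ≠ 0 ∧ Y = c • _root_.cnj g (single 0 1 1) := by
  obtain ⟨h0, α, β, h1, rfl⟩ := h
  rw [Ne, vecMulVec_eq_zero, not_or] at h0
  set r := α 0 ^ 2 + α 1 ^ 2 with hr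
  have hr0 : r ≠ 0 := by
    intro h
    apply h0.1
    ext k; fin_cases k
    · show α 0 = 0
      nlinarith [sq_nonneg (α 0), sq_nonneg (α 1)]
    · show α 1 = 0
      nlinarith [sq_nonneg (α 0), sq_nonneg (α 1)]
  simp only [dotProduct, Fin.sum_univ_two] at h1
  have hdet : (!![α 0, -α 1 / r; α 1, α 0 / r] : Matrix (Fin 2) (Fin 2) ℝ).det = 1 := by
    rw [det_fin_two_of]; field_simp; rw [hr]; ring
  have hY : vecMulVec α β = ((β 1 * α 0 - β 0 * α 1) / r) •
      _root_.cnj (SLR.of _ hdet) (single 0 1 1) := by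
    have hs : (single 0 1 1 : Matrix (Fin 2) (Fin 2) ℝ) = !![0, 1; 0, 0] := by
      ext k l; fin_cases k <;> fin_cases l <;> simp [single_apply]
    rw [_root_.cnj, Matrix.SpecialLinearGroup.coe_inv, SLR.coe_of, adjugate_fin_two_of, hs]
    have e1 : β 0 * r = -(β 1 * α 0 - β 0 * α 1) * α 1 := by
      rw [hr]; linear_combination (α 0) * h1
    have e2 : β 1 * r = (β 1 * α 0 - β 0 * α 1) * α 0 := by
      rw [hr]; linear_combination (α 1) * h1
    ext k l
    fin_cases k <;> fin_cases l <;>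
      simp [vecMulVec_apply, Matrix.mul_apply, Fin.sum_univ_two, single_apply] <;> field_simp
    · linear_combination α 0 * e1
    · linear_combination α 0 * e2
    · linear_combination α 1 * e1
    · linear_combination α 1 * e2
  refine ⟨SLR.of _ hdet, _, fun hc => ?_, hY⟩
  rw [hc, zero_smul, vecMulVec_eq_zero] at hY
  exact hY.elim h0.1 h0.2

theorem IsMautner.eq_top_two_aux {S : Subgroup (SLR 2)} (hS : IsMautner S)
    (h : ∀ t : ℝ, SpecialLinearGroup.transvection (zero_ne_one : (0 : Fin 2) ≠ 1) t ∈ S) :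
    S = ⊤ := by
  have hdet : ∀ a : ℝ, a ≠ 0 → (!![a, 0; 0, a⁻¹] : Matrix (Fin 2) (Fin 2) ℝ).det = 1 := by
    intro a ha; rw [det_fin_two_of]; field_simp; ring
  have hlow : ∀ s : ℝ, (!![1, 0; s, 1] : Matrix (Fin 2) (Fin 2) ℝ).det = 1 := by
    intro a; rw [det_fin_two_of]; ring
  have hup : ∀ s : ℝ, (!![1, s; 0, 1] : Matrix (Fin 2) (Fin 2) ℝ).det = 1 := by
    intro a; rw [det_fin_two_of]; ring
  have hup' : ∀ s, SLR.of _ (hup s) ∈ S := by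
    intro s
    convert h s using 1
    apply SL_ext
    ext k l
    fin_cases k <;> fin_cases l <;> simp [SpecialLinearGroup.transvection_coe, single_apply]
  have hdiag : ∀ a : ℝ, ∀ ha : a ≠ 0, SLR.of _ (hdet a ha) ∈ S := by
    intro a ha
    refine hS (fun j => SLR.of _ (hup ((a - 1) * (j + 1)))) (fun j => SLR.of _ (hlow (1 / (j + 1))))
      (fun j => SLR.of _ (hup (-((a - 1) * (j + 1)) / a))) _ (fun j => hup' _) (fun j => hup' _)
      ?_ ?_
    · rw [SLR.tendsto_iff]
      intro k l
      fin_cases k <;> fin_cases l <;> simp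
      simpa using tendsto_one_div_add_atTop_nhds_zero_nat (𝕜 := ℝ)
    · have e : ∀ j : ℕ, ((SLR.of _ (hup ((a - 1) * (j + 1))) * SLR.of _ (hlow (1 / (j + 1))) *
          SLR.of _ (hup (-((a - 1) * (j + 1)) / a)) : SLR 2) : Matrix (Fin 2) (Fin 2) ℝ) =
          !![a, 0; 1 / ((j : ℝ) + 1), a⁻¹] := by
        intro j
        have : (j : ℝ) + 1 ≠ 0 := by positivity
        simp only [Matrix.SpecialLinearGroup.coe_mul, SLR.coe_of]
        ext k l
        fin_cases k <;> fin_cases l <;> simp [Matrix.mul_apply, Fin.sum_univ_two] <;> field_simp <;>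
          ring
      rw [SLR.tendsto_iff]
      simp only [e]
      intro k l
      fin_cases k <;> fin_cases l <;> simp
      simpa using tendsto_one_div_add_atTop_nhds_zero_nat (𝕜 := ℝ)
  have hlow' : ∀ s, SLR.of _ (hlow s) ∈ S := by
    intro s
    have h2 : ∀ j : ℕ, ((2 : ℝ) ^ j) ≠ 0 := fun j => by positivity
    refine hS (fun j => (SLR.of _ (hdet _ (h2 j)))⁻¹) (fun j => SLR.of _ (hlow (s * (1 / 4) ^ j)))
      (fun j => SLR.of _ (hdet _ (h2 j))) _ (fun j => S.inv_mem (hdiag _ (h2 j)))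
      (fun j => hdiag _ (h2 j))
      ?_ ?_
    · rw [SLR.tendsto_iff]
      intro k l
      fin_cases k <;> fin_cases l <;> simp
      simpa using (tendsto_pow_atTop_nhds_zero_of_lt_one (r := (1 / 4 : ℝ)) (by norm_num)
        (by norm_num)).const_mul s
    · have e : ∀ j : ℕ, (SLR.of _ (hdet _ (h2 j)))⁻¹ * SLR.of _ (hlow (s * (1 / 4) ^ j)) *
          SLR.of _ (hdet _ (h2 j)) = SLR.of _ (hlow s) := by
        intro j
        apply SL_ext
        simp only [Matrix.SpecialLinearGroup.coe_mul, SLR.coe_of,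
          Matrix.SpecialLinearGroup.coe_inv, adjugate_fin_two_of]
        have : (4 : ℝ) ^ j = 2 ^ j * 2 ^ j := by rw [← mul_pow]; norm_num
        ext k l
        fin_cases k <;> fin_cases l <;> simp [Matrix.mul_apply, Fin.sum_univ_two, this]
        field_simp
      simp only [e]
      exact tendsto_const_nhds
  refine SLR.eq_top_of_transvection_mem le_rfl S fun i j hij a => ?_
  fin_cases i <;> fin_cases j
  · exact absurd rfl hij
  · exact h a
  · convert hlow' a using 1
    apply SL_ext
    ext k l
    fin_cases k <;> fin_cases l <;> simp [SpecialLinearGroup.transvection_coe, single_apply]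
  · exact absurd rfl hij

theorem IsMautner.comap_conj {n : ℕ} {S : Subgroup (SLR n)} (hS : IsMautner S) (p : SLR n) :
    IsMautner (S.comap (MulAut.conj p).toMonoidHom) := by
  intro s g t y hs ht hg hy
  refine hS (fun j => p * s j * p⁻¹) (fun j => p * g j * p⁻¹) (fun j => p * t j * p⁻¹) _ hs ht ?_ ?_
  · simpa using (hg.const_mul p).mul_const p⁻¹
  · have := (hy.const_mul p).mul_const p⁻¹
    refine this.congr fun j => ?_
    group

theorem IsMautner.eq_top {n : ℕ} (hn : 2 ≤ n) {S : Subgroup (SLR n)}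
    (hS : IsMautner S) {Y : Matrix (Fin n) (Fin n) ℝ} (hY : IsR1 Y)
    (h : ∀ t : ℝ, toSL (1 + t • Y) ∈ S) : S = ⊤ := by
  rcases hn.eq_or_lt with rfl | hn
  · obtain ⟨p, c, hc, rfl⟩ := hY.conj_two
    have h1 : S.comap (MulAut.conj p).toMonoidHom = ⊤ := by
      refine (hS.comap_conj p).eq_top_two_aux fun t => ?_
      rw [← toSL_one_add_single]
      have := h (t / c)
      rw [smul_smul, div_mul_cancel₀ _ hc, ← cnj_smul] at this
      show p * toSL _ * p⁻¹ ∈ S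
      rw [mul_toSL_mul_inv, cnj_add, cnj_one]
      simpa using this
    refine (Subgroup.eq_top_iff' S).2 fun g => ?_
    have h2 : p⁻¹ * g * p ∈ S.comap (MulAut.conj p).toMonoidHom := h1 ▸ Subgroup.mem_top _
    have h3 : p * (p⁻¹ * g * p) * p⁻¹ ∈ S := h2
    convert h3 using 1
    group
  · exact hS.eq_top_of_three_le hn hY h

theorem Unip.exists_shear {n : ℕ} {u : SLR n} (hu : Unip u) (h1 : u ≠ 1) :
    ∃ X Y : Matrix (Fin n) (Fin n) ℝ, IsR1 Y ∧ cnj u X = X + Y ∧ cnj u Y = Y := by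
  set N : Matrix (Fin n) (Fin n) ℝ := (u : Matrix (Fin n) (Fin n) ℝ) - 1 with hN
  have hN0 : N ≠ 0 := fun h => h1 (SL_ext (by
    rw [hN, sub_eq_zero] at h
    exact h))
  have hu' : (u : Matrix (Fin n) (Fin n) ℝ) = 1 + N := by rw [hN]; abel
  obtain ⟨s, hs1, hs2⟩ : ∃ s, N ^ (s + 1) ≠ 0 ∧ N ^ (s + 2) = 0 := by
    classical
    have hnil : ∃ k, N ^ k = 0 := hu
    have h0 : Nat.find hnil ≠ 0 := fun h => by
      have := Nat.find_spec hnil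
      rw [h, pow_zero] at this
      exact hN0 (by rw [← mul_one N, this, mul_zero])
    have h1 : Nat.find hnil ≠ 1 := fun h => by
      have := Nat.find_spec hnil
      rw [h, pow_one] at this
      exact hN0 this
    obtain ⟨s, hs⟩ : ∃ s, Nat.find hnil = s + 2 := ⟨Nat.find hnil - 2, by omega⟩
    refine ⟨s, Nat.find_min hnil (by omega), ?_⟩
    rw [← hs]; exact Nat.find_spec hnil
  obtain ⟨p, q, hpq⟩ : ∃ p q, (N ^ (s + 1)) p q ≠ 0 := by
    by_contra h
    push Not at h
    exact hs1 (by ext p q; exact h p q)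
  set M := N ^ (s + 1) with hM
  have hNM : N * M = 0 := by rw [hM, ← pow_succ', hs2]
  have hMN : M * N = 0 := by rw [hM, ← pow_succ, hs2]
  have hMM : M * M = 0 := by
    have h : M = N ^ s * N := pow_succ N s
    calc M * M = N ^ s * (N * M) := by rw [← mul_assoc, ← h]
      _ = 0 := by rw [hNM, mul_zero]
  set Z : Matrix (Fin n) (Fin n) ℝ := single q p 1 with hZ
  have hMZM : M * Z * M = vecMulVec (fun k => M k q) (fun l => M p l) := by
    ext k l
    simp [hZ, vecMulVec_apply, Matrix.mul_apply, single_apply, ite_and]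
  have hY : IsR1 (M * Z * M) := by
    refine ⟨fun h => ?_, _, _, ?_, hMZM⟩
    · have := congr_fun (congr_fun h p) q
      rw [hMZM, vecMulVec_apply] at this
      exact hpq (mul_self_eq_zero.1 this)
    · have := congr_fun (congr_fun hMM p) q
      simpa [Matrix.mul_apply, dotProduct] using this
  refine ⟨M * Z * N ^ s - N ^ s * Z * M, (-2 : ℝ) • (M * Z * M), hY.smul (by norm_num), ?_, ?_⟩
  · have e1 : N * N ^ s = M := (pow_succ' N s).symm
    have e2 : N ^ s * N = M := (pow_succ N s).symm
    rw [cnj_eq_iff, hu']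
    have a1 : N * (M * Z * N ^ s) = 0 := by rw [mul_assoc, ← mul_assoc N, hNM, zero_mul]
    have a2 : N * (N ^ s * Z * M) = M * Z * M := by rw [mul_assoc, ← mul_assoc N, e1, mul_assoc]
    have a3 : M * Z * N ^ s * N = M * Z * M := by rw [mul_assoc, e2]
    have a4 : N ^ s * Z * M * N = 0 := by rw [mul_assoc, hMN, mul_zero]
    have a5 : M * Z * M * N = 0 := by rw [mul_assoc, hMN, mul_zero]
    simp only [add_mul, mul_add, sub_mul, mul_sub, one_mul, mul_one, a1, a2, a3, a4, a5,
      Matrix.smul_mul, smul_zero]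
    module
  · rw [cnj_eq_iff, hu']
    have a5 : M * Z * M * N = 0 := by rw [mul_assoc, hMN, mul_zero]
    have a6 : N * (M * Z * M) = 0 := by rw [mul_assoc, ← mul_assoc N, hNM, zero_mul]
    simp only [add_mul, mul_add, one_mul, mul_one, a5, a6, Matrix.smul_mul, Matrix.mul_smul,
      smul_zero]

section rep
variable {n : ℕ} {H : Type*} [NormedAddCommGroup H] [InnerProductSpace ℝ H] [CompleteSpace H]

local notation "⟪" x ", " y "⟫" => inner ℝ x y

theorem exists_weak_limit {ι : Type*} (𝒰 : Ultrafilter ι) (x : ι → H) (C : ℝ)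
    (hx : ∀ i, ‖x i‖ ≤ C) : ∃ v : H, ∀ w, Tendsto (fun i => ⟪x i, w⟫) 𝒰 (𝓝 ⟪v, w⟫) := by
  have hK := WeakDual.isCompact_closedBall (𝕜 := ℝ) (E := H) 0 C
  let y : ι → WeakDual ℝ H := fun i => StrongDual.toWeakDual (InnerProductSpace.toDual ℝ H (x i))
  obtain ⟨ℓ, -, hℓ⟩ := hK.ultrafilter_le_nhds (𝒰.map y) (by
    refine le_principal_iff.2 (Filter.mem_map.2 (Filter.univ_mem' fun i => ?_))
    have : ‖InnerProductSpace.toDual ℝ H (x i)‖ ≤ C := by simpa using hx i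
    simpa [y] using this)
  refine ⟨(InnerProductSpace.toDual ℝ H).symm (WeakDual.toStrongDual ℓ), fun w => ?_⟩
  have h2 : Tendsto (fun i => (y i) w) 𝒰 (𝓝 (ℓ w)) :=
    ((WeakDual.eval_continuous w).tendsto ℓ).comp hℓ
  simpa [y] using h2

theorem isMautner_stabilizer (π : SLR n → H →ₗᵢ[ℝ] H) (h1 : ∀ v, π 1 v = v)
    (hmul : ∀ g h v, π (g * h) v = π g (π h v)) (hc : ∀ v, Continuous fun g => π g v) (v : H)
    (S : Subgroup (SLR n)) (hS : ∀ g, g ∈ S ↔ π g v = v) : IsMautner S := by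
  intro s g t y hs ht hg hy
  rw [hS]
  have a1 : Tendsto (fun j => ‖π (s j * g j * t j) v - v‖) atTop (𝓝 ‖π y v - v‖) :=
    ((((hc v).tendsto y).comp hy).sub_const v).norm
  have a2 : Tendsto (fun j => ‖π (g j) v - v‖) atTop (𝓝 ‖π 1 v - v‖) :=
    ((((hc v).tendsto 1).comp hg).sub_const v).norm
  have e : ∀ j, ‖π (s j * g j * t j) v - v‖ = ‖π (g j) v - v‖ := by
    intro j
    rw [hmul, (hS _).1 (ht j), hmul, ← (π (s j)).norm_map (π (g j) v - v), map_sub,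
      (hS _).1 (hs j)]
  simp only [e] at a1
  have := tendsto_nhds_unique a1 a2
  rw [h1, sub_self, norm_zero, norm_eq_zero, sub_eq_zero] at this
  exact this

theorem inner_rep_right (π : SLR n → H →ₗᵢ[ℝ] H) (h1 : ∀ v, π 1 v = v)
    (hmul : ∀ g h v, π (g * h) v = π g (π h v)) (g : SLR n) (v w : H) :
    ⟪π g v, w⟫ = ⟪v, π g⁻¹ w⟫ := by
  have : w = π g (π g⁻¹ w) := by rw [← hmul, mul_inv_cancel, h1]
  conv_lhs => rw [this]
  rw [(π g).inner_map_map]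

/-- Weak limits of `π (u ^ j) f`, with `u` unipotent, are invariant. -/
theorem exists_invariant_weak_limit (hn : 2 ≤ n) (π : SLR n → H →ₗᵢ[ℝ] H) (h1 : ∀ v, π 1 v = v)
    (hmul : ∀ g h v, π (g * h) v = π g (π h v)) (hc : ∀ v, Continuous fun g => π g v)
    {u : SLR n} (hu : Unip u) (hu1 : u ≠ 1) (𝒰 : Ultrafilter ℕ) (hU : (𝒰 : Filter ℕ) ≤ atTop)
    (f : H) : ∃ v : H, (∀ g, π g v = v) ∧
      ∀ w, Tendsto (fun j => ⟪π (u ^ j) f, w⟫) 𝒰 (𝓝 ⟪v, w⟫) := by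
  obtain ⟨v, hv⟩ := exists_weak_limit 𝒰 (fun j => π (u ^ j) f) ‖f‖
    (fun j => ((π (u ^ j)).norm_map f).le)
  refine ⟨v, ?_, hv⟩
  let S : Subgroup (SLR n) :=
    { carrier := {g | π g v = v}
      one_mem' := h1 v
      mul_mem' := fun {a b} ha hb => by
        change π (a * b) v = v
        rw [hmul, show π b v = v from hb, show π a v = v from ha]
      inv_mem' := fun {a} ha => by
        change π a⁻¹ v = v
        conv_lhs => rw [← show π a v = v from ha, ← hmul, inv_mul_cancel, h1] }
  have hS : ∀ g, g ∈ S ↔ π g v = v := fun g => Iff.rfl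
  have hM := isMautner_stabilizer π h1 hmul hc v S hS
  obtain ⟨X, Y, hY, hX1, hY1⟩ := hu.exists_shear hu1
  have : S = ⊤ := by
    refine hM.eq_top hn hY fun t => ?_
    rw [hS]
    obtain ⟨g0, g1⟩ := tendsto_shear (by omega) hX1 hY1 hY t
    set y := toSL (1 + t • Y)
    set g := fun j : ℕ => toSL (1 + (t / j) • X)
    refine ext_inner_right ℝ fun w => ?_
    have b1 : Tendsto (fun j => ⟪π (u ^ j * g j * (u ^ j)⁻¹) (π (u ^ j) f), w⟫) 𝒰
        (𝓝 ⟪π y v, w⟫) := by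
      have c1 : Tendsto (fun j => ⟪π (u ^ j) f, π y⁻¹ w⟫) 𝒰 (𝓝 ⟪π y v, w⟫) := by
        rw [inner_rep_right π h1 hmul]; exact hv _
      have c2 : Tendsto (fun j => ⟪π (u ^ j) f, π (u ^ j * g j * (u ^ j)⁻¹)⁻¹ w - π y⁻¹ w⟫) 𝒰
          (𝓝 0) := by
        have d : Tendsto (fun j => π (u ^ j * g j * (u ^ j)⁻¹)⁻¹ w - π y⁻¹ w) 𝒰 (𝓝 0) := by
          have := ((((hc w).tendsto y⁻¹).comp (g1.inv)).mono_left hU).sub_const (π y⁻¹ w)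
          rwa [sub_self] at this
        have d' := d.norm.const_mul ‖f‖
        rw [norm_zero, mul_zero] at d'
        refine squeeze_zero_norm (fun j => ?_) d'
        refine (norm_inner_le_norm _ _).trans ?_
        rw [(π (u ^ j)).norm_map]
      have := c1.add c2
      rw [add_zero] at this
      refine this.congr fun j => ?_
      rw [← inner_add_right, add_sub_cancel, ← inner_rep_right π h1 hmul]
    have b2 : Tendsto (fun j => ⟪π (u ^ j * g j * (u ^ j)⁻¹) (π (u ^ j) f), w⟫) 𝒰
        (𝓝 ⟪v, w⟫) := by
      have c2 : Tendsto (fun j => ⟪π (u ^ j) (π (g j) f - f), w⟫) 𝒰 (𝓝 0) := by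
        have d : Tendsto (fun j => π (g j) f - f) 𝒰 (𝓝 0) := by
          have := ((((hc f).tendsto 1).comp g0).mono_left hU).sub_const f
          rwa [h1, sub_self] at this
        have d' := d.norm.mul_const ‖w‖
        rw [norm_zero, zero_mul] at d'
        refine squeeze_zero_norm (fun j => ?_) d'
        refine (norm_inner_le_norm _ _).trans ?_
        rw [(π (u ^ j)).norm_map]
      have := (hv w).add c2
      rw [add_zero] at this
      refine this.congr fun j => ?_
      rw [← inner_add_left, map_sub, add_sub_cancel, ← hmul, ← hmul, inv_mul_cancel_right]
    exact tendsto_nhds_unique b1 b2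
  intro g
  exact (hS g).1 (this ▸ Subgroup.mem_top g)

end rep

variable {n : ℕ} {X : Type*} [TopologicalSpace X] [MeasurableSpace X] [MulAction (SLR n) X]
  [HomSpace n X]

theorem measurable_smul_prod : Measurable (fun p : SLR n × X => p.1 • p.2) := by
  have : SecondCountableTopology X := HomSpace.toSecondCountableTopology n
  have : BorelSpace X := HomSpace.toBorelSpace n
  exact continuous_smul.measurable

theorem haar_smul_mem_eq_zero_iff (μ : Measure X) [IsProbabilityMeasure μ]
    [SMulInvariantMeasure (SLR n) X μ] (x₀ : X) {B : Set X} (hB : MeasurableSet B) :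
    (Measure.haar : Measure (SLR n)) {g | g • x₀ ∈ B} = 0 ↔ μ B = 0 := by
  set m : Measure (SLR n) := Measure.haar
  have hm : MeasurableSet {p : SLR n × X | p.1 • p.2 ∈ B} := measurable_smul_prod hB
  have key : ∀ x : X, m {g | g • x ∈ B} = 0 ↔ m {g | g • x₀ ∈ B} = 0 := by
    have : ∀ x y : X, m {g | g • x ∈ B} = 0 → m {g | g • y ∈ B} = 0 := by
      intro x y h
      obtain ⟨k, rfl⟩ := MulAction.exists_smul_eq (SLR n) x y
      have := (quasiMeasurePreserving_mul_right m k).preimage_null h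
      simpa [Set.preimage, mul_smul] using this
    exact fun x => ⟨this _ _, this _ _⟩
  have e : ∫⁻ x, m {g | g • x ∈ B} ∂μ = m univ * μ B := by
    have h1 := Measure.prod_apply (μ := m) (ν := μ) hm
    have h2 := Measure.prod_apply_symm (μ := m) (ν := μ) hm
    have h3 : ∀ g : SLR n, μ (Prod.mk g ⁻¹' {p : SLR n × X | p.1 • p.2 ∈ B}) = μ B := fun g =>
      measure_preimage_smul_of_nullMeasurableSet hB.nullMeasurableSet g
    simp only [h3, lintegral_const] at h1
    rw [mul_comm, ← h1, h2]
    rfl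
  constructor
  · intro h
    rw [lintegral_congr (g := fun _ => (0 : ENNReal)) (fun x => (key x).2 h), lintegral_zero] at e
    rcases mul_eq_zero.1 e.symm with h | h
    · exact absurd (Measure.measure_univ_eq_zero.1 h) (NeZero.ne m)
    · exact h
  · intro h
    rw [h, mul_zero] at e
    obtain ⟨x, hx⟩ := ((lintegral_eq_zero_iff (measurable_measure_prodMk_right hm)).1 e).exists
    exact (key x).1 hx

theorem ae_eq_const_of_forall_smul_ae_eq (μ : Measure X) [IsProbabilityMeasure μ]
    [SMulInvariantMeasure (SLR n) X μ] {f : X → ℝ} (hf : Measurable f)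
    (h : ∀ g : SLR n, (fun x => f (g • x)) =ᵐ[μ] f) : ∃ c, f =ᵐ[μ] fun _ => c := by
  set m : Measure (SLR n) := Measure.haar
  have hm : MeasurableSet {p : SLR n × X | f (p.1 • p.2) ≠ f p.2} :=
    (measurableSet_eq_fun (hf.comp measurable_smul_prod) (hf.comp measurable_snd)).compl
  have h1 : (m.prod μ) {p : SLR n × X | f (p.1 • p.2) ≠ f p.2} = 0 := by
    rw [Measure.measure_prod_null hm]
    exact Filter.Eventually.of_forall fun g => h g
  rw [Measure.prod_apply_symm hm, lintegral_eq_zero_iff (measurable_measure_prodMk_right hm)] at h1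
  obtain ⟨x, hx⟩ := h1.exists
  refine ⟨f x, ?_⟩
  have hB : MeasurableSet {y | f y ≠ f x} := (measurableSet_eq_fun hf measurable_const).compl
  exact (haar_smul_mem_eq_zero_iff μ x hB).1 hx

noncomputable section koopman
variable (μ : Measure X) [IsProbabilityMeasure μ] [SMulInvariantMeasure (SLR n) X μ]

/-- The Koopman representation on `L²`. -/
def koopman (n : ℕ) {X : Type*} [TopologicalSpace X] [MeasurableSpace X] [MulAction (SLR n) X]
    [HomSpace n X] (μ : Measure X) [IsProbabilityMeasure μ] [SMulInvariantMeasure (SLR n) X μ]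
    (g : SLR n) : Lp ℝ 2 μ →ₗᵢ[ℝ] Lp ℝ 2 μ :=
  Lp.compMeasurePreservingₗᵢ ℝ (g⁻¹ • ·) (measurePreserving_smul g⁻¹ μ)

theorem koopman_eq (g : SLR n) (f : Lp ℝ 2 μ) : koopman n μ g f = DomMulAct.mk g⁻¹ • f := rfl

theorem koopman_ae (g : SLR n) (f : Lp ℝ 2 μ) :
    koopman n μ g f =ᵐ[μ] fun x => f (g⁻¹ • x) :=
  DomMulAct.smul_Lp_ae_eq (DomMulAct.mk g⁻¹) f

theorem koopman_one (f : Lp ℝ 2 μ) : koopman n μ 1 f = f := by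
  rw [koopman_eq, _root_.inv_one, DomMulAct.mk_one, one_smul]

theorem koopman_mul (g h : SLR n) (f : Lp ℝ 2 μ) :
    koopman n μ (g * h) f = koopman n μ g (koopman n μ h f) := by
  rw [koopman_eq, koopman_eq, koopman_eq, smul_smul, ← DomMulAct.mk_mul, _root_.mul_inv_rev]

theorem continuous_koopman (f : Lp ℝ 2 μ) : Continuous fun g => koopman n μ g f := by
  have : SecondCountableTopology X := HomSpace.toSecondCountableTopology n
  have : BorelSpace X := HomSpace.toBorelSpace n
  have : LocallyCompactSpace X := HomSpace.toLocallyCompactSpace n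
  have : T2Space X := HomSpace.toT2Space n
  have : Fact ((2 : ENNReal) ≠ ⊤) := ⟨ENNReal.ofNat_ne_top⟩
  simp_rw [koopman_eq]
  have h : Continuous fun g : SLR n => DomMulAct.mk g⁻¹ :=
    DomMulAct.continuous_mk.comp continuous_inv
  exact h.smul continuous_const

theorem koopman_indicator (g : SLR n) {A : Set X} (hA : MeasurableSet A) :
    koopman n μ g (indicatorConstLp 2 hA (measure_ne_top μ A) (1 : ℝ)) =
      indicatorConstLp 2 (hA.preimage (measurable_const_smul g⁻¹)) (measure_ne_top μ _) 1 := by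
  rw [koopman_eq, DomMulAct.mk_smul_indicatorConstLp]

theorem inner_indicator {A B : Set X} (hA : MeasurableSet A) (hB : MeasurableSet B) :
    inner ℝ (indicatorConstLp 2 hA (measure_ne_top μ A) (1 : ℝ))
      (indicatorConstLp 2 hB (measure_ne_top μ B) (1 : ℝ)) = μ.real (A ∩ B) := by
  rw [L2.inner_indicatorConstLp_one, setIntegral_congr_ae (g := B.indicator 1) hA]
  · rw [integral_indicator hB]
    simp [Measure.restrict_restrict hB, inter_comm, measureReal_def]
  · filter_upwards [indicatorConstLp_coeFn (p := 2) (hs := hB) (hμs := measure_ne_top μ B)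
      (c := (1 : ℝ))] with x hx _
    rw [hx]; rfl

end koopman

/-- Unipotent elements act by mixing transformations. -/
theorem mixing_unipotent (hn : 2 ≤ n) (μ : Measure X) [IsProbabilityMeasure μ]
    [SMulInvariantMeasure (SLR n) X μ] {u : SLR n} (hu : Unip u) (hu1 : u ≠ 1) {A B : Set X}
    (hA : MeasurableSet A) (hB : MeasurableSet B) :
    Tendsto (fun j : ℕ => μ.real ({x | u ^ j • x ∈ A} ∩ B)) atTop (𝓝 (μ.real A * μ.real B)) := by
  rw [tendsto_iff_ultrafilter]
  intro 𝒰 hU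
  obtain ⟨v, hv, hlim⟩ := exists_invariant_weak_limit hn (koopman n μ) (koopman_one μ)
    (koopman_mul μ) (continuous_koopman μ) hu.inv (by simpa using hu1) 𝒰 hU
    (indicatorConstLp 2 hA (measure_ne_top μ A) (1 : ℝ))
  have hlim' : ∀ {D : Set X} (hD : MeasurableSet D),
      Tendsto (fun j : ℕ => μ.real ({x | u ^ j • x ∈ A} ∩ D)) 𝒰
        (𝓝 (inner ℝ v (indicatorConstLp 2 hD (measure_ne_top μ D) (1 : ℝ)))) := by
    intro D hD
    refine (hlim _).congr fun j => ?_
    rw [koopman_indicator, inner_indicator]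
    simp [Set.preimage, inv_pow]
  obtain ⟨c, hc⟩ : ∃ c : ℝ, v =ᵐ[μ] fun _ => c := by
    obtain ⟨f, hf, hvf⟩ := (Lp.aestronglyMeasurable v).aemeasurable
    obtain ⟨c, hc⟩ := ae_eq_const_of_forall_smul_ae_eq (n := n) μ hf (fun g => by
      have h1 := koopman_ae μ g⁻¹ v
      rw [hv, inv_inv] at h1
      exact (((measurePreserving_smul g μ).quasiMeasurePreserving.ae_eq_comp hvf).symm.trans
        h1.symm).trans hvf)
    exact ⟨c, hvf.trans hc⟩
  have hin : ∀ {D : Set X} (hD : MeasurableSet D),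
      inner ℝ v (indicatorConstLp 2 hD (measure_ne_top μ D) (1 : ℝ)) = c * μ.real D := by
    intro D hD
    rw [real_inner_comm, L2.inner_indicatorConstLp_one,
      setIntegral_congr_ae (g := fun _ => c) hD (by filter_upwards [hc] with x hx _ using hx)]
    simp [measureReal_def, mul_comm]
  have h1 := hlim' MeasurableSet.univ
  have h2 := hlim' hB
  rw [hin] at h1 h2
  have h3 : (fun j : ℕ => μ.real ({x | u ^ j • x ∈ A} ∩ univ)) = fun _ => μ.real A := by
    ext j
    rw [inter_univ, measureReal_def, measureReal_def]
    congr 1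
    exact measure_preimage_smul_of_nullMeasurableSet hA.nullMeasurableSet (u ^ j)
  rw [h3] at h1
  have h4 := tendsto_nhds_unique h1 tendsto_const_nhds
  simp only [probReal_univ, mul_one] at h4
  rwa [h4] at h2

theorem exists_countable_isPiSystem (X : Type*) [TopologicalSpace X] [SecondCountableTopology X]
    [MeasurableSpace X] [BorelSpace X] : ∃ S : Set (Set X), S.Countable ∧ IsPiSystem S ∧
      ‹MeasurableSpace X› = MeasurableSpace.generateFrom S := by
  have hb := TopologicalSpace.isBasis_countableBasis X
  set b := TopologicalSpace.countableBasis X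
  have h2 := TopologicalSpace.isTopologicalBasis_of_subbasis hb.eq_generateFrom
  refine ⟨(fun f => ⋂₀ f) '' {f | f.Finite ∧ f ⊆ b}, (Set.countable_ofPred_finite_subset
    (TopologicalSpace.countable_countableBasis X)).image _, ?_, ?_⟩
  · rintro _ ⟨f, ⟨hf, hfb⟩, rfl⟩ _ ⟨g, ⟨hg, hgb⟩, rfl⟩ -
    exact ⟨f ∪ g, ⟨hf.union hg, union_subset hfb hgb⟩, sInter_union f g⟩
  · rw [BorelSpace.measurable_eq (α := X)]
    exact h2.borel_eq_generateFrom

/-- Measurable families of maps `X → X × X`, equivariant over `T : Ω → Ω`. -/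
structure PairFam {n : ℕ} {X : Type*} [MeasurableSpace X] [MulAction (SLR n) X] {Ω : Type*}
    [MeasurableSpace Ω] (u w : SLR n) (μ : Measure X) (T : Ω → Ω) (Ψ : Ω → X → X × X) : Prop where
  meas : ∀ ω, Measurable (Ψ ω)
  meas_param : ∀ A D, MeasurableSet A → MeasurableSet D → Measurable fun ω => μ (A ∩ Ψ ω ⁻¹' D)
  mp : ∀ ω, μ.map (fun x => (Ψ ω x).1) = μ
  equiv : ∀ ω, ∀ᵐ x ∂μ, Ψ (T ω) (u • x) = w • Ψ ω x

variable {n : ℕ} {X : Type*} [TopologicalSpace X] [MeasurableSpace X] [MulAction (SLR n) X]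
  [HomSpace n X] {Ω : Type*} [MeasurableSpace Ω] {u w : SLR n} {μ : Measure X}
  [IsProbabilityMeasure μ] [SMulInvariantMeasure (SLR n) X μ] {T : Ω → Ω} {Ψ : Ω → X → X × X}

theorem PairFam.iterate (hΨ : PairFam u w μ T Ψ) (j : ℕ) (ω : Ω) :
    ∀ᵐ x ∂μ, Ψ (T^[j] ω) (u ^ j • x) = w ^ j • Ψ ω x := by
  induction j generalizing ω with
  | zero => simp
  | succ j ih =>
    have h1 := (measurePreserving_smul u μ).quasiMeasurePreserving.ae (ih (T ω))
    filter_upwards [h1, hΨ.equiv ω] with x h1 h2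
    rw [Function.iterate_succ_apply, pow_succ, mul_smul, h1, h2, pow_succ, mul_smul]

theorem PairFam.measure_iterate (hΨ : PairFam u w μ T Ψ) {D : Set (X × X)} (hD : MeasurableSet D)
    (hw : ∀ p, w • p ∈ D ↔ p ∈ D) (j : ℕ) (ω : Ω) {B : Set X} (hB : MeasurableSet B) :
    μ (B ∩ Ψ (T^[j] ω) ⁻¹' D) = μ ({x | u ^ j • x ∈ B} ∩ Ψ ω ⁻¹' D) := by
  have hw' : ∀ p, w ^ j • p ∈ D ↔ p ∈ D := by
    induction j with
    | zero => simp
    | succ j ih => intro p; rw [pow_succ, mul_smul, ih, hw]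
  have h := (measurePreserving_smul (u ^ j) μ).measure_preimage
    (hB.inter (hΨ.meas (T^[j] ω) hD)).nullMeasurableSet
  rw [← h]
  apply measure_congr
  filter_upwards [hΨ.iterate j ω] with x hx
  apply propext
  change (_ ∧ Ψ (T^[j] ω) (u ^ j • x) ∈ D) ↔ (_ ∧ _)
  rw [hx, hw']
  rfl

theorem PairFam.zero_one (hn : 2 ≤ n) (hu : Unip u) (hu1 : u ≠ 1) {ν : Measure Ω}
    [IsProbabilityMeasure ν] (hT : MeasurePreserving T ν ν) (hΨ : PairFam u w μ T Ψ)
    {D : Set (X × X)} (hD : MeasurableSet D) (hw : ∀ p, w • p ∈ D ↔ p ∈ D) :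
    ∀ᵐ ω ∂ν, μ (Ψ ω ⁻¹' D) = 0 ∨ μ (Ψ ω ⁻¹' D) = 1 := by
  have : SecondCountableTopology X := HomSpace.toSecondCountableTopology n
  have : BorelSpace X := HomSpace.toBorelSpace n
  obtain ⟨S, hSc, hSπ, hSg⟩ := exists_countable_isPiSystem X
  have key : ∀ B, MeasurableSet B → ∀ᵐ ω ∂ν, μ.real (B ∩ Ψ ω ⁻¹' D) =
      μ.real (Ψ ω ⁻¹' D) * μ.real B := by
    intro B hB
    let F : Ω → ℝ := fun ω => |μ.real (B ∩ Ψ ω ⁻¹' D) - μ.real (univ ∩ Ψ ω ⁻¹' D) * μ.real B|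
    have hFm : Measurable F := by
      have h1 := (hΨ.meas_param B D hB hD).ennreal_toReal
      have h2 := (hΨ.meas_param univ D MeasurableSet.univ hD).ennreal_toReal
      exact (h1.sub (h2.mul_const _)).abs
    have hF1 : ∀ ω, ‖F ω‖ ≤ 1 := by
      intro ω
      rw [Real.norm_eq_abs, abs_abs, abs_le]
      have a1 : μ.real (B ∩ Ψ ω ⁻¹' D) ≤ 1 := measureReal_le_one
      have a2 : 0 ≤ μ.real (B ∩ Ψ ω ⁻¹' D) := measureReal_nonneg
      have b1 : μ.real (univ ∩ Ψ ω ⁻¹' D) ≤ 1 := measureReal_le_one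
      have b2 : 0 ≤ μ.real (univ ∩ Ψ ω ⁻¹' D) := measureReal_nonneg
      have c1 : μ.real B ≤ 1 := measureReal_le_one
      have c2 : 0 ≤ μ.real B := measureReal_nonneg
      constructor <;> nlinarith
    have hT' : ∀ j, ∫ ω, F (T^[j] ω) ∂ν = ∫ ω, F ω ∂ν := by
      intro j
      have h1 := hT.iterate j
      rw [← integral_map (φ := T^[j]) h1.measurable.aemeasurable hFm.aestronglyMeasurable, h1.map_eq]
    have hlim : Tendsto (fun j => ∫ ω, F (T^[j] ω) ∂ν) atTop (𝓝 (∫ ω, (0 : ℝ) ∂ν)) := by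
      refine tendsto_integral_of_dominated_convergence (fun _ => 1)
        (fun j => (hFm.comp (hT.iterate j).measurable).aestronglyMeasurable)
        (integrable_const 1) (fun j => Eventually.of_forall fun ω => hF1 _)
        (Eventually.of_forall fun ω => ?_)
      have hmix := mixing_unipotent hn μ hu hu1 hB (hΨ.meas ω hD)
      have e : ∀ j, F (T^[j] ω) = |μ.real ({x | u ^ j • x ∈ B} ∩ Ψ ω ⁻¹' D) -
          μ.real (univ ∩ Ψ ω ⁻¹' D) * μ.real B| := by
        intro j
        simp only [F, measureReal_def]
        rw [hΨ.measure_iterate hD hw j ω hB, hΨ.measure_iterate hD hw j ω MeasurableSet.univ]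
        simp
      simp only [e]
      have := (hmix.sub_const (μ.real (univ ∩ Ψ ω ⁻¹' D) * μ.real B)).abs
      have e0 : μ.real B * μ.real (Ψ ω ⁻¹' D) - μ.real (univ ∩ Ψ ω ⁻¹' D) * μ.real B = 0 := by
        rw [univ_inter]; ring
      rwa [e0, abs_zero] at this
    simp only [hT'] at hlim
    rw [integral_zero] at hlim
    have h0 : ∫ ω, F ω ∂ν = 0 := tendsto_nhds_unique tendsto_const_nhds hlim
    rw [integral_eq_zero_iff_of_nonneg (fun ω => abs_nonneg _)
      (Integrable.of_bound hFm.aestronglyMeasurable 1 (Eventually.of_forall hF1))] at h0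
    filter_upwards [h0] with ω hω
    have : F ω = 0 := hω
    simp only [F, abs_eq_zero, sub_eq_zero, univ_inter] at this
    exact this
  have hall : ∀ᵐ ω ∂ν, ∀ B ∈ S, μ.real (B ∩ Ψ ω ⁻¹' D) = μ.real (Ψ ω ⁻¹' D) * μ.real B := by
    rw [ae_ball_iff hSc]
    intro B hB
    refine key B ?_
    rw [hSg]
    exact MeasurableSpace.measurableSet_generateFrom hB
  filter_upwards [hall] with ω hω
  have hE := hΨ.meas ω hD
  have heq : μ.restrict (Ψ ω ⁻¹' D) = μ (Ψ ω ⁻¹' D) • μ := by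
    refine ext_of_generate_finite S hSg hSπ (fun B hB => ?_) (by simp)
    have hBm : MeasurableSet B := by
      rw [hSg]; exact MeasurableSpace.measurableSet_generateFrom hB
    rw [Measure.restrict_apply hBm, Measure.smul_apply, smul_eq_mul]
    have := hω B hB
    rw [measureReal_def, measureReal_def, measureReal_def, ← ENNReal.toReal_mul] at this
    exact (ENNReal.toReal_eq_toReal_iff' (measure_ne_top _ _)
      (ENNReal.mul_ne_top (measure_ne_top _ _) (measure_ne_top _ _))).1 this
  have h2 := congr_arg (fun m => m (Ψ ω ⁻¹' D)) heq
  simp only [Measure.restrict_apply hE, Measure.smul_apply, smul_eq_mul, inter_self] at h2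
  by_cases h0 : μ (Ψ ω ⁻¹' D) = 0
  · exact Or.inl h0
  · right
    exact ((ENNReal.mul_eq_left h0 (measure_ne_top _ _)).1 h2.symm)

theorem smul_mem_GRel_iff {F : Set (SLR n)} (hF : ∀ g ∈ F, Commute w g) (p : X × X) :
    w • p ∈ GRel X F ↔ p ∈ GRel X F := by
  constructor
  · rintro ⟨g, hg, h⟩
    refine ⟨g, hg, ?_⟩
    rw [Prod.smul_fst, Prod.smul_snd, ← mul_smul, ← (hF g hg).eq, mul_smul] at h
    exact MulAction.injective w h
  · rintro ⟨g, hg, h⟩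
    refine ⟨g, hg, ?_⟩
    rw [Prod.smul_fst, Prod.smul_snd, ← mul_smul, ← (hF g hg).eq, mul_smul, h]

/-- If `Ψ ω x` often lies in a compact set of pairs given by elements commuting with `w`,
then the two coordinates of `Ψ ω` differ by the action of one element. -/
theorem PairFam.exists_commute (hn : 2 ≤ n) (hu : Unip u) (hu1 : u ≠ 1) {ν : Measure Ω}
    [IsProbabilityMeasure ν] (hT : MeasurePreserving T ν ν) (hΨ : PairFam u w μ T Ψ)
    {K : Set (SLR n)} (hK : IsCompact K) (hKw : ∀ g ∈ K, Commute w g) :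
    ∀ᵐ ω ∂ν, μ (Ψ ω ⁻¹' GRel X K) ≠ 0 → ∃ c ∈ K, ∀ᵐ x ∂μ, (Ψ ω x).2 = c • (Ψ ω x).1 := by
  have : SecondCountableTopology X := HomSpace.toSecondCountableTopology n
  have : BorelSpace X := HomSpace.toBorelSpace n
  have : T2Space X := HomSpace.toT2Space n
  set b := TopologicalSpace.countableBasis (SLR n)
  have hbb := TopologicalSpace.isBasis_countableBasis (SLR n)
  have hF : ∀ U : Set (SLR n), IsCompact (closure U ∩ K) := fun U => hK.inter_left isClosed_closure
  have h01 : ∀ᵐ ω ∂ν, ∀ U ∈ b, μ (Ψ ω ⁻¹' GRel X (closure U ∩ K)) = 0 ∨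
      μ (Ψ ω ⁻¹' GRel X (closure U ∩ K)) = 1 := by
    rw [ae_ball_iff (TopologicalSpace.countable_countableBasis (SLR n))]
    intro U _
    exact hΨ.zero_one hn hu hu1 hT (measurableSet_GRel (hF U))
      (smul_mem_GRel_iff fun g hg => hKw g hg.2)
  filter_upwards [h01] with ω hω hpos
  obtain ⟨c, hc, hcU⟩ : ∃ c ∈ K, ∀ U ∈ b, c ∈ U → μ (Ψ ω ⁻¹' GRel X (closure U ∩ K)) = 1 := by
    by_contra hcon
    push Not at hcon
    have hcon' : ∀ c ∈ K, ∃ U ∈ b, c ∈ U ∧ μ (Ψ ω ⁻¹' GRel X (closure U ∩ K)) = 0 := by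
      intro c hc
      obtain ⟨U, hU, hcU, hne⟩ := hcon c hc
      exact ⟨U, hU, hcU, (hω U hU).resolve_right hne⟩
    choose! U hU hcU hU0 using hcon'
    obtain ⟨t, htK, htc⟩ := hK.elim_nhds_subcover U
      (fun c hc => (hbb.isOpen (hU c hc)).mem_nhds (hcU c hc))
    refine hpos (measure_mono_null ?_ ((measure_biUnion_null_iff t.countable_toSet).2
      (fun c hc => hU0 c (htK c hc))))
    rintro x ⟨g, hg, hgx⟩
    obtain ⟨c, hct, hgc⟩ := mem_iUnion₂.1 (htc hg)
    exact mem_iUnion₂.2 ⟨c, hct, g, ⟨subset_closure hgc, hg⟩, hgx⟩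
  refine ⟨c, hc, ?_⟩
  have hall : ∀ᵐ x ∂μ, ∀ U ∈ b, c ∈ U → Ψ ω x ∈ GRel X (closure U ∩ K) := by
    rw [ae_ball_iff (TopologicalSpace.countable_countableBasis (SLR n))]
    intro U hU
    by_cases h : c ∈ U
    · have h1 := hcU U hU h
      have h2 := (prob_compl_eq_zero_iff (μ := μ)
        (hΨ.meas ω (measurableSet_GRel (hF U)))).2 h1
      filter_upwards [measure_eq_zero_iff_ae_notMem.1 h2] with x hx _
      simpa using hx
    · exact Eventually.of_forall fun x h' => absurd h' h
  filter_upwards [hall] with x hx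
  by_contra hne
  have hopen : IsOpen {g : SLR n | (Ψ ω x).2 ≠ g • (Ψ ω x).1} :=
    isOpen_ne_fun continuous_const (by fun_prop)
  obtain ⟨V, hV, hVc, hVs⟩ := exists_mem_nhds_isClosed_subset (hopen.mem_nhds hne)
  obtain ⟨U, hU, hcU', hUV⟩ := hbb.mem_nhds_iff.1 hV
  obtain ⟨g, ⟨hg, -⟩, hgx⟩ := hx U hU hcU'
  exact hVs (closure_minimal hUV hVc hg) hgx.symm

theorem IsPolySeq.eq_of_bounded {D : ℕ} {f : ℕ → ℝ} (hf : IsPolySeq D f) {c : ℝ}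
    (hc : ∀ j, |f j| ≤ c) (i j : ℕ) : f i = f j := by
  obtain ⟨p, -, hp⟩ := hf
  have hdeg : p.degree ≤ 0 := by
    by_contra h
    push Not at h
    have h1 := (p.abs_tendsto_atTop h).comp tendsto_natCast_atTop_atTop
    obtain ⟨k, hk⟩ := (h1.eventually_gt_atTop c).exists
    have := hc k
    rw [hp k] at this
    exact absurd this (not_le.2 hk)
  rw [hp, hp, Polynomial.eq_C_of_degree_le_zero hdeg]
  simp

variable {n : ℕ}

theorem Unip.commute_of_mem_cnjBal {w g : SLR n} (hw : Unip w) {δ : ℝ}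
    (hg : ∀ N, g ∈ cnjBal w δ N) : Commute w g := by
  obtain ⟨D, hD⟩ := hw.isPolySeq_cnj
  have hb : ∀ j, ‖cnj (w ^ j) ((g : Matrix (Fin n) (Fin n) ℝ) - 1)‖ ≤ δ := by
    intro j
    rw [cnj_sub_one]
    exact hg (j + 1) j (Nat.lt_succ_self j)
  have h1 : cnj (w ^ 1) ((g : Matrix (Fin n) (Fin n) ℝ) - 1) =
      cnj (w ^ 0) ((g : Matrix (Fin n) (Fin n) ℝ) - 1) := by
    ext a b
    exact (hD _ a b).eq_of_bounded (fun j => (abs_entry_le_norm _ a b).trans (hb j)) 1 0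
  rw [cnj_sub_one, cnj_sub_one, sub_left_inj] at h1
  have h2 := SL_ext h1
  rw [pow_one, pow_zero, one_mul, _root_.inv_one, mul_one, mul_inv_eq_iff_eq_mul] at h2
  exact h2

theorem isCompact_cnjBal (w : SLR n) (δ : ℝ) {N : ℕ} (hN : 0 < N) : IsCompact (cnjBal w δ N) := by
  have h : cnjBal w δ N = ⋂ j ∈ Finset.range N, (fun g => w ^ j * g * (w ^ j)⁻¹) ⁻¹' bal n δ := by
    ext g; simp [cnjBal]
  refine (isCompact_bal n δ).of_isClosed_subset ?_ fun g hg => ?_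
  · rw [h]
    exact isClosed_biInter fun j _ => (isClosed_bal n δ).preimage (by fun_prop)
  · have := hg 0 hN
    rwa [pow_zero, one_mul, _root_.inv_one, mul_one] at this

theorem cnjBal_anti (w : SLR n) (δ : ℝ) {N M : ℕ} (h : N ≤ M) : cnjBal w δ M ⊆ cnjBal w δ N :=
  fun _ hg j hj => hg j (hj.trans_le h)

variable {X : Type*} [TopologicalSpace X] [MeasurableSpace X] [MulAction (SLR n) X]
  [HomSpace n X]

theorem mem_GRel_of_forall_cnjBal {w : SLR n} (hw : Unip w) {δ : ℝ} {p : X × X}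
    (hp : ∀ N > 0, p ∈ GRel X (cnjBal w δ N)) : p ∈ GRel X (bal n δ ∩ {g | Commute w g}) := by
  have : T2Space X := HomSpace.toT2Space n
  let t : ℕ → Set (SLR n) := fun N => cnjBal w δ (N + 1) ∩ {g | g • p.1 = p.2}
  have hcl : IsClosed {g : SLR n | g • p.1 = p.2} := isClosed_eq (by fun_prop) continuous_const
  have htc : ∀ N, IsCompact (t N) := fun N => (isCompact_cnjBal w δ N.succ_pos).inter_right hcl
  obtain ⟨g, hg⟩ := IsCompact.nonempty_iInter_of_sequence_nonempty_isCompact_isClosed t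
    (fun N => inter_subset_inter_left _ (cnjBal_anti w δ (Nat.le_succ _)))
    (fun N => by obtain ⟨g, hg, h⟩ := hp (N + 1) N.succ_pos; exact ⟨g, hg, h⟩)
    (htc 0) (fun N => (htc N).isClosed)
  rw [mem_iInter] at hg
  refine ⟨g, ⟨?_, hw.commute_of_mem_cnjBal fun N => cnjBal_anti w δ (Nat.le_succ N) (hg N).1⟩,
    (hg 0).2⟩
  have := (hg 0).1 0 Nat.one_pos
  rwa [pow_zero, one_mul, _root_.inv_one, mul_one] at this

variable {u w : SLR n} {μ : Measure X}
  [IsProbabilityMeasure μ] [SMulInvariantMeasure (SLR n) X μ]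

theorem PairFam.measure_notMem_le {Ω : Type*} [MeasurableSpace Ω] {T : Ω → Ω} {Ψ : Ω → X → X × X}
    (hΨ : PairFam u w μ T Ψ) {D : Set (X × X)} (hD : MeasurableSet D) (j : ℕ) (ω : Ω) :
    μ {x | w ^ j • Ψ ω x ∉ D} = μ {x | Ψ (T^[j] ω) x ∉ D} := by
  have h := (measurePreserving_smul (u ^ j) μ).measure_preimage
    (hΨ.meas (T^[j] ω) hD.compl).nullMeasurableSet
  have e : {x | Ψ (T^[j] ω) x ∉ D} = Ψ (T^[j] ω) ⁻¹' Dᶜ := rfl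
  rw [e, ← h]
  apply measure_congr
  filter_upwards [hΨ.iterate j ω] with x hx
  apply propext
  change _ ↔ Ψ (T^[j] ω) (u ^ j • x) ∉ D
  rw [hx]
  rfl

/-- A pair family whose two coordinates are close for most times along the orbit of `ω`
satisfies `Ψ₂ = c • Ψ₁` for some small `c` commuting with `w`. -/
theorem PairFam.exists_commute_of_frequently (hn : 2 ≤ n) (hu : Unip u) (hu1 : u ≠ 1)
    (hw : Unip w) (μ : Measure X) [IsProbabilityMeasure μ] [SMulInvariantMeasure (SLR n) X μ]
    {δ₀ : ℝ} (hδ₀ : 0 < δ₀) : ∃ δ > 0, ∀ {Ω : Type} [MeasurableSpace Ω] {T : Ω → Ω}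
    {Ψ : Ω → X → X × X} (ν : Measure Ω) [IsProbabilityMeasure ν], MeasurePreserving T ν ν →
    PairFam u w μ T Ψ → ∀ᵐ ω ∂ν, (∃ᶠ N : ℕ in atTop, ∑ j ∈ Finset.range N,
      μ {x | Ψ (T^[j] ω) x ∉ GRel X (bal n δ)} ≤ 64⁻¹ * N) →
      ∃ c ∈ bal n δ₀, Commute w c ∧ ∀ᵐ x ∂μ, (Ψ ω x).2 = c • (Ψ ω x).1 := by
  have : SecondCountableTopology X := HomSpace.toSecondCountableTopology n
  have : BorelSpace X := HomSpace.toBorelSpace n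
  obtain ⟨r, hr, hrμ⟩ := exists_Inj_compl_le (n := n) μ (ε := 64⁻¹) (by simp)
  obtain ⟨δ, hδ, hδc⟩ := exists_cnjBal X hw hr hδ₀
  refine ⟨δ, hδ, ?_⟩
  intro Ω _ T Ψ ν _ hT hΨ
  have hK : IsCompact (bal n δ₀ ∩ {g | Commute w g}) :=
    (isCompact_bal n δ₀).inter_right (isClosed_eq (by fun_prop) (by fun_prop))
  filter_upwards [hΨ.exists_commute hn hu hu1 hT hK fun g hg => hg.2] with ω hω hfreq
  let E : ℕ → Set X := fun N => {x | Ψ ω x ∉ GRel X (cnjBal w δ₀ (N + 1))}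
  have hEmono : Monotone E := fun N M hNM x hx h =>
    hx (GRel_mono (cnjBal_anti w δ₀ (Nat.succ_le_succ hNM)) h)
  let bad : ℕ → Set X := fun j => {x | w ^ j • Ψ ω x ∉ {p | p.1 ∈ Inj n X r}} ∪
    {x | w ^ j • Ψ ω x ∉ GRel X (bal n δ)}
  have hI : MeasurableSet {p : X × X | p.1 ∈ Inj n X r} := measurable_fst (measurableSet_Inj (n := n) r)
  have hB := measurableSet_GRel (X := X) (isCompact_bal n δ)
  have hsm : ∀ j, Measurable fun x => w ^ j • Ψ ω x := by
    intro j
    exact (((measurable_const_smul (w ^ j)).comp measurable_fst).prodMk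
      ((measurable_const_smul (w ^ j)).comp measurable_snd)).comp (hΨ.meas ω)
  have hbad : ∀ j, MeasurableSet (bad j) := fun j => (hsm j hI.compl).union (hsm j hB.compl)
  have hbadle : ∀ j, μ (bad j) ≤ 64⁻¹ + μ {x | Ψ (T^[j] ω) x ∉ GRel X (bal n δ)} := by
    intro j
    refine (measure_union_le _ _).trans ?_
    rw [hΨ.measure_notMem_le hI, hΨ.measure_notMem_le hB]
    gcongr
    have := Measure.map_apply (μ := μ) ((hΨ.meas (T^[j] ω)).fst) (measurableSet_Inj (n := n) r).compl
    rw [hΨ.mp] at this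
    rw [this] at hrμ
    exact hrμ
  have h8 : (8 : ENNReal) * (64⁻¹ + 64⁻¹) = 4⁻¹ := by
    rw [← ENNReal.toReal_eq_toReal_iff' (by finiteness) (by finiteness)]
    rw [ENNReal.toReal_mul, ENNReal.toReal_add (by finiteness) (by finiteness)]
    simp only [ENNReal.toReal_inv, ENNReal.toReal_ofNat]
    norm_num
  have hE : ∀ N, μ (E N) ≤ 4⁻¹ := by
    intro N
    obtain ⟨M, hM, hMs⟩ := (hfreq.and_eventually (eventually_ge_atTop (N + 1))).exists
    obtain ⟨M, rfl⟩ : ∃ M', M = M' + 1 := ⟨M - 1, by omega⟩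
    have h1 := measure_many_bad_le μ hbad M.succ_pos (ε := 64⁻¹ + 64⁻¹) (by
      refine (Finset.sum_le_sum fun j _ => hbadle j).trans ?_
      rw [Finset.sum_add_distrib, add_mul]
      gcongr
      · simp [mul_comm])
    rw [h8] at h1
    refine le_trans (measure_mono ?_) h1
    refine (hEmono (show N ≤ M by omega)).trans fun x hx => ?_
    by_contra hcon
    rw [mem_ofPred_eq, not_lt] at hcon
    refine hx (hδc (M + 1) M.succ_pos _ _ _ (fun j hj => ?_) hcon)
    simp only [bad, mem_union, not_or] at hj
    exact ⟨not_not.1 hj.1, not_not.1 hj.2⟩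
  refine (fun h => let ⟨c, hc, h⟩ := hω h; ⟨c, hc.1, hc.2, h⟩) ?_
  intro h0
  have hU : μ (⋃ N, E N) ≤ 4⁻¹ := by
    rw [hEmono.measure_iUnion]
    exact iSup_le hE
  have hcov : univ ⊆ (⋃ N, E N) ∪ Ψ ω ⁻¹' GRel X (bal n δ₀ ∩ {g | Commute w g}) := by
    intro x _
    by_cases hx : x ∈ ⋃ N, E N
    · exact Or.inl hx
    · right
      refine mem_GRel_of_forall_cnjBal hw fun N hN => ?_
      by_contra hcon
      refine hx (mem_iUnion.2 ⟨N - 1, ?_⟩)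
      show Ψ ω x ∉ _
      rwa [Nat.sub_add_cancel hN]
  have h1 := (measure_mono hcov).trans (measure_union_le (μ := μ) _ _)
  rw [measure_univ, h0, add_zero] at h1
  have := h1.trans hU
  have h4 : (4 : ENNReal)⁻¹ < 1 := by rw [ENNReal.inv_lt_one]; norm_num
  exact absurd this (not_le.2 h4)

variable {n : ℕ}

theorem dst_mul_le (a b : SLR n) : dst (a * b) ≤ dst a * dst b + dst a + dst b := by
  have h : ((a * b : SLR n) : Matrix (Fin n) (Fin n) ℝ) - 1 =
      ((a : Matrix (Fin n) (Fin n) ℝ) - 1) * ((b : Matrix (Fin n) (Fin n) ℝ) - 1) +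
      ((a : Matrix (Fin n) (Fin n) ℝ) - 1) + ((b : Matrix (Fin n) (Fin n) ℝ) - 1) := by
    rw [Matrix.SpecialLinearGroup.coe_mul]; noncomm_ring
  unfold dst
  rw [h]
  exact (norm_add_le _ _).trans (add_le_add_left ((norm_add_le _ _).trans
    (add_le_add_left (norm_mul_le _ _) _)) _)

theorem hasBasis_nhds_one_bal : (𝓝 (1 : SLR n)).HasBasis (fun r : ℝ => 0 < r) (bal n) :=
  ⟨fun _ => ⟨fun h => exists_bal_subset h, fun ⟨_, hr, h⟩ => mem_of_superset (bal_mem_nhds n hr) h⟩⟩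

section Intw

variable {X : Type*} [TopologicalSpace X] [MeasurableSpace X] [MulAction (SLR n) X]
  [HomSpace n X]

/-- `φ` intertwines the actions of `g` and `g'`, almost everywhere. -/
def Intw (μ : Measure X) (φ : X → X) (g g' : SLR n) : Prop := ∀ᵐ x ∂μ, φ (g • x) = g' • φ x

variable {μ : Measure X} [IsProbabilityMeasure μ] [SMulInvariantMeasure (SLR n) X μ] {φ : X → X}

theorem Intw.one : Intw μ φ (1 : SLR n) 1 := by simp [Intw]

theorem ae_smul (g : SLR n) {P : X → Prop} (h : ∀ᵐ x ∂μ, P x) : ∀ᵐ x ∂μ, P (g • x) :=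
  (measurePreserving_smul g μ).quasiMeasurePreserving.ae h

theorem Intw.mul {g g' h h' : SLR n} (hg : Intw μ φ g g') (hh : Intw μ φ h h') :
    Intw μ φ (g * h) (g' * h') := by
  filter_upwards [ae_smul h hg, hh] with x h1 h2
  rw [mul_smul, h1, h2, mul_smul]

theorem Intw.inv {g g' : SLR n} (hg : Intw μ φ g g') : Intw μ φ g⁻¹ g'⁻¹ := by
  filter_upwards [ae_smul g⁻¹ hg] with x h1
  rw [smul_inv_smul] at h1
  rw [h1, inv_smul_smul]

theorem Intw.pow {g g' : SLR n} (hg : Intw μ φ g g') (k : ℕ) : Intw μ φ (g ^ k) (g' ^ k) := by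
  induction k with
  | zero => simpa using Intw.one
  | succ k ih => rw [pow_succ, pow_succ]; exact ih.mul hg

theorem eq_of_forall_mem_GRel {p : X × X} (h : ∀ k : ℕ, p ∈ GRel X (bal n (1 / ((k : ℝ) + 1)))) :
    p.1 = p.2 := by
  have : T2Space X := HomSpace.toT2Space n
  choose g hg hgp using h
  have h1 : Tendsto g atTop (𝓝 1) := by
    refine hasBasis_nhds_one_bal.tendsto_right_iff.2 fun r hr => ?_
    filter_upwards [(tendsto_one_div_add_atTop_nhds_zero_nat (𝕜 := ℝ)).eventually_le_const hr]
      with k hk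
    exact bal_mono hk (hg k)
  have h2 : Tendsto (fun k => g k • p.1) atTop (𝓝 ((1 : SLR n) • p.1)) := h1.smul_const _
  simp only [hgp, one_smul] at h2
  exact (tendsto_nhds_unique h2 tendsto_const_nhds)

theorem isClosed_intw (hφ : Measurable φ) : IsClosed {p : SLR n × SLR n | Intw μ φ p.1 p.2} := by
  rw [isClosed_iff_frequently]
  rintro ⟨g, g'⟩ hfr
  show Intw μ φ g g'
  have key : ∀ k : ℕ, μ {x | (φ (g • x), g' • φ x) ∉ GRel X (bal n (1 / ((k : ℝ) + 1)))} = 0 := by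
    intro k
    have hk : (0 : ℝ) < 1 / ((k : ℝ) + 1) := by positivity
    obtain ⟨η, hη, hηk⟩ := exists_bal_inv_mul_mem (n := n) hk
    rw [← nonpos_iff_eq_zero]
    refine ENNReal.le_of_forall_pos_le_add fun ε hε _ => ?_
    rw [zero_add]
    have h1 := (near_continuous (n := n) μ hφ hη).eventually_le_const
      (show (0 : ENNReal) < ε by exact_mod_cast hε)
    have c1 : Tendsto (fun p : SLR n × SLR n => p.1 * g⁻¹) (𝓝 (g, g')) (𝓝 1) := by
      have : Continuous (fun p : SLR n × SLR n => p.1 * g⁻¹) := by fun_prop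
      simpa using this.tendsto (g, g')
    have c2 : Tendsto (fun p : SLR n × SLR n => p.2 * g'⁻¹) (𝓝 (g, g')) (𝓝 1) := by
      have : Continuous (fun p : SLR n × SLR n => p.2 * g'⁻¹) := by fun_prop
      simpa using this.tendsto (g, g')
    obtain ⟨⟨a, a'⟩, ha, ha1, ha2⟩ :=
      (hfr.and_eventually ((c1.eventually h1).and (c2.eventually (bal_mem_nhds n hη)))).exists
    simp only at ha ha1 ha2
    have hset : MeasurableSet {x | (φ x, φ ((a * g⁻¹) • x)) ∉ GRel X (bal n η)} :=
      measurableSet_notNear η hφ (hφ.comp (measurable_const_smul _))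
    rw [← (measurePreserving_smul g μ).measure_preimage hset.nullMeasurableSet] at ha1
    refine le_trans (measure_mono_ae ?_) ha1
    filter_upwards [ha] with x hx hne
    intro hcon
    refine hne ?_
    obtain ⟨b, hb, hbx⟩ := hcon
    simp only at hbx
    rw [mul_smul, inv_smul_smul, hx] at hbx
    have h2 : φ (g • x) = b⁻¹ • a' • φ x := by rw [← hbx, inv_smul_smul]
    refine ⟨(a' * g'⁻¹)⁻¹ * b, hηk _ ha2 _ hb, ?_⟩
    simp only
    rw [h2, mul_smul, smul_inv_smul, _root_.mul_inv_rev, inv_inv, mul_smul, inv_smul_smul]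
  have hall : ∀ᵐ x ∂μ, ∀ k : ℕ, (φ (g • x), g' • φ x) ∈ GRel X (bal n (1 / ((k : ℝ) + 1))) := by
    rw [ae_all_iff]
    intro k
    exact (measure_eq_zero_iff_ae_notMem.1 (key k)).mono fun x hx => by simpa using hx
  filter_upwards [hall] with x hx
  exact eq_of_forall_mem_GRel hx

end Intw

variable {n : ℕ}

/-- The scalar matrices `1` and `-1`. -/
def IsPM (z : SLR n) : Prop :=
  (z : Matrix (Fin n) (Fin n) ℝ) = 1 ∨ (z : Matrix (Fin n) (Fin n) ℝ) = -1

theorem IsPM.commute {z : SLR n} (hz : IsPM z) (g : SLR n) : z * g = g * z := by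
  apply SL_ext
  rw [Matrix.SpecialLinearGroup.coe_mul, Matrix.SpecialLinearGroup.coe_mul]
  rcases hz with h | h <;> simp [h]

theorem IsPM.mul_self {z : SLR n} (hz : IsPM z) : z * z = 1 := by
  apply SL_ext
  rw [Matrix.SpecialLinearGroup.coe_mul]
  rcases hz with h | h <;> simp [h]

theorem IsPM.inv_eq {z : SLR n} (hz : IsPM z) : z⁻¹ = z := inv_eq_of_mul_eq_one_left hz.mul_self

theorem IsPM.one : IsPM (1 : SLR n) := Or.inl rfl

/-- An element almost commuting with all elementary matrices is close to `±1`. -/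
theorem exists_isPM_mul_mem_bal (hn : 2 ≤ n) {η : ℝ} (hη : 0 < η) : ∃ ε > 0, ∀ c : SLR n,
    (∀ i j : Fin n, i ≠ j → ‖cnj c (single i j 1) - single i j 1‖ ≤ ε) →
    ∃ z, IsPM z ∧ z * c ∈ bal n η := by
  have : NeZero n := ⟨by omega⟩
  let F : SLR n → (Fin n × Fin n) → Matrix (Fin n) (Fin n) ℝ := fun c p =>
    if p.1 = p.2 then 0 else cnj c (single p.1 p.2 1) - single p.1 p.2 1
  suffices h : ∀ᶠ c in Filter.comap F (𝓝 0), ∃ z, IsPM z ∧ z * c ∈ bal n η by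
    obtain ⟨ε, hε, h⟩ := (((Metric.nhds_basis_closedBall
      (x := (0 : (Fin n × Fin n) → Matrix (Fin n) (Fin n) ℝ))).comap F).eventually_iff).1 h
    refine ⟨ε, hε, fun c hc => h ?_⟩
    rw [mem_preimage, mem_closedBall_zero_iff, pi_norm_le_iff_of_nonneg hε.le]
    rintro ⟨i, j⟩
    by_cases hij : i = j
    · simp [F, hij, hε.le]
    · simpa [F, hij] using hc i j hij
  set l := Filter.comap F (𝓝 0)
  have hF : ∀ i j : Fin n, i ≠ j →
      Tendsto (fun c => cnj c (single i j 1) - single i j 1) l (𝓝 0) := by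
    intro i j hij
    have := (tendsto_pi_nhds.1 (tendsto_comap : Tendsto F l (𝓝 0))) (i, j)
    simpa [F, hij] using this
  let c' : SLR n → Matrix (Fin n) (Fin n) ℝ := fun c =>
    ‖(c : Matrix (Fin n) (Fin n) ℝ)‖⁻¹ • (c : Matrix (Fin n) (Fin n) ℝ)
  have hc0 : ∀ c : SLR n, (c : Matrix (Fin n) (Fin n) ℝ) ≠ 0 := fun c h => by
    have := c.2
    rw [h, det_zero] at this
    exact zero_ne_one this
  have hc' : ∀ c, ‖c' c‖ = 1 := by
    intro c
    rw [norm_smul, norm_inv, norm_norm, inv_mul_cancel₀ (norm_ne_zero_iff.2 (hc0 c))]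
  have hcomm : ∀ i j : Fin n, i ≠ j →
      Tendsto (fun c => c' c * single i j 1 - single i j 1 * c' c) l (𝓝 0) := by
    intro i j hij
    refine squeeze_zero_norm (fun c => ?_) (by simpa using (hF i j hij).norm)
    have : c' c * single i j 1 - single i j 1 * c' c =
        (cnj c (single i j 1) - single i j 1) * c' c := by
      have h := (cnj_eq_iff c (single i j 1) _).1 rfl
      simp only [c', Matrix.smul_mul, Matrix.mul_smul, sub_mul]
      rw [h]
    rw [this]
    refine (norm_mul_le _ _).trans ?_
    rw [hc', mul_one]
  have hent : ∀ i j a b : Fin n, i ≠ j →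
      Tendsto (fun c => (c' c * single i j 1 - single i j 1 * c' c :
        Matrix (Fin n) (Fin n) ℝ) a b) l (𝓝 0) := by
    intro i j a b hij
    exact squeeze_zero_norm (fun c => abs_entry_le_norm _ a b) (by simpa using (hcomm i j hij).norm)
  have hoff : ∀ k i : Fin n, k ≠ i → Tendsto (fun c => c' c k i) l (𝓝 0) := by
    intro k i hki
    have := hent i k k k hki.symm
    simpa [Matrix.sub_apply, Matrix.mul_apply, single_apply, hki, hki.symm, Finset.sum_ite_eq] using this
  have hdiag : ∀ i j : Fin n, Tendsto (fun c => c' c i i - c' c j j) l (𝓝 0) := by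
    intro i j
    by_cases hij : i = j
    · simp [hij, tendsto_const_nhds]
    have := hent i j i j hij
    simpa [Matrix.sub_apply, Matrix.mul_apply, single_apply, hij] using this
  have hsc : Tendsto (fun c => c' c - (c' c 0 0) • (1 : Matrix (Fin n) (Fin n) ℝ)) l (𝓝 0) := by
    refine tendsto_pi_nhds.2 fun a => tendsto_pi_nhds.2 fun b => ?_
    by_cases hab : a = b
    · subst hab
      simpa using hdiag a 0
    · simpa [hab] using hoff a b hab
  have hlam : Tendsto (fun c => |c' c 0 0|) l (𝓝 1) := by
    have h1 : ∀ c, abs (1 - abs (c' c 0 0)) ≤ ‖c' c - (c' c 0 0) • (1 : Matrix (Fin n) (Fin n) ℝ)‖ := by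
      intro c
      have := abs_norm_sub_norm_le (c' c) ((c' c 0 0) • (1 : Matrix (Fin n) (Fin n) ℝ))
      rwa [hc', norm_smul, norm_one, mul_one, Real.norm_eq_abs] at this
    have h2 : Tendsto (fun c => 1 - |c' c 0 0|) l (𝓝 0) :=
      squeeze_zero_norm h1 (by simpa using hsc.norm)
    simpa using (tendsto_const_nhds (x := (1 : ℝ))).sub h2
  have hpos : ∀ᶠ c in l, 0 < |c' c 0 0| := hlam.eventually_const_lt one_pos
  have hc'00 : ∀ c, c' c 0 0 = ‖(c : Matrix (Fin n) (Fin n) ℝ)‖⁻¹ * c 0 0 := fun c => rfl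
  have hscale : ∀ c, (c' c 0 0)⁻¹ • c' c =
      ((c : Matrix (Fin n) (Fin n) ℝ) 0 0)⁻¹ • (c : Matrix (Fin n) (Fin n) ℝ) := by
    intro c
    rw [hc'00, mul_inv, inv_inv, smul_smul, mul_right_comm,
      mul_inv_cancel₀ (norm_ne_zero_iff.2 (hc0 c)), one_mul]
  have hratio : Tendsto (fun c : SLR n => ((c : Matrix (Fin n) (Fin n) ℝ) 0 0)⁻¹ •
      (c : Matrix (Fin n) (Fin n) ℝ)) l (𝓝 1) := by
    refine tendsto_iff_norm_sub_tendsto_zero.2 ?_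
    have h3 : Tendsto (fun c => |c' c 0 0|⁻¹ *
        ‖c' c - (c' c 0 0) • (1 : Matrix (Fin n) (Fin n) ℝ)‖) l (𝓝 0) := by
      simpa using (hlam.inv₀ one_ne_zero).mul hsc.norm
    refine h3.congr' ?_
    filter_upwards [hpos] with c hc
    rw [← hscale, ← abs_inv, ← Real.norm_eq_abs, ← norm_smul, smul_sub,
      inv_smul_smul₀ (abs_pos.1 hc)]
  have hdet : Tendsto (fun c : SLR n => (((c : Matrix (Fin n) (Fin n) ℝ) 0 0)⁻¹) ^ n) l (𝓝 1) := by
    have h1 := ((continuous_id.matrix_det).tendsto (1 : Matrix (Fin n) (Fin n) ℝ)).comp hratio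
    rw [id, det_one] at h1
    refine h1.congr fun c => ?_
    have hd : (c : Matrix (Fin n) (Fin n) ℝ).det = 1 := c.2
    simp [Function.comp, det_smul, hd]
  have habs : Tendsto (fun c : SLR n => |(c : Matrix (Fin n) (Fin n) ℝ) 0 0|) l (𝓝 1) := by
    have h1 := (hdet.abs.inv₀ (by simp)).rpow_const (p := (n : ℝ)⁻¹) (Or.inr (by positivity))
    simp only [abs_one, inv_one, Real.one_rpow] at h1
    refine h1.congr fun c => ?_
    rw [abs_pow, abs_inv, inv_pow, inv_inv, Real.pow_rpow_inv_natCast (abs_nonneg _) (by omega)]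
  have hfin := (habs.smul hratio)
  rw [one_smul] at hfin
  have hfin2 := (tendsto_iff_norm_sub_tendsto_zero.1 hfin).eventually_le_const hη
  filter_upwards [hfin2, hdet.eventually_const_lt one_pos, habs.eventually_const_lt one_pos]
    with c h1 h2 h3
  rw [smul_smul] at h1
  set a : ℝ := (c : Matrix (Fin n) (Fin n) ℝ) 0 0
  rcases lt_or_gt_of_ne (abs_pos.1 h3) with ha | ha
  · rw [abs_of_neg ha, neg_mul, mul_inv_cancel₀ ha.ne] at h1
    have heven : Even n := by
      by_contra hodd
      rw [Nat.not_even_iff_odd] at hodd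
      exact absurd h2 (not_lt.2 (hodd.pow_nonpos (inv_nonpos.2 ha.le)))
    refine ⟨⟨-1, by rw [det_neg, det_one, Fintype.card_fin, heven.neg_one_pow, one_mul]⟩,
      Or.inr rfl, ?_⟩
    have e : ‖(-1 : Matrix (Fin n) (Fin n) ℝ) * (c : Matrix (Fin n) (Fin n) ℝ) - 1‖ ≤ η := by
      simpa using h1
    exact e
  · rw [abs_of_pos ha, mul_inv_cancel₀ ha.ne', one_smul] at h1
    exact ⟨1, IsPM.one, by rw [one_mul]; exact h1⟩

theorem toSL_one_add_smul_mem_bal {Y : Matrix (Fin n) (Fin n) ℝ} (hY : IsR1 Y) {s r : ℝ}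
    (h : ‖s • Y‖ ≤ r) : toSL (1 + s • Y) ∈ bal n r := by
  show dst _ ≤ r
  rwa [dst, hY.coe_toSL, add_sub_cancel_left]

variable {X : Type*} [TopologicalSpace X] [MeasurableSpace X] [MulAction (SLR n) X]
  [HomSpace n X]

/-- An element moving most points of `X` only a little almost commutes with the elementary
matrices. -/
theorem exists_norm_cnj_single_sub_le (hn : 2 ≤ n) (μ : Measure X) [IsProbabilityMeasure μ]
    [SMulInvariantMeasure (SLR n) X μ] {ε : ℝ} (hε : 0 < ε) : ∃ δ > 0, ∀ c : SLR n,
    μ {p | (p, c • p) ∉ GRel X (bal n δ)} ≤ 4⁻¹ →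
    ∀ i j : Fin n, i ≠ j → ‖cnj c (single i j 1) - single i j 1‖ ≤ ε := by
  have : NeZero n := ⟨by omega⟩
  obtain ⟨r, hr, hrμ⟩ := exists_Inj_compl_le (n := n) μ (ε := 4⁻¹) (by simp)
  obtain ⟨η, hη, hηr⟩ := exists_bal_inv_mul_mem (n := n) hr
  obtain ⟨s₀, hs₀, hs₀1, hs₀η⟩ : ∃ s₀ > 0, s₀ ≤ 1 ∧ 3 * s₀ ≤ η :=
    ⟨min 1 (η / 3), by positivity, min_le_left _ _, by linarith [min_le_right 1 (η / 3)]⟩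
  have hn0 : (0 : ℝ) < n := by positivity
  obtain ⟨δ, hδ, hδ0, hδ1, hδ2⟩ : ∃ δ > 0, δ ≤ s₀ ∧ 4 * δ ≤ s₀ / 2 ∧ 8 * n * δ ≤ ε * s₀ := by
    refine ⟨min (s₀ / 8) (ε * s₀ / (8 * n)), by positivity, ?_, ?_, ?_⟩
    · linarith [min_le_left (s₀ / 8) (ε * s₀ / (8 * n))]
    · linarith [min_le_left (s₀ / 8) (ε * s₀ / (8 * n))]
    · have := min_le_right (s₀ / 8) (ε * s₀ / (8 * n))
      rw [le_div_iff₀ (by positivity)] at this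
      linarith
  refine ⟨δ, hδ, fun c hc i j hij => ?_⟩
  set E : Matrix (Fin n) (Fin n) ℝ := single i j 1
  have hE : IsR1 E := isR1_single hij one_ne_zero
  have hZ : IsR1 (cnj c E) := hE.cnj c
  set Z := cnj c E
  have hE1 : ‖E‖ ≤ n := by
    have := norm_le_of_entries (Z := E) zero_le_one fun a b => by
      simp only [E, single_apply]; split_ifs <;> simp
    simpa using this
  have hE0 : 0 < ‖E‖ := norm_pos_iff.2 hE.1
  set m := max ‖E‖ ‖Z‖
  have hm : 0 < m := lt_max_of_lt_left hE0
  set s := s₀ / m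
  have hs : 0 < s := by positivity
  have hsE : ‖s • E‖ ≤ s₀ := by
    rw [norm_smul, Real.norm_of_nonneg hs.le, div_mul_eq_mul_div, div_le_iff₀ hm]
    exact mul_le_mul_of_nonneg_left (le_max_left _ _) hs₀.le
  have hsZ : ‖s • Z‖ ≤ s₀ := by
    rw [norm_smul, Real.norm_of_nonneg hs.le, div_mul_eq_mul_div, div_le_iff₀ hm]
    exact mul_le_mul_of_nonneg_left (le_max_right _ _) hs₀.le
  set h := toSL (1 + s • E)
  have hconj : c * h * c⁻¹ = toSL (1 + s • Z) := by
    rw [mul_toSL_mul_inv, cnj_add, cnj_one, cnj_smul]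
  have hB := measurableSet_notNear (n := n) (X := X) δ measurable_id (measurable_const_smul c)
  have hex : ∃ p, p ∈ Inj n X r ∧ (p, c • p) ∈ GRel X (bal n δ) ∧
      (h • p, c • h • p) ∈ GRel X (bal n δ) := by
    by_contra hcon
    push Not at hcon
    have hcov : univ ⊆ ((Inj n X r)ᶜ ∪ {p | (p, c • p) ∉ GRel X (bal n δ)}) ∪
        {p | (h • p, c • h • p) ∉ GRel X (bal n δ)} := by
      intro p _
      by_cases h1 : p ∈ Inj n X r
      · by_cases h2 : (p, c • p) ∈ GRel X (bal n δ)
        · exact Or.inr (hcon p h1 h2)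
        · exact Or.inl (Or.inr h2)
      · exact Or.inl (Or.inl h1)
    have h1 := (measure_mono hcov).trans ((measure_union_le (μ := μ) _ _).trans
      (add_le_add_left (measure_union_le _ _) _))
    have h2 := (measurePreserving_smul h μ).measure_preimage hB.nullMeasurableSet
    have h3 : μ {p | (h • p, c • h • p) ∉ GRel X (bal n δ)} ≤ 4⁻¹ := h2.le.trans hc
    have h4 := h1.trans (add_le_add (add_le_add hrμ hc) h3)
    rw [measure_univ] at h4
    have h5 : (4⁻¹ + 4⁻¹ + 4⁻¹ : ENNReal) < 1 := by
      rw [← ENNReal.toReal_lt_toReal (by finiteness) (by finiteness),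
        ENNReal.toReal_add (by finiteness) (by finiteness),
        ENNReal.toReal_add (by finiteness) (by finiteness)]
      simp only [ENNReal.toReal_inv, ENNReal.toReal_ofNat, ENNReal.toReal_one]
      norm_num
    exact absurd h4 (not_le.2 h5)
  obtain ⟨p, hp, ⟨b, hb, hbp⟩, b', hb', hbp'⟩ := hex
  simp only at hbp hbp'
  have hb0 : dst b ≤ δ := hb
  have hb0' : dst b' ≤ δ := hb'
  have hh0 : dst h ≤ s₀ := toSL_one_add_smul_mem_bal hE hsE
  have hz0 : dst (c * h * c⁻¹) ≤ s₀ := by rw [hconj]; exact toSL_one_add_smul_mem_bal hZ hsZ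
  have heq : c * h * c⁻¹ * b = b' * h := by
    refine eq_of_mem_Inj hηr hp ?_ ?_ ?_
    · refine (dst_mul_le _ _).trans ?_
      nlinarith [dst_nonneg b, dst_nonneg (c * h * c⁻¹)]
    · refine (dst_mul_le _ _).trans ?_
      nlinarith [dst_nonneg b', dst_nonneg h]
    · rw [mul_smul, mul_smul, hbp, mul_smul, mul_smul, inv_smul_smul, hbp']
  have hdiff : ‖s • Z - s • E‖ ≤ 4 * δ := by
    have e1 : s • Z - s • E = ((b' : Matrix (Fin n) (Fin n) ℝ) - 1) * (1 + s • E) -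
        (1 + s • Z) * ((b : Matrix (Fin n) (Fin n) ℝ) - 1) := by
      have := congr_arg (fun g : SLR n => (g : Matrix (Fin n) (Fin n) ℝ)) heq
      simp only [hconj] at this
      rw [Matrix.SpecialLinearGroup.coe_mul, Matrix.SpecialLinearGroup.coe_mul, hZ.coe_toSL,
        hE.coe_toSL] at this
      rw [sub_mul, mul_sub, this, one_mul, mul_one]
      abel
    rw [e1]
    refine (norm_sub_le _ _).trans ((add_le_add (norm_mul_le _ _) (norm_mul_le _ _)).trans ?_)
    have e2 : ‖1 + s • E‖ ≤ 2 := (norm_add_le _ _).trans (by rw [norm_one]; linarith)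
    have e3 : ‖1 + s • Z‖ ≤ 2 := (norm_add_le _ _).trans (by rw [norm_one]; linarith)
    have e4 : ‖(b' : Matrix (Fin n) (Fin n) ℝ) - 1‖ ≤ δ := hb0'
    have e5 : ‖(b : Matrix (Fin n) (Fin n) ℝ) - 1‖ ≤ δ := hb0
    nlinarith [norm_nonneg ((b' : Matrix (Fin n) (Fin n) ℝ) - 1),
      norm_nonneg ((b : Matrix (Fin n) (Fin n) ℝ) - 1), norm_nonneg (1 + s • E),
      norm_nonneg (1 + s • Z)]
  rw [← smul_sub, norm_smul, Real.norm_of_nonneg hs.le, div_mul_eq_mul_div, div_le_iff₀ hm] at hdiff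
  have hm2 : m ≤ 2 * ‖E‖ := by
    refine max_le (by linarith) ?_
    by_contra hlt
    push Not at hlt
    have hmZ : m = ‖Z‖ := max_eq_right (by linarith)
    rw [hmZ] at hdiff
    have : ‖Z‖ ≤ ‖Z - E‖ + ‖E‖ := by simpa using norm_add_le (Z - E) E
    nlinarith
  have : s₀ * ‖Z - E‖ ≤ s₀ * ε := by nlinarith
  exact le_of_mul_le_mul_left this hs₀

theorem exists_isPM_of_near (hn : 2 ≤ n) (μ : Measure X) [IsProbabilityMeasure μ]
    [SMulInvariantMeasure (SLR n) X μ] {η : ℝ} (hη : 0 < η) : ∃ δ > 0, ∀ c : SLR n,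
    μ {p | (p, c • p) ∉ GRel X (bal n δ)} ≤ 4⁻¹ → ∃ z, IsPM z ∧ z * c ∈ bal n η := by
  obtain ⟨ε, hε, h1⟩ := exists_isPM_mul_mem_bal hn hη
  obtain ⟨δ, hδ, h2⟩ := exists_norm_cnj_single_sub_le hn μ hε
  exact ⟨δ, hδ, fun c hc => h1 c (h2 c hc)⟩

section Lift

variable {μ : Measure X} [IsProbabilityMeasure μ] [SMulInvariantMeasure (SLR n) X μ] {φ : X → X}

theorem Intw.exists_isPM (hn : 2 ≤ n) (hφ : MeasurePreserving φ μ μ) {η : ℝ} (hη : 0 < η) :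
    ∃ ρ > 0, ∀ c c' : SLR n, c ∈ bal n ρ → Intw μ φ c c' → ∃ z, IsPM z ∧ z * c' ∈ bal n η := by
  obtain ⟨δ, hδ, h⟩ := exists_isPM_of_near hn μ hη
  have h1 := (near_continuous (n := n) μ hφ.measurable hδ).eventually_le_const
    (show (0 : ENNReal) < 4⁻¹ by simp)
  obtain ⟨ρ, hρ, hρs⟩ := exists_bal_subset h1
  refine ⟨ρ, hρ, fun c c' hc hcc => h c' ?_⟩
  have hB := measurableSet_notNear (n := n) (X := X) δ measurable_id (measurable_const_smul c')
  have h2 := hφ.measure_preimage hB.nullMeasurableSet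
  refine (h2.symm.le.trans (measure_mono_ae ?_)).trans (hρs hc)
  filter_upwards [hcc] with x hx hne
  show (φ x, φ (c • x)) ∉ _
  rw [hx]
  exact hne

theorem Intw.isPM_of_one (hn : 2 ≤ n) (hφ : MeasurePreserving φ μ μ) {c : SLR n}
    (h : Intw μ φ 1 c) : IsPM c := by
  have h1 : ∀ k : ℕ, ∃ z, IsPM z ∧ z * c ∈ bal n (1 / ((k : ℝ) + 1)) := by
    intro k
    obtain ⟨ρ, hρ, hρc⟩ := Intw.exists_isPM hn hφ (η := 1 / ((k : ℝ) + 1)) (by positivity)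
    exact hρc 1 c (one_mem_bal hρ.le) h
  choose z hz hzc using h1
  have hlim : Tendsto (fun k => z k * c) atTop (𝓝 1) := by
    refine hasBasis_nhds_one_bal.tendsto_right_iff.2 fun r hr => ?_
    filter_upwards [(tendsto_one_div_add_atTop_nhds_zero_nat (𝕜 := ℝ)).eventually_le_const hr]
      with k hk
    exact bal_mono hk (hzc k)
  have hlim2 : Tendsto z atTop (𝓝 c⁻¹) := by
    simpa using hlim.mul_const c⁻¹
  have hcl : IsClosed {z : SLR n | IsPM z} :=
    (isClosed_eq (SLR.continuous_val n) continuous_const).union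
      (isClosed_eq (SLR.continuous_val n) continuous_const)
  have h2 : IsPM c⁻¹ := hcl.mem_of_tendsto hlim2 (Eventually.of_forall hz)
  have := h2.inv_eq
  rw [inv_inv] at this
  rwa [this]

/-- An intertwining pair `(c, c')` with `c` near `1` can be modified by a sign so that the second
component is also near `1`. -/
theorem Intw.exists_near (hn : 2 ≤ n) (hφ : MeasurePreserving φ μ μ) {η : ℝ} (hη : 0 < η) :
    ∃ ρ > 0, ∀ c c' : SLR n, c ∈ bal n ρ → Intw μ φ c c' →
      ∃ z, IsPM z ∧ z * c' ∈ bal n η ∧ Intw μ φ c (z * c') := by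
  by_cases hall : ∀ z : SLR n, IsPM z → Intw μ φ 1 z
  · obtain ⟨ρ, hρ, h⟩ := Intw.exists_isPM hn hφ hη
    refine ⟨ρ, hρ, fun c c' hc hcc => ?_⟩
    obtain ⟨z, hz, hzc⟩ := h c c' hc hcc
    exact ⟨z, hz, hzc, by simpa using (hall z hz).mul hcc⟩
  push Not at hall
  obtain ⟨z₀, hz₀, hz₀I⟩ := hall
  have hopen := (isClosed_intw (n := n) (μ := μ) hφ.measurable).isOpen_compl
  have hev : ∀ᶠ p : SLR n × SLR n in 𝓝 (1, 1), ¬ Intw μ φ p.1 (z₀ * p.2) := by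
    have hc : Continuous fun p : SLR n × SLR n => (p.1, z₀ * p.2) := by fun_prop
    exact (hopen.preimage hc).mem_nhds (by simpa using hz₀I)
  rw [nhds_prod_eq, (hasBasis_nhds_one_bal.prod_self).eventually_iff] at hev
  obtain ⟨ρ₁, hρ₁, h1⟩ := hev
  obtain ⟨ρ, hρ, h⟩ := Intw.exists_isPM hn hφ (lt_min hη hρ₁)
  refine ⟨min ρ ρ₁, lt_min hρ hρ₁, fun c c' hc hcc => ?_⟩
  obtain ⟨z, hz, hzc⟩ := h c c' (bal_mono (min_le_left _ _) hc) hcc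
  by_cases hzz : z = z₀
  · subst hzz
    refine absurd ?_ (h1 (x := (c, z * c')) ⟨bal_mono (min_le_right _ _) hc,
      bal_mono (min_le_right _ _) hzc⟩)
    simp only
    rwa [← mul_assoc, hz.mul_self, one_mul]
  · have hz1 : z = 1 := by
      rcases hz with h' | h'
      · exact SL_ext h'
      · rcases hz₀ with h'' | h''
        · exact absurd (by rw [show z₀ = 1 from SL_ext h'']; exact Intw.one) hz₀I
        · exact absurd (SL_ext (h'.trans h''.symm)) hzz
    subst hz1
    exact ⟨1, IsPM.one, bal_mono (min_le_left _ _) hzc, by rwa [one_mul]⟩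

end Lift

theorem frequently_le_of_lintegral_tendsto {Ω : Type*} [MeasurableSpace Ω] {ν : Measure Ω}
    {F : ℕ → Ω → ENNReal} (hF : ∀ k, Measurable (F k))
    (h : Tendsto (fun k => ∫⁻ ω, F k ω ∂ν) atTop (𝓝 0)) {ε : ENNReal} (hε : 0 < ε) :
    ∀ᵐ ω ∂ν, ∃ᶠ k in atTop, F k ω < ε := by
  have h1 : ∫⁻ ω, liminf (fun k => F k ω) atTop ∂ν = 0 :=
    le_antisymm ((lintegral_liminf_le hF).trans h.liminf_eq.le) zero_le
  rw [lintegral_eq_zero_iff (Measurable.liminf hF)] at h1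
  filter_upwards [h1] with ω hω
  exact frequently_lt_of_liminf_lt (by isBoundedDefault) (hω.trans_lt hε)

theorem frequently_frequently_sum_le {Ω : Type*} [MeasurableSpace Ω] {ν : Measure Ω} {T : Ω → Ω}
    (hT : MeasurePreserving T ν ν) {f : ℕ → Ω → ENNReal} (hf : ∀ k, Measurable (f k))
    (h : Tendsto (fun k => ∫⁻ ω, f k ω ∂ν) atTop (𝓝 0)) {ε : ENNReal} (hε : 0 < ε) :
    ∀ᵐ ω ∂ν, ∃ᶠ k in atTop, ∃ᶠ N : ℕ in atTop,
      ∑ j ∈ Finset.range N, f k (T^[j] ω) ≤ ε * N := by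
  let A : ℕ → ℕ → Ω → ENNReal := fun k N ω => (N : ENNReal)⁻¹ * ∑ j ∈ Finset.range N, f k (T^[j] ω)
  have hm : ∀ k j, Measurable fun ω => f k (T^[j] ω) := fun k j =>
    (hf k).comp (hT.iterate j).measurable
  have hA : ∀ k N, Measurable (A k N) := fun k N =>
    (Finset.measurable_fun_sum _ fun j _ => hm k j).const_mul _
  have hAi : ∀ k N, ∫⁻ ω, A k N ω ∂ν ≤ ∫⁻ ω, f k ω ∂ν := by
    intro k N
    simp only [A]
    rw [lintegral_const_mul _ (Finset.measurable_fun_sum _ fun j _ => hm k j),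
      lintegral_finsetSum _ fun j _ => hm k j]
    have e : ∀ j ∈ Finset.range N, ∫⁻ ω, f k (T^[j] ω) ∂ν = ∫⁻ ω, f k ω ∂ν := fun j _ =>
      (hT.iterate j).lintegral_comp (hf k)
    rw [Finset.sum_congr rfl e, Finset.sum_const, Finset.card_range, nsmul_eq_mul, ← mul_assoc]
    exact mul_le_of_le_one_left zero_le (ENNReal.inv_mul_le_one _)
  have hL : Tendsto (fun k => ∫⁻ ω, liminf (fun N => A k N ω) atTop ∂ν) atTop (𝓝 0) := by
    refine tendsto_of_tendsto_of_tendsto_of_le_of_le tendsto_const_nhds h (fun k => zero_le)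
      fun k => (lintegral_liminf_le (hA k)).trans ?_
    exact (liminf_le_liminf (Eventually.of_forall (hAi k))).trans (liminf_const _).le
  filter_upwards [frequently_le_of_lintegral_tendsto (fun k => Measurable.liminf (hA k)) hL hε]
    with ω hω
  refine hω.mono fun k hk => ?_
  refine ((frequently_lt_of_liminf_lt (by isBoundedDefault) hk).and_eventually
    (eventually_gt_atTop 0)).mono fun N ⟨hN, hN0⟩ => ?_
  have hN1 : (N : ENNReal) ≠ 0 := by exact_mod_cast hN0.ne'
  have := mul_le_mul_left hN.le (N : ENNReal)
  rwa [mul_right_comm, ENNReal.inv_mul_cancel hN1 (ENNReal.natCast_ne_top N), one_mul] at this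

variable {n : ℕ}

theorem IsR1.toSL_add {Y : Matrix (Fin n) (Fin n) ℝ} (hY : IsR1 Y) (s t : ℝ) :
    toSL (1 + (s + t) • Y) = toSL (1 + s • Y) * toSL (1 + t • Y) := by
  apply SL_ext
  rw [Matrix.SpecialLinearGroup.coe_mul, hY.coe_toSL, hY.coe_toSL, hY.coe_toSL, mul_add, add_mul,
    add_mul, smul_mul_smul_comm, hY.mul_self]
  simp [add_smul, add_assoc]

theorem IsR1.continuous_toSL {Y : Matrix (Fin n) (Fin n) ℝ} (hY : IsR1 Y) :
    Continuous fun t : ℝ => (toSL (1 + t • Y) : SLR n) := by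
  rw [(SLR.isClosedEmbedding_val n).isInducing.continuous_iff]
  have : (fun g : SLR n => (g : Matrix (Fin n) (Fin n) ℝ)) ∘ (fun t : ℝ => toSL (1 + t • Y)) =
      fun t : ℝ => 1 + t • Y := funext fun t => hY.coe_toSL t
  rw [this]
  fun_prop

theorem toSL_one_add_zero (Y : Matrix (Fin n) (Fin n) ℝ) : toSL (1 + (0 : ℝ) • Y) = 1 := by
  rw [zero_smul, add_zero, toSL_one]

theorem IsR1.toSL_neg {Y : Matrix (Fin n) (Fin n) ℝ} (hY : IsR1 Y) (t : ℝ) :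
    toSL (1 + (-t) • Y) = (toSL (1 + t • Y))⁻¹ := by
  rw [eq_inv_iff_mul_eq_one, ← hY.toSL_add, neg_add_cancel, toSL_one_add_zero]

/-- A closed subgroup containing arbitrarily small elements of a root subgroup contains it. -/
theorem IsR1.toSL_mem_of_isClosed {Y : Matrix (Fin n) (Fin n) ℝ} (hY : IsR1 Y)
    {S : Subgroup (SLR n)} (hS : IsClosed (S : Set (SLR n)))
    (h : ∀ ε : ℝ, 0 < ε → ∃ t ∈ Ioo 0 ε, toSL (1 + t • Y) ∈ S) (t : ℝ) : toSL (1 + t • Y) ∈ S := by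
  let A : AddSubgroup ℝ :=
    { carrier := {t | toSL (1 + t • Y) ∈ S}
      add_mem' := fun {a b} ha hb => by
        show toSL (1 + (a + b) • Y) ∈ S
        rw [hY.toSL_add]; exact S.mul_mem ha hb
      zero_mem' := by
        show toSL (1 + (0 : ℝ) • Y) ∈ S
        rw [toSL_one_add_zero]; exact S.one_mem
      neg_mem' := fun {a} ha => by
        show toSL (1 + (-a) • Y) ∈ S
        rw [hY.toSL_neg]; exact S.inv_mem ha }
  have hA : IsClosed (A : Set ℝ) := hS.preimage hY.continuous_toSL
  have hd : Dense (A : Set ℝ) := A.dense_of_not_isolated_zero fun ε hε => by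
    obtain ⟨t, ht, hts⟩ := h ε hε
    exact ⟨t, hts, ht⟩
  have : (A : Set ℝ) = univ := by rw [← hA.closure_eq, hd.closure_eq]
  exact (this ▸ mem_univ t : t ∈ (A : Set ℝ))

variable {X : Type*} [TopologicalSpace X] [MeasurableSpace X] [MulAction (SLR n) X]
  [HomSpace n X] {μ : Measure X} [IsProbabilityMeasure μ] [SMulInvariantMeasure (SLR n) X μ]

/-- The elements intertwined by `φ` with an element commuting with `w`. -/
def cIntw (μ : Measure X) [IsProbabilityMeasure μ] [SMulInvariantMeasure (SLR n) X μ]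
    (φ : X → X) (w : SLR n) : Subgroup (SLR n) where
  carrier := {g | ∃ g', Commute w g' ∧ Intw μ φ g g'}
  one_mem' := ⟨1, Commute.one_right w, Intw.one⟩
  mul_mem' := fun ⟨a, ha, ha'⟩ ⟨b, hb, hb'⟩ => ⟨a * b, ha.mul_right hb, ha'.mul hb'⟩
  inv_mem' := fun ⟨a, ha, ha'⟩ => ⟨a⁻¹, ha.inv_right, ha'.inv⟩

theorem isClosed_cIntw (hn : 2 ≤ n) {φ : X → X} (hφ : MeasurePreserving φ μ μ) (w : SLR n) :
    IsClosed (cIntw μ φ w : Set (SLR n)) := by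
  set S := cIntw μ φ w with hSdef
  obtain ⟨ρ, hρ, hnear⟩ := Intw.exists_near hn hφ (one_pos : (0 : ℝ) < 1)
  have hK : IsCompact (bal n 1 ∩ {g : SLR n | Commute w g}) :=
    (isCompact_bal n 1).inter_right (isClosed_eq (by fun_prop) (by fun_prop))
  let P : Set (SLR n) := {a | ∃ b ∈ bal n 1 ∩ {g : SLR n | Commute w g}, Intw μ φ a b}
  have hP : IsClosed P := by
    have h1 : IsClosed {p : (SLR n) × (bal n 1 ∩ {g : SLR n | Commute w g} : Set (SLR n)) |
        Intw μ φ p.1 (p.2 : SLR n)} :=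
      (isClosed_intw (μ := μ) hφ.measurable).preimage
        (f := fun p : (SLR n) × (bal n 1 ∩ {g : SLR n | Commute w g} : Set (SLR n)) =>
          (p.1, (p.2 : SLR n))) (by fun_prop)
    have : CompactSpace (bal n 1 ∩ {g : SLR n | Commute w g} : Set (SLR n)) :=
      isCompact_iff_compactSpace.1 hK
    have h2 := isClosedMap_fst_of_compactSpace _ h1
    convert h2 using 1
    ext a
    constructor
    · rintro ⟨b, hb, hab⟩
      exact ⟨(a, ⟨b, hb⟩), hab, rfl⟩
    · rintro ⟨⟨a', b, hb⟩, hab, rfl⟩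
      exact ⟨b, hb, hab⟩
  have hPS : P ⊆ S := fun a ⟨b, hb, hab⟩ => ⟨b, hb.2, hab⟩
  have hSP : (S : Set (SLR n)) ∩ bal n ρ ⊆ P := by
    rintro a ⟨⟨a', ha', haa'⟩, haρ⟩
    obtain ⟨z, hz, hz1, hz2⟩ := hnear a a' haρ haa'
    exact ⟨z * a', ⟨hz1, Commute.mul_right (hz.commute w).symm ha'⟩, hz2⟩
  refine isClosed_of_closure_subset fun g hg => ?_
  have hV : (fun x : SLR n => g * x⁻¹) ⁻¹' interior (bal n ρ) ∈ 𝓝 g := by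
    refine (isOpen_interior.preimage (by fun_prop)).mem_nhds ?_
    show g * g⁻¹ ∈ interior (bal n ρ)
    rw [mul_inv_cancel]
    exact mem_interior_iff_mem_nhds.2 (bal_mem_nhds n hρ)
  obtain ⟨g₀, hg₀V, hg₀S⟩ := mem_closure_iff_nhds.1 hg _ hV
  have h1 : g * g₀⁻¹ ∈ closure (S : Set (SLR n)) :=
    S.topologicalClosure.mul_mem hg (S.le_topologicalClosure (S.inv_mem hg₀S))
  have h2 : g * g₀⁻¹ ∈ closure ((S : Set (SLR n)) ∩ interior (bal n ρ)) := by
    rw [inter_comm]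
    exact isOpen_interior.inter_closure ⟨hg₀V, h1⟩
  have h3 : g * g₀⁻¹ ∈ (S : Set (SLR n)) := hPS (hP.closure_subset_iff.2
    ((inter_subset_inter_right _ interior_subset).trans hSP) h2)
  simpa using S.mul_mem h3 hg₀S

/-- Measurable families of measure preserving maps of `X`, equivariant over `T : Ω → Ω`. -/
structure Fam (u w : SLR n) (μ : Measure X) {Ω : Type} [MeasurableSpace Ω] (T : Ω → Ω)
    (Φ : Ω → X → X) : Prop where
  mp : ∀ ω, MeasurePreserving (Φ ω) μ μ
  meas_param : ∀ (κ : SLR n) (A : Set X) (D : Set (X × X)), MeasurableSet A → MeasurableSet D →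
    Measurable fun ω => μ (A ∩ {x | (Φ ω x, Φ ω (κ • x)) ∈ D})
  equiv : ∀ ω, ∀ᵐ x ∂μ, Φ (T ω) (u • x) = w • Φ ω x

variable {u w : SLR n} {Ω : Type} [MeasurableSpace Ω] {T : Ω → Ω} {Φ : Ω → X → X}

theorem Fam.pairFam (h : Fam u w μ T Φ) {κ : SLR n} (hκ : Commute u κ) :
    PairFam u w μ T fun ω x => (Φ ω x, Φ ω (κ • x)) where
  meas ω := (h.mp ω).measurable.prodMk ((h.mp ω).measurable.comp (measurable_const_smul κ))
  meas_param A D hA hD := h.meas_param κ A D hA hD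
  mp ω := (h.mp ω).map_eq
  equiv ω := by
    filter_upwards [h.equiv ω, ae_smul κ (h.equiv ω)] with x h1 h2
    rw [h1, ← mul_smul, ← hκ.eq, mul_smul, h2]
    rfl

/-- The proportion of points `x` such that `Φ ω (κ • x)` is not `δ`-close to `Φ ω x`. -/
noncomputable def farMeas (μ : Measure X) (φ : X → X) (δ : ℝ) (κ : SLR n) : ENNReal :=
  μ {x | (φ x, φ (κ • x)) ∉ GRel X (bal n δ)}

theorem Fam.measurable_farMeas (h : Fam u w μ T Φ) (δ : ℝ) (κ : SLR n) :
    Measurable fun ω => farMeas μ (Φ ω) δ κ := by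
  have : BorelSpace X := HomSpace.toBorelSpace n
  have : SecondCountableTopology X := HomSpace.toSecondCountableTopology n
  have := h.meas_param κ univ _ MeasurableSet.univ
    (measurableSet_GRel (X := X) (isCompact_bal n δ)).compl
  simp only [univ_inter] at this
  exact this

theorem Fam.tendsto_lintegral_farMeas (h : Fam u w μ T Φ) {ν : Measure Ω} [IsProbabilityMeasure ν]
    {δ : ℝ} (hδ : 0 < δ) {κ : ℕ → SLR n} (hκ : Tendsto κ atTop (𝓝 1)) :
    Tendsto (fun k => ∫⁻ ω, farMeas μ (Φ ω) δ (κ k) ∂ν) atTop (𝓝 0) := by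
  have := tendsto_lintegral_of_dominated_convergence (μ := ν) (f := fun _ => 0) (fun _ => 1)
    (fun k => h.measurable_farMeas δ (κ k))
    (fun k => Eventually.of_forall fun ω => prob_le_one) (by simp)
    (Eventually.of_forall fun ω => (near_continuous (n := n) μ (h.mp ω).measurable hδ).comp hκ)
  simpa using this

theorem Fam.forall_mem_cIntw (hn : 2 ≤ n) (hu : Unip u) (hu1 : u ≠ 1) (hw : Unip w)
    {ν : Measure Ω} [IsProbabilityMeasure ν] (hT : MeasurePreserving T ν ν) (h : Fam u w μ T Φ)
    {Y : Matrix (Fin n) (Fin n) ℝ} (hY : IsR1 Y) (huY : cnj u Y = Y) :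
    ∀ᵐ ω ∂ν, ∀ t : ℝ, toSL (1 + t • Y) ∈ cIntw μ (Φ ω) w := by
  have hcomm : ∀ t : ℝ, Commute u (toSL (1 + t • Y)) := by
    intro t
    have := mul_toSL_mul_inv u (1 + t • Y)
    rw [cnj_add, cnj_one, cnj_smul, huY, mul_inv_eq_iff_eq_mul] at this
    exact this
  obtain ⟨δ, hδ, hR⟩ := PairFam.exists_commute_of_frequently hn hu hu1 hw μ one_pos
  let s : ℕ → ℝ := fun k => 1 / ((k : ℝ) + 1)
  have hs : Tendsto s atTop (𝓝 0) := tendsto_one_div_add_atTop_nhds_zero_nat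
  let κ : ℕ → SLR n := fun k => toSL (1 + s k • Y)
  have hκ : Tendsto κ atTop (𝓝 1) := by
    have := (hY.continuous_toSL.tendsto 0).comp hs
    rwa [toSL_one_add_zero] at this
  have hfr := frequently_frequently_sum_le hT (fun k => h.measurable_farMeas δ (κ k))
    (h.tendsto_lintegral_farMeas hδ hκ) (ε := 64⁻¹) (by simp)
  have hall := ae_all_iff.2 fun k => hR ν hT (h.pairFam (hcomm (s k)))
  filter_upwards [hfr, hall] with ω hω hall
  refine hY.toSL_mem_of_isClosed (isClosed_cIntw hn (h.mp ω) w) fun ε hε => ?_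
  obtain ⟨k, hk, hkε⟩ := (hω.and_eventually (hs.eventually_lt_const hε)).exists
  obtain ⟨c, -, hc, hcI⟩ := hall k hk
  exact ⟨s k, ⟨by positivity, hkε⟩, c, hc, hcI⟩

theorem IsPolySeq.sum_alternating_eq_zero {D : ℕ} {f : ℕ → ℝ} (hf : IsPolySeq D f) {m : ℕ}
    (hm : D < m) (a s : ℕ) :
    ∑ k ∈ Finset.range (m + 1), ((-1 : ℝ) ^ (m - k) * m.choose k) * f (a + k * s) = 0 := by
  obtain ⟨p, hp, hf⟩ := hf
  let q : Polynomial ℝ := p.comp (Polynomial.C (a : ℝ) + Polynomial.C (s : ℝ) * Polynomial.X)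
  have hq : q.natDegree < m := by
    refine lt_of_le_of_lt ((Polynomial.natDegree_comp_le).trans ?_) hm
    have : (Polynomial.C (a : ℝ) + Polynomial.C (s : ℝ) * Polynomial.X).natDegree ≤ 1 := by
      compute_degree
    calc _ ≤ p.natDegree * 1 := Nat.mul_le_mul_left _ this
      _ ≤ D := by rwa [mul_one]
  have h := congrFun (Polynomial.fwdDiff_iter_eq_zero_of_degree_lt hq) 0
  rw [fwdDiff_iter_eq_sum_shift] at h
  rw [← show (0 : ℝ → ℝ) 0 = 0 from rfl, ← h]
  refine Finset.sum_congr rfl fun k _ => ?_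
  rw [hf]
  simp [q, zsmul_eq_mul, mul_comm]

theorem exists_arith_progression_notMem (B : Finset ℕ) {s : ℕ} (hB : B.card < s) (K : ℕ) :
    ∃ a < s, ∀ i < K, a + i * s ∉ B := by
  by_contra! h
  choose! i hi hiB using h
  have : (Finset.range s).card ≤ B.card := by
    refine Finset.card_le_card_of_injOn (fun a => a + i a * s)
      (fun a ha => hiB a (Finset.mem_range.1 ha)) fun a ha b hb hab => ?_
    have h2 : (a + i a * s) % s = (b + i b * s) % s := congrArg (· % s) hab
    have ha' : a < s := by simpa using ha
    have hb' : b < s := by simpa using hb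
    rwa [Nat.add_mul_mod_self_right, Nat.add_mul_mod_self_right, Nat.mod_eq_of_lt ha',
      Nat.mod_eq_of_lt hb'] at h2
  rw [Finset.card_range] at this
  omega

open Classical in
theorem exists_few_bad {Y : Type*} [MeasurableSpace Y] (μ : Measure Y) [IsProbabilityMeasure μ]
    {bad : ℕ → Set Y} (hbad : ∀ j, MeasurableSet (bad j)) {N : ℕ} {ε : ENNReal}
    (h : ∑ j ∈ Finset.range N, μ (bad j) ≤ ε) {P : Y → Prop} (hP : ∀ᵐ x ∂μ, P x) :
    ∃ x, P x ∧ (((Finset.range N).filter fun j => x ∈ bad j).card : ENNReal) ≤ ε := by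
  let f : Y → ENNReal := fun x => ∑ j ∈ Finset.range N, (bad j).indicator 1 x
  have hf : Measurable f := Finset.measurable_fun_sum _ fun j _ =>
    measurable_one.indicator (hbad j)
  have hint : ∫⁻ x, f x ∂μ ≤ ε := by
    rw [lintegral_finsetSum _ fun j _ => measurable_one.indicator (hbad j)]
    simpa [lintegral_indicator_one (hbad _)] using h
  have hfx : ∀ x, f x = (((Finset.range N).filter fun j => x ∈ bad j).card : ENNReal) := by
    intro x
    simp only [f, Set.indicator_apply, Pi.one_apply]
    rw [Finset.sum_ite, Finset.sum_const_zero, add_zero, Finset.sum_const, nsmul_one]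
  obtain ⟨x, hx, hxf⟩ := exists_notMem_null_le_lintegral (μ := μ) (N := {x | ¬ P x})
    hf.aemeasurable (ae_iff.1 hP)
  exact ⟨x, not_not.1 hx, (hfx x).symm.le.trans (hxf.trans hint)⟩

variable {n : ℕ}

/-- If the conjugates `cnj (w ^ j) Z` follow the powers of `v` along an arithmetic progression
up to an error `δ`, then `v` is unipotent up to an error of the same order. -/
theorem norm_sub_one_pow_le {w : SLR n} {D : ℕ}
    (hD : ∀ Z a b, IsPolySeq D fun j => cnj (w ^ j) Z a b) {m : ℕ} (hm : D < m)
    {Z v : Matrix (Fin n) (Fin n) ℝ} {t : SLR n} {a s : ℕ} {δ : ℝ}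
    (h : ∀ k ≤ m, ∃ b : Matrix (Fin n) (Fin n) ℝ, ‖b - 1‖ ≤ δ ∧
      cnj (w ^ (a + k * s)) Z = b * v ^ k * (t : Matrix (Fin n) (Fin n) ℝ)) :
    ‖(v - 1) ^ m‖ ≤ (∑ k ∈ Finset.range (m + 1), (m.choose k : ℝ) * ‖v ^ k‖) * δ := by
  choose! b hb hbe using h
  let c : ℕ → ℝ := fun k => (-1 : ℝ) ^ (m - k) * m.choose k
  have h0 : ∑ k ∈ Finset.range (m + 1), c k • (b k * v ^ k) = 0 := by
    have h1 : (∑ k ∈ Finset.range (m + 1), c k • (b k * v ^ k)) *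
        (t : Matrix (Fin n) (Fin n) ℝ) = 0 := by
      rw [Finset.sum_mul]
      ext i j
      rw [Matrix.sum_apply, Matrix.zero_apply,
        ← (hD Z i j).sum_alternating_eq_zero hm a s]
      refine Finset.sum_congr rfl fun k hk => ?_
      rw [hbe k (Nat.lt_succ_iff.1 (Finset.mem_range.1 hk)), smul_mul_assoc, Matrix.smul_apply,
        smul_eq_mul]
    have h2 := congrArg (· * ((t⁻¹ : SLR n) : Matrix (Fin n) (Fin n) ℝ)) h1
    simpa only [mul_assoc, SLR.coe_mul_coe_inv, mul_one, zero_mul] using h2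
  have h1 : (v - 1) ^ m = ∑ k ∈ Finset.range (m + 1), c k • v ^ k := by
    rw [sub_eq_add_neg, (Commute.neg_right (Commute.one_right v)).add_pow]
    refine Finset.sum_congr rfl fun k _ => ?_
    have : ((-1 : Matrix (Fin n) (Fin n) ℝ)) ^ (m - k) =
        ((-1 : ℝ) ^ (m - k)) • (1 : Matrix (Fin n) (Fin n) ℝ) := by
      rw [← one_pow (M := Matrix (Fin n) (Fin n) ℝ) (m - k), ← smul_pow]
      simp
    rw [this, mul_smul_comm, mul_one, smul_mul_assoc, ← nsmul_eq_mul', ← Nat.cast_smul_eq_nsmul ℝ,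
      smul_smul]
  have h2 : (v - 1) ^ m = -∑ k ∈ Finset.range (m + 1), c k • ((b k - 1) * v ^ k) := by
    rw [h1, eq_neg_iff_add_eq_zero, ← Finset.sum_add_distrib, ← h0]
    refine Finset.sum_congr rfl fun k _ => ?_
    rw [← smul_add, sub_mul, one_mul, add_sub_cancel]
  rw [h2, norm_neg, Finset.sum_mul]
  refine (norm_sum_le _ _).trans (Finset.sum_le_sum fun k hk => ?_)
  rw [norm_smul]
  have hc : ‖c k‖ = (m.choose k : ℝ) := by simp [c]
  rw [hc, mul_assoc]
  gcongr
  refine (norm_mul_le _ _).trans ?_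
  rw [mul_comm]
  gcongr
  exact hb k (Nat.lt_succ_iff.1 (Finset.mem_range.1 hk))

variable {n : ℕ}

theorem IsR1.toSL_natCast_mul {Y : Matrix (Fin n) (Fin n) ℝ} (hY : IsR1 Y) (i : ℕ) (c : ℝ) :
    toSL (1 + ((i : ℝ) * c) • Y) = toSL (1 + c • Y) ^ i := by
  induction i with
  | zero => simp [toSL_one]
  | succ i ih => rw [Nat.cast_succ, add_mul, one_mul, hY.toSL_add, ih, pow_succ]

theorem commute_toSL_of_cnj_eq {u : SLR n} {Y : Matrix (Fin n) (Fin n) ℝ} (huY : cnj u Y = Y)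
    (t : ℝ) : Commute u (toSL (1 + t • Y)) := by
  have := mul_toSL_mul_inv u (1 + t • Y)
  rw [cnj_add, cnj_one, cnj_smul, huY, mul_inv_eq_iff_eq_mul] at this
  exact this

/-- The discrepancy between `1 + s X₀ + τ Y` and `1 + τ Y`. -/
noncomputable def slip (X₀ Y : Matrix (Fin n) (Fin n) ℝ) (s τ : ℝ) : SLR n :=
  toSL (1 + s • X₀ + τ • Y) * (toSL (1 + τ • Y))⁻¹

theorem IsR1.eventually_slip_mem (hn : n ≠ 0) (X₀ : Matrix (Fin n) (Fin n) ℝ)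
    {Y : Matrix (Fin n) (Fin n) ℝ} (hY : IsR1 Y) (L : ℝ) {U : Set (SLR n)} (hU : U ∈ 𝓝 1) :
    ∀ᶠ s in 𝓝 (0 : ℝ), ∀ τ ∈ Icc 0 L, slip X₀ Y s τ ∈ U := by
  refine isCompact_Icc.eventually_forall_of_forall_eventually fun τ _ => ?_
  have hc : ContinuousAt (fun p : ℝ × ℝ => slip X₀ Y p.1 p.2) (0, τ) := by
    refine ContinuousAt.mul ?_ ?_
    · have hdet : 0 < (1 + (0 : ℝ) • X₀ + τ • Y).det := by
        rw [zero_smul, add_zero, hY.det_eq]; exact one_pos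
      exact ContinuousAt.comp (f := fun p : ℝ × ℝ => 1 + p.1 • X₀ + p.2 • Y) (x := (0, τ))
        (continuousAt_toSL hn hdet) (by fun_prop)
    · exact ((hY.continuous_toSL.comp continuous_snd).inv).continuousAt
  have h0 : slip X₀ Y 0 τ = 1 := by rw [slip, zero_smul, add_zero, mul_inv_cancel]
  rw [ContinuousAt, h0] at hc
  exact hc hU

variable {X : Type*} [TopologicalSpace X] [MeasurableSpace X] [MulAction (SLR n) X]
  [HomSpace n X] {μ : Measure X} [IsProbabilityMeasure μ] [SMulInvariantMeasure (SLR n) X μ]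
variable {u w : SLR n} {Ω : Type} [MeasurableSpace Ω] {T : Ω → Ω} {Φ : Ω → X → X}

theorem Fam.iterate (h : Fam u w μ T Φ) (j : ℕ) (ω : Ω) :
    ∀ᵐ x ∂μ, Φ (T^[j] ω) (u ^ j • x) = w ^ j • Φ ω x :=
  ((h.pairFam (Commute.one_right u)).iterate j ω).mono fun _ hx => congrArg Prod.fst hx

theorem Fam.tendsto_lintegral_farMeas_nhds (h : Fam u w μ T Φ) {ν : Measure Ω}
    [IsProbabilityMeasure ν] {δ : ℝ} (hδ : 0 < δ) :
    Tendsto (fun κ : SLR n => ∫⁻ ω, farMeas μ (Φ ω) δ κ ∂ν) (𝓝 1) (𝓝 0) :=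
  tendsto_of_seq_tendsto fun _ hκ => h.tendsto_lintegral_farMeas hδ hκ

theorem Fam.frequently_slip (hn : n ≠ 0) (h : Fam u w μ T Φ) {ν : Measure Ω}
    [IsProbabilityMeasure ν] (hT : MeasurePreserving T ν ν) (X₀ : Matrix (Fin n) (Fin n) ℝ)
    {Y : Matrix (Fin n) (Fin n) ℝ} (hY : IsR1 Y) {c : ℝ} (hc : 0 ≤ c) (K : ℕ) {δ : ℝ} (hδ : 0 < δ)
    {ε : ENNReal} (hε : 0 < ε) :
    ∀ᵐ ω ∂ν, ∃ᶠ s : ℕ in atTop, 0 < s ∧ ∑ j ∈ Finset.range (K * s),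
      farMeas μ (Φ (T^[j] ω)) δ (slip X₀ Y (c / s) (c / s * j)) ≤ ε * (K * s : ℕ) := by
  let κ : ℕ → ℕ → SLR n := fun s j => slip X₀ Y (c / s) (c / s * j)
  have hm : ∀ s j, Measurable fun ω => farMeas μ (Φ (T^[j] ω)) δ (κ s j) := fun s j =>
    (h.measurable_farMeas δ (κ s j)).comp (hT.iterate j).measurable
  let F : ℕ → Ω → ENNReal := fun s ω => ((K * s : ℕ) : ENNReal)⁻¹ *
    ∑ j ∈ Finset.range (K * s), farMeas μ (Φ (T^[j] ω)) δ (κ s j)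
  have hF : ∀ s, Measurable (F s) := fun s =>
    (Finset.measurable_fun_sum _ fun j _ => hm s j).const_mul _
  have hlim : Tendsto (fun s => ∫⁻ ω, F s ω ∂ν) atTop (𝓝 0) := by
    rw [ENNReal.tendsto_nhds_zero]
    intro a ha
    have h1 : ∀ᶠ g in 𝓝 (1 : SLR n), ∫⁻ ω, farMeas μ (Φ ω) δ g ∂ν ≤ a :=
      ENNReal.tendsto_nhds_zero.1 (h.tendsto_lintegral_farMeas_nhds hδ) a ha
    have h2 := (tendsto_const_div_atTop_nhds_zero_nat c).eventually
      (hY.eventually_slip_mem hn X₀ (c * K) h1)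
    filter_upwards [h2, eventually_gt_atTop 0] with s hs hs0
    simp only [F]
    rw [lintegral_const_mul _ (Finset.measurable_fun_sum _ fun j _ => hm s j),
      lintegral_finsetSum _ fun j _ => hm s j]
    have e : ∀ j ∈ Finset.range (K * s), ∫⁻ ω, farMeas μ (Φ (T^[j] ω)) δ (κ s j) ∂ν ≤ a := by
      intro j hj
      have e1 : ∫⁻ ω, farMeas μ (Φ (T^[j] ω)) δ (κ s j) ∂ν = ∫⁻ ω, farMeas μ (Φ ω) δ (κ s j) ∂ν :=
        (hT.iterate j).lintegral_comp (h.measurable_farMeas δ (κ s j))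
      rw [e1]
      refine hs _ ⟨by positivity, ?_⟩
      have hj' : (j : ℝ) ≤ K * s := by exact_mod_cast (Finset.mem_range.1 hj).le
      have hs' : (0 : ℝ) < s := by exact_mod_cast hs0
      calc c / s * j ≤ c / s * (K * s) := by gcongr
        _ = c * K := by field_simp
    calc _ ≤ ((K * s : ℕ) : ENNReal)⁻¹ * ((K * s : ℕ) * a) := by
          gcongr
          refine (Finset.sum_le_sum e).trans ?_
          rw [Finset.sum_const, Finset.card_range, nsmul_eq_mul]
      _ ≤ a := by
          rw [← mul_assoc]
          exact mul_le_of_le_one_left zero_le (ENNReal.inv_mul_le_one _)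
  filter_upwards [frequently_le_of_lintegral_tendsto hF hlim hε] with ω hω
  refine (hω.and_eventually (eventually_gt_atTop 0)).mono fun s ⟨hs, hs0⟩ => ⟨hs0, ?_⟩
  by_cases hK : K * s = 0
  · simp [hK]
  have hN1 : ((K * s : ℕ) : ENNReal) ≠ 0 := by exact_mod_cast hK
  have := mul_le_mul_left hs.le ((K * s : ℕ) : ENNReal)
  rwa [mul_right_comm, ENNReal.inv_mul_cancel hN1 (ENNReal.natCast_ne_top _), one_mul] at this

theorem Fam.norm_sub_one_pow_le (h : Fam u w μ T Φ) {X₀ Y : Matrix (Fin n) (Fin n) ℝ}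
    (hX : cnj u X₀ = X₀ + Y) (huY : cnj u Y = Y) (hY : IsR1 Y) {D m : ℕ}
    (hD : ∀ Z a b, IsPolySeq D fun j => cnj (w ^ j) Z a b) (hm : D < m) {ε : ENNReal}
    (hε : 16 * (m + 1) * ε ≤ 1) {r δ₀ δ₁ η₁ η : ℝ} (hr : μ (Inj n X r)ᶜ ≤ ε)
    (hη₁ : ∀ a ∈ bal n η₁, ∀ b ∈ bal n η₁, a⁻¹ * b ∈ bal n r) (h01 : δ₀ ≤ η₁)
    (hLem : ∀ N > 0, ∀ (p q : X) (good : ℕ → Prop),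
      (∀ j, good j → w ^ j • p ∈ Inj n X r ∧ (w ^ j • p, w ^ j • q) ∈ GRel X (bal n δ₁)) →
      7 * N ≤ 8 * (goodTimes good 0 N).card → (p, q) ∈ GRel X (cnjBal w δ₀ N))
    (hη : ∀ b ∈ bal n η, ∀ v ∈ bal n η, ∀ t ∈ bal n η, ∀ k ≤ m,
      b * v ^ k * t ∈ bal n (min δ₁ η₁))
    {ω : Ω} {c : ℝ} (hc : 0 ≤ c) {v : SLR n} (hv : v ∈ bal n η) (hwv : Commute w v)
    (hvI : Intw μ (Φ ω) (toSL (1 + c • Y)) v)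
    (hτ : ∀ τ ∈ Icc 0 c, ∃ t ∈ bal n η, Commute w t ∧ Intw μ (Φ ω) (toSL (1 + τ • Y)) t)
    {δ : ℝ} (hδ : δ ≤ η) {s : ℕ} (hs : 0 < s)
    (hsum : ∑ j ∈ Finset.range ((m + 1) * s),
      farMeas μ (Φ (T^[j] ω)) δ (slip X₀ Y (c / s) (c / s * j)) ≤ ε * ((m + 1) * s : ℕ)) :
    ‖((v : Matrix (Fin n) (Fin n) ℝ) - 1) ^ m‖ ≤
      (∑ k ∈ Finset.range (m + 1), (m.choose k : ℝ) *
        ‖(v : Matrix (Fin n) (Fin n) ℝ) ^ k‖) * δ := by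
  classical
  have : BorelSpace X := HomSpace.toBorelSpace n
  have : SecondCountableTopology X := HomSpace.toSecondCountableTopology n
  choose! t htη htw htI using hτ
  let N := (m + 1) * s
  have hN : 0 < N := by positivity
  let g : SLR n := toSL (1 + (c / s) • X₀)
  let C : ℕ → SLR n := fun j => toSL (1 + (c / s * j) • Y)
  let κ : ℕ → SLR n := fun j => slip X₀ Y (c / s) (c / s * j)
  have hs' : (0 : ℝ) < s := by exact_mod_cast hs
  have hCu : ∀ j, Commute (u ^ j) (C j) := fun j => (commute_toSL_of_cnj_eq huY _).pow_left j
  have hκ : ∀ j, κ j * (u ^ j * C j) = u ^ j * g := by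
    intro j
    have := pow_mul_toSL_mul_inv hX huY j (c / s)
    rw [mul_inv_eq_iff_eq_mul] at this
    rw [this, (hCu j).eq, ← mul_assoc]
    simp only [κ, slip, C, inv_mul_cancel_right]
  have hj0 : ∀ j, c / s * (j % s : ℕ) ∈ Icc 0 c := by
    intro j
    have : ((j % s : ℕ) : ℝ) ≤ s := by exact_mod_cast (Nat.mod_lt j hs).le
    refine ⟨by positivity, ?_⟩
    calc c / s * (j % s : ℕ) ≤ c / s * s := by gcongr
      _ = c := by field_simp
  let w' : ℕ → SLR n := fun j => v ^ (j / s) * t (c / s * (j % s : ℕ))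
  have hw'I : ∀ j, Intw μ (Φ ω) (C j) (w' j) := by
    intro j
    have e : c / s * j = ((j / s : ℕ) : ℝ) * c + c / s * (j % s : ℕ) := by
      have : (j : ℝ) = s * (j / s : ℕ) + (j % s : ℕ) := by
        exact_mod_cast (Nat.div_add_mod j s).symm
      rw [this]
      field_simp
    have e2 : C j = toSL (1 + c • Y) ^ (j / s) * toSL (1 + (c / s * (j % s : ℕ)) • Y) := by
      simp only [C]
      rw [e, hY.toSL_add, hY.toSL_natCast_mul]
    rw [e2]
    exact (hvI.pow _).mul (htI _ (hj0 j))
  have hw'c : ∀ j, Commute w (w' j) := fun j =>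
    (hwv.pow_right _).mul_right (htw _ (hj0 j))
  let bad : ℕ → Set X := fun j => (fun x => Φ (T^[j] ω) (u ^ j • x)) ⁻¹' (Inj n X r)ᶜ ∪
    (fun x => (u ^ j * C j) • x) ⁻¹'
      {z | (Φ (T^[j] ω) z, Φ (T^[j] ω) (κ j • z)) ∉ GRel X (bal n δ)}
  have hfm : ∀ j, MeasurableSet {z | (Φ (T^[j] ω) z, Φ (T^[j] ω) (κ j • z)) ∉ GRel X (bal n δ)} :=
    fun j => measurableSet_notNear δ (h.mp _).measurable
      ((h.mp _).measurable.comp (measurable_const_smul _))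
  have hmI : ∀ j, Measurable fun x => Φ (T^[j] ω) (u ^ j • x) := fun j =>
    (h.mp _).measurable.comp (measurable_const_smul _)
  have hbad : ∀ j, MeasurableSet (bad j) := fun j =>
    ((hmI j) (measurableSet_Inj r).compl).union (measurable_const_smul _ (hfm j))
  have hbadμ : ∀ j, μ (bad j) ≤ ε + farMeas μ (Φ (T^[j] ω)) δ (κ j) := by
    intro j
    refine (measure_union_le _ _).trans (add_le_add ?_ ?_)
    · have := ((h.mp (T^[j] ω)).comp (measurePreserving_smul (u ^ j) μ)).measure_preimage
        (measurableSet_Inj (n := n) (X := X) r).compl.nullMeasurableSet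
      exact this.le.trans hr
    · have := (measurePreserving_smul (u ^ j * C j) μ).measure_preimage
        (hfm j).nullMeasurableSet
      exact this.le
  have hsumbad : ∑ j ∈ Finset.range N, μ (bad j) ≤ 2 * ε * N := by
    refine (Finset.sum_le_sum fun j _ => hbadμ j).trans ?_
    rw [Finset.sum_add_distrib, Finset.sum_const, Finset.card_range, nsmul_eq_mul]
    refine (add_le_add le_rfl hsum).trans ?_
    rw [mul_comm (N : ENNReal), ← add_mul, two_mul]
  have hae : ∀ᵐ x ∂μ, (∀ j, Φ (T^[j] ω) (u ^ j • x) = w ^ j • Φ ω x) ∧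
      (∀ j, Φ (T^[j] ω) (u ^ j • C j • x) = w ^ j • Φ ω (C j • x)) ∧
      (∀ j, Φ (T^[j] ω) (u ^ j • g • x) = w ^ j • Φ ω (g • x)) ∧
      (∀ j, Φ ω (C j • x) = w' j • Φ ω x) :=
    (ae_all_iff.2 fun j => h.iterate j ω).and <|
      (ae_all_iff.2 fun j => ae_smul (C j) (h.iterate j ω)).and <|
      (ae_all_iff.2 fun j => ae_smul g (h.iterate j ω)).and (ae_all_iff.2 hw'I)
  obtain ⟨x, ⟨hx1, hx2, hx3, hx4⟩, hxbad⟩ := exists_few_bad μ hbad hsumbad hae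
  set B := (Finset.range N).filter fun j => x ∈ bad j with hBdef
  have hxbad' : (B.card : ENNReal) ≤ 2 * ε * N := by
    rw [hBdef]
    refine le_trans (le_of_eq ?_) hxbad
    congr
  have hB8 : 8 * B.card ≤ s := by
    have h1 : (8 * B.card : ENNReal) ≤ s := by
      calc (8 * B.card : ENNReal) ≤ 8 * (2 * ε * N) := mul_le_mul_right hxbad' 8
        _ = 16 * (m + 1) * ε * s := by
          simp only [N]; push_cast; ring
        _ ≤ 1 * s := by gcongr
        _ = s := one_mul _
    exact_mod_cast h1
  set p := Φ ω x
  set q := Φ ω (g • x)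
  have hgood : ∀ j, x ∉ bad j → w ^ j • p ∈ Inj n X r ∧
      ∃ b ∈ bal n δ, (b * w' j) • w ^ j • p = w ^ j • q := by
    intro j hj
    rw [mem_union, not_or] at hj
    obtain ⟨hj1, hj2⟩ := hj
    refine ⟨?_, ?_⟩
    · have : Φ (T^[j] ω) (u ^ j • x) ∈ Inj n X r := not_not.1 hj1
      rwa [hx1] at this
    · have h2 : (Φ (T^[j] ω) ((u ^ j * C j) • x), Φ (T^[j] ω) (κ j • (u ^ j * C j) • x)) ∈
        GRel X (bal n δ) := not_not.1 hj2
      rw [← mul_smul, hκ, mul_smul, mul_smul, hx2, hx3, hx4, ← mul_smul,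
        ((hw'c j).pow_left j).eq, mul_smul] at h2
      obtain ⟨b, hb, hbe⟩ := h2
      exact ⟨b, hb, by rw [mul_smul]; exact hbe⟩
  have hjs : ∀ j < N, j / s ≤ m := fun j hj => by
    have : j / s < m + 1 := (Nat.div_lt_iff_lt_mul hs).2 hj
    omega
  have hsmall : ∀ j < N, ∀ b ∈ bal n δ, b * w' j ∈ bal n (min δ₁ η₁) := by
    intro j hj b hb
    simp only [w']
    rw [← mul_assoc]
    exact hη b (bal_mono hδ hb) v hv _ (htη _ (hj0 j)) _ (hjs j hj)
  have hrel : (p, q) ∈ GRel X (cnjBal w δ₀ N) := by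
    refine hLem N hN p q (fun j => j < N ∧ x ∉ bad j) (fun j hj => ?_) ?_
    · obtain ⟨hj1, b, hb, hbe⟩ := hgood j hj.2
      exact ⟨hj1, b * w' j, bal_mono (min_le_left _ _) (hsmall j hj.1 b hb), hbe⟩
    · have h1 := Finset.card_filter_add_card_filter_not (s := Finset.range N) (fun j => x ∈ bad j)
      have h2 : (goodTimes (fun j => j < N ∧ x ∉ bad j) 0 N).card =
          ((Finset.range N).filter fun j => ¬ x ∈ bad j).card := by
        rw [goodTimes, ← Finset.range_eq_Ico]
        congr 1
        ext j
        simp only [Finset.mem_filter, Finset.mem_range]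
        tauto
      rw [Finset.card_range, ← hBdef] at h1
      rw [h2]
      have h3 : s ≤ N := Nat.le_mul_of_pos_left s (Nat.succ_pos m)
      omega
  obtain ⟨g', hg', hg'q⟩ := hrel
  obtain ⟨a, ha, haB⟩ := exists_arith_progression_notMem B (s := s) (by omega) (m + 1)
  refine _root_.norm_sub_one_pow_le (w := w) (t := t (c / s * a)) (s := s) (a := a)
    (Z := (g' : Matrix (Fin n) (Fin n) ℝ)) hD hm fun k hk => ?_
  have hjN : a + k * s < N := by
    calc a + k * s < s + k * s := by omega
      _ = (k + 1) * s := by ring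
      _ ≤ N := Nat.mul_le_mul_right _ (by omega)
  have hjb : x ∉ bad (a + k * s) := fun hb => haB k (by omega)
    (Finset.mem_filter.2 ⟨Finset.mem_range.2 hjN, hb⟩)
  obtain ⟨hj1, b, hb, hbe⟩ := hgood _ hjb
  refine ⟨b, hb, ?_⟩
  have hdiv : (a + k * s) / s = k := by
    rw [Nat.add_mul_div_right _ _ hs, Nat.div_eq_of_lt ha, zero_add]
  have hmod : (a + k * s) % s = a := by
    rw [Nat.add_mul_mod_self_right, Nat.mod_eq_of_lt ha]
  have e1 : w ^ (a + k * s) * g' * (w ^ (a + k * s))⁻¹ = b * w' (a + k * s) := by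
    refine eq_of_mem_Inj hη₁ hj1 (bal_mono h01 (hg' _ hjN))
      (bal_mono (min_le_right _ _) (hsmall _ hjN b hb)) ?_
    rw [hbe, ← mul_smul, inv_mul_cancel_right, mul_smul]
    exact congrArg _ hg'q
  have e2 := congrArg (fun g : SLR n => (g : Matrix (Fin n) (Fin n) ℝ)) e1
  simp only [w', hdiv, hmod, Matrix.SpecialLinearGroup.coe_mul,
    Matrix.SpecialLinearGroup.coe_pow, ← mul_assoc] at e2
  simp only [cnj, Matrix.SpecialLinearGroup.coe_pow, ← mul_assoc]
  exact e2

variable {n : ℕ}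
variable {X : Type*} [TopologicalSpace X] [MeasurableSpace X] [MulAction (SLR n) X]
  [HomSpace n X] {μ : Measure X} [IsProbabilityMeasure μ] [SMulInvariantMeasure (SLR n) X μ]
variable {u w : SLR n} {Ω : Type} [MeasurableSpace Ω] {T : Ω → Ω} {Φ : Ω → X → X}

theorem exists_bal_mul_pow_mul_mem (m : ℕ) {δ : ℝ} (hδ : 0 < δ) :
    ∃ η > 0, ∀ b ∈ bal n η, ∀ v ∈ bal n η, ∀ t ∈ bal n η, ∀ k ≤ m, b * v ^ k * t ∈ bal n δ := by
  have h : ∀ k : ℕ, ∀ᶠ p : SLR n × SLR n × SLR n in 𝓝 (1, 1, 1),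
      p.1 * p.2.1 ^ k * p.2.2 ∈ bal n δ := by
    intro k
    have hc : Continuous fun p : SLR n × SLR n × SLR n => p.1 * p.2.1 ^ k * p.2.2 := by fun_prop
    refine hc.continuousAt ?_
    simpa using bal_mem_nhds n hδ
  have h' := (Finset.eventually_all (Finset.range (m + 1))).2 fun k _ => h k
  rw [nhds_prod_eq, nhds_prod_eq] at h'
  obtain ⟨U, hU, V, hV, hUV⟩ := Filter.mem_prod_iff.1 h'
  obtain ⟨V₁, hV₁, V₂, hV₂, hVV⟩ := Filter.mem_prod_iff.1 hV
  obtain ⟨η, hη, hs⟩ := hasBasis_nhds_one_bal.mem_iff.1 (inter_mem hU (inter_mem hV₁ hV₂))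
  refine ⟨η, hη, fun b hb v hv t ht k hk => ?_⟩
  exact hUV (show ((b, v, t) : SLR n × SLR n × SLR n) ∈ U ×ˢ V from
    ⟨(hs hb).1, hVV ⟨(hs hv).2.1, (hs ht).2.2⟩⟩) k (Finset.mem_range.2 (by omega))

/-- Along a shear direction of `u` the family intertwines short root elements with unipotents. -/
theorem Fam.ae_exists_unip (hn : 2 ≤ n) (hu : Unip u) (hu1 : u ≠ 1) (hw : Unip w)
    {ν : Measure Ω} [IsProbabilityMeasure ν] (hT : MeasurePreserving T ν ν) (h : Fam u w μ T Φ)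
    {X₀ Y : Matrix (Fin n) (Fin n) ℝ} (hX : cnj u X₀ = X₀ + Y) (huY : cnj u Y = Y) (hY : IsR1 Y) :
    ∀ᵐ ω ∂ν, ∃ k₀ : ℕ, ∀ k : ℕ, k₀ ≤ k → ∃ v, Unip v ∧
      Intw μ (Φ ω) (toSL (1 + (1 / ((k : ℝ) + 1)) • Y)) v := by
  obtain ⟨D, hD⟩ := hw.isPolySeq_cnj
  let m := D + 1
  let ε : ENNReal := (16 * (m + 1))⁻¹
  have hne : (16 * (m + 1) : ENNReal) ≠ ⊤ := by finiteness
  have hε0 : 0 < ε := ENNReal.inv_pos.2 hne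
  have hε : 16 * (m + 1) * ε ≤ 1 := ENNReal.mul_inv_le_one _
  obtain ⟨r, hr0, hr⟩ := exists_Inj_compl_le (n := n) μ hε0
  obtain ⟨η₁, hη₁0, hη₁⟩ := exists_bal_inv_mul_mem (n := n) hr0
  obtain ⟨δ₁, hδ₁, hLem⟩ := exists_cnjBal X hw hr0 hη₁0
  obtain ⟨η, hη0, hη⟩ := exists_bal_mul_pow_mul_mem (n := n) m (lt_min hδ₁ hη₁0)
  have hfr : ∀ᵐ ω ∂ν, ∀ k l : ℕ, ∃ᶠ s : ℕ in atTop, 0 < s ∧ ∑ j ∈ Finset.range ((m + 1) * s),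
      farMeas μ (Φ (T^[j] ω)) (min η (1 / ((l : ℝ) + 1)))
        (slip X₀ Y (1 / ((k : ℝ) + 1) / s) (1 / ((k : ℝ) + 1) / s * j)) ≤
        ε * ((m + 1) * s : ℕ) :=
    ae_all_iff.2 fun k => ae_all_iff.2 fun l => h.frequently_slip (by omega) hT X₀ hY
      (by positivity) (m + 1) (lt_min hη0 (by positivity)) hε0
  filter_upwards [hfr, h.forall_mem_cIntw hn hu hu1 hw hT hY huY] with ω hω hc
  obtain ⟨ρ, hρ, hnear⟩ := Intw.exists_near hn (h.mp ω) hη0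
  obtain ⟨k₀, hk₀⟩ := exists_nat_gt (‖Y‖ / ρ)
  refine ⟨k₀, fun k hk => ?_⟩
  have hk1 : 1 / ((k : ℝ) + 1) * ‖Y‖ ≤ ρ := by
    have hkk : (k₀ : ℝ) ≤ k := by exact_mod_cast hk
    rw [div_lt_iff₀ hρ] at hk₀
    rw [one_div, inv_mul_le_iff₀ (by positivity)]
    nlinarith
  have hτ : ∀ τ ∈ Icc 0 (1 / ((k : ℝ) + 1)), ∃ t ∈ bal n η, Commute w t ∧
      Intw μ (Φ ω) (toSL (1 + τ • Y)) t := by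
    intro τ hτ
    obtain ⟨t, htw, htI⟩ := hc τ
    have : toSL (1 + τ • Y) ∈ bal n ρ := toSL_one_add_smul_mem_bal hY <| by
      rw [norm_smul, Real.norm_of_nonneg hτ.1]
      exact (mul_le_mul_of_nonneg_right hτ.2 (norm_nonneg _)).trans hk1
    obtain ⟨z, hz, hz1, hz2⟩ := hnear _ t this htI
    exact ⟨z * t, hz1, Commute.mul_right (hz.commute w).symm htw, hz2⟩
  have hk0 : (0 : ℝ) ≤ 1 / ((k : ℝ) + 1) := by positivity
  obtain ⟨v, hv, hwv, hvI⟩ := hτ _ ⟨hk0, le_rfl⟩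
  refine ⟨v, ⟨m, ?_⟩, hvI⟩
  set C := ∑ k ∈ Finset.range (m + 1), (m.choose k : ℝ) *
    ‖(v : Matrix (Fin n) (Fin n) ℝ) ^ k‖ with hC
  have hC0 : 0 ≤ C := Finset.sum_nonneg fun _ _ => by positivity
  have hb : ∀ l : ℕ, ‖((v : Matrix (Fin n) (Fin n) ℝ) - 1) ^ m‖ ≤ C * (1 / ((l : ℝ) + 1)) := by
    intro l
    obtain ⟨s, hs, hsum⟩ := (hω k l).exists
    refine (h.norm_sub_one_pow_le hX huY hY hD (Nat.lt_succ_self D) hε hr hη₁ le_rfl hLem hη hk0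
      hv hwv hvI hτ (min_le_left _ _) hs hsum).trans ?_
    gcongr
    exact min_le_right _ _
  have hlim : Tendsto (fun l : ℕ => C * (1 / ((l : ℝ) + 1))) atTop (𝓝 (C * 0)) :=
    tendsto_one_div_add_atTop_nhds_zero_nat.const_mul C
  rw [mul_zero] at hlim
  exact norm_le_zero_iff.1 (ge_of_tendsto' hlim hb)

/-- A real function given by a polynomial. -/
def IsPolyFun (f : ℝ → ℝ) : Prop := ∃ p : Polynomial ℝ, ∀ t, f t = p.eval t

namespace IsPolyFun
variable {f g : ℝ → ℝ}

theorem const (c : ℝ) : IsPolyFun fun _ => c := ⟨Polynomial.C c, by simp⟩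

theorem mul (hf : IsPolyFun f) (hg : IsPolyFun g) : IsPolyFun fun t => f t * g t := by
  obtain ⟨p, hp⟩ := hf
  obtain ⟨q, hq⟩ := hg
  exact ⟨p * q, fun t => by simp [hp, hq]⟩

theorem sum {ι : Type*} {f : ι → ℝ → ℝ} (s : Finset ι) (hf : ∀ i ∈ s, IsPolyFun (f i)) :
    IsPolyFun fun t => ∑ i ∈ s, f i t := by
  choose! p hp using hf
  refine ⟨∑ i ∈ s, p i, fun t => ?_⟩
  rw [Polynomial.eval_finsetSum]
  exact Finset.sum_congr rfl fun i hi => hp i hi t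

theorem prod {ι : Type*} {f : ι → ℝ → ℝ} (s : Finset ι) (hf : ∀ i ∈ s, IsPolyFun (f i)) :
    IsPolyFun fun t => ∏ i ∈ s, f i t := by
  choose! p hp using hf
  refine ⟨∏ i ∈ s, p i, fun t => ?_⟩
  rw [Polynomial.eval_prod]
  exact Finset.prod_congr rfl fun i hi => hp i hi t

theorem comp_affine (hf : IsPolyFun f) (a b : ℝ) : IsPolyFun fun t => f (a + b * t) := by
  obtain ⟨p, hp⟩ := hf
  exact ⟨p.comp (Polynomial.C a + Polynomial.C b * Polynomial.X), fun t => by simp [hp]⟩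

theorem continuous (hf : IsPolyFun f) : Continuous f := by
  obtain ⟨p, hp⟩ := hf
  rw [funext hp]
  exact p.continuous

theorem isPolySeq (hf : IsPolyFun f) : ∃ D, IsPolySeq D fun j => f j :=
  let ⟨p, hp⟩ := hf; ⟨p.natDegree, p, le_rfl, fun j => hp j⟩

theorem eq_of_natCast (hf : IsPolyFun f) (hg : IsPolyFun g) (h : ∀ j : ℕ, f j = g j) : f = g := by
  obtain ⟨p, hp⟩ := hf
  obtain ⟨q, hq⟩ := hg
  have : p = q := Polynomial.eq_of_infinite_eval_eq p q <|
    (Set.infinite_range_of_injective (Nat.cast_injective (R := ℝ))).mono <| by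
      rintro _ ⟨j, rfl⟩
      rw [mem_ofPred_eq, ← hp, ← hq, h]
  funext t
  rw [hp, hq, this]

end IsPolyFun

variable {n : ℕ}

/-- A one-parameter subgroup with polynomial entries. -/
structure IsUPG (P : ℝ → SLR n) : Prop where
  add : ∀ s t, P (s + t) = P s * P t
  poly : ∀ a b, IsPolyFun fun t => (P t : Matrix (Fin n) (Fin n) ℝ) a b

theorem IsPolyFun.matrix_mul {F G : ℝ → Matrix (Fin n) (Fin n) ℝ}
    (hF : ∀ a b, IsPolyFun fun t => F t a b) (hG : ∀ a b, IsPolyFun fun t => G t a b) (a b : Fin n) :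
    IsPolyFun fun t => (F t * G t) a b := by
  simp only [Matrix.mul_apply]
  exact IsPolyFun.sum _ fun i _ => (hF a i).mul (hG i b)

theorem matrix_eq_of_natCast {F G : ℝ → Matrix (Fin n) (Fin n) ℝ}
    (hF : ∀ a b, IsPolyFun fun t => F t a b) (hG : ∀ a b, IsPolyFun fun t => G t a b)
    (h : ∀ j : ℕ, F j = G j) (t : ℝ) : F t = G t := by
  ext a b
  exact congrFun ((hF a b).eq_of_natCast (hG a b) fun j => by rw [h]) t

namespace IsUPG
variable {P Q : ℝ → SLR n}

theorem zero (hP : IsUPG P) : P 0 = 1 := by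
  have := hP.add 0 0
  rw [add_zero] at this
  exact left_eq_mul.1 this

theorem neg (hP : IsUPG P) (t : ℝ) : P (-t) = (P t)⁻¹ := by
  rw [eq_inv_iff_mul_eq_one, ← hP.add, neg_add_cancel, hP.zero]

theorem natCast_mul (hP : IsUPG P) (j : ℕ) (t : ℝ) : P (j * t) = P t ^ j := by
  induction j with
  | zero => simp [hP.zero]
  | succ j ih => rw [Nat.cast_succ, add_mul, one_mul, hP.add, ih, pow_succ]

theorem natCast (hP : IsUPG P) (j : ℕ) : P j = P 1 ^ j := by
  rw [← hP.natCast_mul, mul_one]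

theorem continuous (hP : IsUPG P) : Continuous P := by
  rw [SLR.isClosedEmbedding_val n |>.isInducing.continuous_iff]
  exact continuous_matrix fun a b => (hP.poly a b).continuous

theorem eq_of_one (hP : IsUPG P) (hQ : IsUPG Q) (h : P 1 = Q 1) : P = Q := by
  funext t
  refine SL_ext (matrix_eq_of_natCast hP.poly hQ.poly (fun j => ?_) t)
  rw [hP.natCast, hQ.natCast, h]

theorem comp_mul (hP : IsUPG P) (c : ℝ) : IsUPG fun t => P (c * t) where
  add s t := by rw [mul_add, hP.add]
  poly a b := by simpa using (hP.poly a b).comp_affine 0 c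

theorem conj (hP : IsUPG P) (g : SLR n) : IsUPG fun t => g * P t * g⁻¹ where
  add s t := by rw [hP.add]; group
  poly a b := by
    simp only [Matrix.SpecialLinearGroup.coe_mul]
    exact IsPolyFun.matrix_mul (G := fun _ => (g⁻¹ : SLR n)) (IsPolyFun.matrix_mul
      (F := fun _ => g) (fun _ _ => .const _) hP.poly) (fun _ _ => .const _) a b

theorem unip (hP : IsUPG P) (t : ℝ) : Unip (P t) := by
  have h1 : ∀ a b, ∃ D, IsPolySeq D fun j =>
      ((P t ^ j : SLR n) : Matrix (Fin n) (Fin n) ℝ) a b := fun a b => by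
    simpa only [hP.natCast_mul, mul_comm t] using ((hP.comp_mul t).poly a b).isPolySeq
  choose D hD using h1
  let D' := ∑ a, ∑ b, D a b
  have hD' : ∀ a b, D a b ≤ D' := fun a b =>
    (Finset.single_le_sum (f := fun b => D a b) (fun _ _ => Nat.zero_le _) (Finset.mem_univ b)).trans
      (Finset.single_le_sum (f := fun a => ∑ b, D a b) (fun _ _ => Nat.zero_le _)
        (Finset.mem_univ a))
  refine ⟨D' + 1, ?_⟩
  rw [sub_eq_add_neg, (Commute.neg_right (Commute.one_right _)).add_pow]
  ext a b
  rw [Matrix.sum_apply, Matrix.zero_apply,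
    ← ((hD a b).mono (hD' a b)).sum_alternating_eq_zero (Nat.lt_succ_self D') 0 1]
  refine Finset.sum_congr rfl fun k _ => ?_
  rw [zero_add, mul_one, Matrix.SpecialLinearGroup.coe_pow, neg_pow, one_pow, mul_one]
  rw [show ((-1 : Matrix (Fin n) (Fin n) ℝ) ^ (D' + 1 - k)) =
    ((-1 : ℝ) ^ (D' + 1 - k)) • 1 by
      rcases neg_one_pow_eq_or ℝ (D' + 1 - k) with h | h
      all_goals
        rcases Nat.even_or_odd (D' + 1 - k) with h' | h' <;> simp [h'.neg_one_pow]]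
  rw [mul_smul_comm, mul_one, smul_mul_assoc, Matrix.smul_apply, ← nsmul_eq_mul',
    Matrix.smul_apply, smul_eq_mul, nsmul_eq_mul]
  ring

end IsUPG

theorem Unip.exists_isUPG {w : SLR n} (hw : Unip w) : ∃ P, IsUPG P ∧ P 1 = w := by
  obtain ⟨m, hm⟩ := hw
  choose p hp hp' using fun i => isPolySeq_choose i
  let N := (w : Matrix (Fin n) (Fin n) ℝ) - 1
  let F : ℝ → Matrix (Fin n) (Fin n) ℝ := fun t => ∑ i ∈ Finset.range m, (p i).eval t • N ^ i
  have hF : ∀ a b, IsPolyFun fun t => F t a b := fun a b => by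
    simp only [F, Matrix.sum_apply, Matrix.smul_apply, smul_eq_mul]
    exact IsPolyFun.sum _ fun i _ => IsPolyFun.mul ⟨p i, fun _ => rfl⟩ (.const _)
  have hFj : ∀ j : ℕ, F j = (w : Matrix (Fin n) (Fin n) ℝ) ^ j := fun j => by
    rw [show (w : Matrix (Fin n) (Fin n) ℝ) = 1 + N by simp [N], one_add_pow_eq_sum_choose hm]
    refine Finset.sum_congr rfl fun i _ => ?_
    rw [← hp', Nat.cast_smul_eq_nsmul]
  have hshift : ∀ s a b, IsPolyFun fun t => F (s + t) a b := fun s a b => by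
    simpa using (hF a b).comp_affine s 1
  have hFadd : ∀ s t, F (s + t) = F s * F t := by
    have h1 : ∀ (j : ℕ) t, F (j + t) = F j * F t := fun j =>
      matrix_eq_of_natCast (hshift _) (IsPolyFun.matrix_mul (fun _ _ => .const _) hF) fun k => by
        rw [← Nat.cast_add, hFj, hFj, hFj, pow_add]
    intro s t
    have h2 := matrix_eq_of_natCast (F := fun s => F (t + s)) (G := fun s => F s * F t) (hshift t)
      (IsPolyFun.matrix_mul hF fun _ _ => .const _) (fun j => by rw [add_comm, h1]) s
    rw [add_comm]; exact h2
  have hdet : ∀ t, (F t).det = 1 := by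
    have : IsPolyFun fun t => (F t).det := by
      simp only [Matrix.det_apply']
      exact IsPolyFun.sum _ fun σ _ => (IsPolyFun.const _).mul (IsPolyFun.prod _ fun i _ => hF _ _)
    exact congrFun (this.eq_of_natCast (.const 1) fun j => by
      rw [hFj, Matrix.det_pow, w.2, one_pow])
  refine ⟨fun t => toSL (F t), ⟨fun s t => SL_ext ?_, fun a b => ?_⟩, SL_ext ?_⟩
  · rw [Matrix.SpecialLinearGroup.coe_mul, coe_toSL_of_det_eq_one (hdet _),
      coe_toSL_of_det_eq_one (hdet _), coe_toSL_of_det_eq_one (hdet _), hFadd]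
  · simpa only [coe_toSL_of_det_eq_one (hdet _)] using hF a b
  · rw [coe_toSL_of_det_eq_one (hdet _)]
    simpa using hFj 1

theorem Unip.trace_eq {w : SLR n} (hw : Unip w) : (w : Matrix (Fin n) (Fin n) ℝ).trace = n := by
  have := (Matrix.isNilpotent_trace_of_isNilpotent hw).eq_zero
  rw [Matrix.trace_sub, Matrix.trace_one, Fintype.card_fin] at this
  linarith

theorem Unip.eq_of_isPM_mul {v z : SLR n} (hn : 2 ≤ n) (hz : IsPM z) (hv : Unip v)
    (hzv : Unip (z * v)) : z = 1 := by
  rcases hz with h | h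
  · exact SL_ext h
  · have := hzv.trace_eq
    rw [Matrix.SpecialLinearGroup.coe_mul, h, neg_one_mul, Matrix.trace_neg, hv.trace_eq] at this
    have : (0 : ℝ) < n := by exact_mod_cast (by omega : 0 < n)
    linarith

theorem IsUPG.eq_of_pow_eq {P : ℝ → SLR n} (hP : IsUPG P) {v : SLR n} (hv : Unip v) {m : ℕ}
    (hm : 0 < m) (h : v ^ m = P 1) : v = P (1 / m) := by
  obtain ⟨Q, hQ, hQ1⟩ := hv.exists_isUPG
  have hm' : (m : ℝ) ≠ 0 := by positivity
  have := (hQ.comp_mul m).eq_of_one hP (by rw [hQ.natCast_mul, hQ1, h])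
  rw [← this]
  show v = Q (m * (1 / m))
  rw [mul_one_div_cancel hm', hQ1]

variable {X : Type*} [TopologicalSpace X] [MeasurableSpace X] [MulAction (SLR n) X]
  [HomSpace n X] {μ : Measure X} [IsProbabilityMeasure μ] [SMulInvariantMeasure (SLR n) X μ]

theorem exists_isUPG_intw (hn : 2 ≤ n) {φ : X → X} (hφ : MeasurePreserving φ μ μ)
    {Y : Matrix (Fin n) (Fin n) ℝ} (hY : IsR1 Y) {k₀ : ℕ}
    (h : ∀ k : ℕ, k₀ ≤ k → ∃ v, Unip v ∧ Intw μ φ (toSL (1 + (1 / ((k : ℝ) + 1)) • Y)) v) :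
    ∃ P, IsUPG P ∧ ∀ t : ℝ, Intw μ φ (toSL (1 + t • Y)) (P t) := by
  choose! v hv hvI using h
  have hpow : ∀ k, k₀ ≤ k → Intw μ φ (toSL (1 + (1 : ℝ) • Y)) (v k ^ (k + 1)) := fun k hk => by
    have := (hvI k hk).pow (k + 1)
    rw [← hY.toSL_natCast_mul] at this
    rwa [Nat.cast_succ, mul_one_div_cancel (by positivity)] at this
  have hunip : ∀ k, k₀ ≤ k → Unip (v k ^ (k + 1)) := fun k hk => by
    obtain ⟨Q, hQ, hQ1⟩ := (hv k hk).exists_isUPG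
    rw [← hQ1, ← hQ.natCast]
    exact hQ.unip _
  obtain ⟨P, hP, hP1⟩ := (hunip k₀ le_rfl).exists_isUPG
  have heq : ∀ k, k₀ ≤ k → v k ^ (k + 1) = P 1 := fun k hk => by
    have h1 := (hpow k hk).mul (hpow k₀ le_rfl).inv
    rw [mul_inv_cancel] at h1
    have h2 := Intw.isPM_of_one hn hφ h1
    have h3 : v k ^ (k + 1) * (v k₀ ^ (k₀ + 1))⁻¹ * v k₀ ^ (k₀ + 1) = v k ^ (k + 1) :=
      inv_mul_cancel_right _ _
    have h4 := Unip.eq_of_isPM_mul hn h2 (hunip k₀ le_rfl) (by rw [h3]; exact hunip k hk)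
    rw [h4, one_mul] at h3
    rw [← h3, hP1]
  refine ⟨P, hP, fun t => ?_⟩
  let A : AddSubgroup ℝ :=
    { carrier := {t | Intw μ φ (toSL (1 + t • Y)) (P t)}
      add_mem' := fun {a b} ha hb => by
        show Intw μ φ (toSL (1 + (a + b) • Y)) (P (a + b))
        rw [hY.toSL_add, hP.add]; exact Intw.mul ha hb
      zero_mem' := by
        show Intw μ φ (toSL (1 + (0 : ℝ) • Y)) (P 0)
        rw [toSL_one_add_zero, hP.zero]; exact Intw.one
      neg_mem' := fun {a} ha => by
        show Intw μ φ (toSL (1 + (-a) • Y)) (P (-a))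
        rw [hY.toSL_neg, hP.neg]; exact Intw.inv ha }
  have hA : IsClosed (A : Set ℝ) :=
    (isClosed_intw (n := n) (μ := μ) hφ.measurable).preimage (hY.continuous_toSL.prodMk hP.continuous)
  have hd : Dense (A : Set ℝ) := A.dense_of_not_isolated_zero fun ε hε => by
    obtain ⟨k, hk⟩ := exists_nat_one_div_lt hε
    refine ⟨1 / (((max k k₀ : ℕ) : ℝ) + 1), ?_, by positivity, lt_of_le_of_lt ?_ hk⟩
    · show Intw μ φ _ _
      have h1 := hvI _ (le_max_right k k₀)
      rwa [hP.eq_of_pow_eq (hv _ (le_max_right k k₀)) (Nat.succ_pos _)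
        (heq _ (le_max_right k k₀)), Nat.succ_eq_add_one, Nat.cast_add_one] at h1
    · gcongr
      exact le_max_left _ _
  have : (A : Set ℝ) = univ := by rw [← hA.closure_eq, hd.closure_eq]
  exact (this ▸ mem_univ t : t ∈ (A : Set ℝ))

variable {u w : SLR n} {Ω : Type} [MeasurableSpace Ω] {T : Ω → Ω} {Φ : Ω → X → X}

/-- Along a shear direction of `u` the family intertwines root subgroups with unipotent ones. -/
theorem Fam.ae_exists_isUPG (hn : 2 ≤ n) (hu : Unip u) (hu1 : u ≠ 1) (hw : Unip w)
    {ν : Measure Ω} [IsProbabilityMeasure ν] (hT : MeasurePreserving T ν ν) (h : Fam u w μ T Φ)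
    {X₀ Y : Matrix (Fin n) (Fin n) ℝ} (hX : cnj u X₀ = X₀ + Y) (huY : cnj u Y = Y) (hY : IsR1 Y) :
    ∀ᵐ ω ∂ν, ∃ P, IsUPG P ∧ ∀ t : ℝ, Intw μ (Φ ω) (toSL (1 + t • Y)) (P t) := by
  filter_upwards [h.ae_exists_unip hn hu hu1 hw hT hX huY hY] with ω ⟨k₀, hk⟩
  exact exists_isUPG_intw hn (h.mp ω) hY hk

variable {n : ℕ} {X : Type*} [TopologicalSpace X] [MeasurableSpace X] [MulAction (SLR n) X]
  [HomSpace n X] {μ : Measure X} [IsProbabilityMeasure μ] [SMulInvariantMeasure (SLR n) X μ]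
  {φ : X → X}

/-- Intertwining is compatible with conjugation of the map by a group element. -/
theorem Intw.of_conj {f c c' : SLR n} (h : Intw μ (fun x => f • φ (f⁻¹ • x)) c c') :
    Intw μ φ (f⁻¹ * c * f) (f⁻¹ * c' * f) := by
  filter_upwards [ae_smul f h] with x hx
  rw [inv_smul_smul] at hx
  rw [mul_smul, mul_smul, mul_smul, mul_smul, ← hx, inv_smul_smul]

section Lattice
variable {F'' F' : Subgroup (SLR n)}

theorem fam_of_lattice (hφ : MeasurePreserving φ μ μ)
    (hcomm : ∀ f ∈ F', Intw μ φ f f) (u : F'') :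
    Fam (u : SLR n) u μ (fun ω : F'' ⧸ F'.subgroupOf F'' => u • ω)
      fun ω x => (ω.out : SLR n) • φ ((ω.out : SLR n)⁻¹ • x) where
  mp ω := (measurePreserving_smul _ μ).comp (hφ.comp (measurePreserving_smul _ μ))
  meas_param κ A D hA hD := by
    have : SecondCountableTopology X := HomSpace.toSecondCountableTopology n
    refine QuotientGroup.measurable_from_quotient.2 ?_
    have hm : ∀ κ : SLR n, Measurable fun p : F'' × X =>
        (p.1 : SLR n) • φ ((p.1 : SLR n)⁻¹ • κ • p.2) := fun κ => by
      have h1 : Measurable fun p : F'' × X => (p.1 : SLR n) := measurable_fst.subtype_val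
      have h2 : Measurable fun p : F'' × X => φ ((p.1 : SLR n)⁻¹ • κ • p.2) :=
        hφ.measurable.comp <| measurable_smul_prod.comp <|
          ((continuous_inv (G := SLR n)).measurable.comp h1).prodMk
            ((measurable_const_smul κ).comp measurable_snd)
      exact measurable_smul_prod.comp (h1.prodMk h2)
    have hS : MeasurableSet {p : F'' × X | p.2 ∈ A ∧
        ((p.1 : SLR n) • φ ((p.1 : SLR n)⁻¹ • (1 : SLR n) • p.2),
          (p.1 : SLR n) • φ ((p.1 : SLR n)⁻¹ • κ • p.2)) ∈ D} :=
      (measurable_snd hA).inter (((hm 1).prodMk (hm κ)) hD)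
    have hS' := measurable_measure_prodMk_left (ν := μ) hS
    convert hS' using 1
    funext f
    refine measure_congr ?_
    obtain ⟨⟨f', hf'⟩, hout⟩ := QuotientGroup.mk_out_eq_mul (F'.subgroupOf F'') f
    have hF : ∀ᵐ x : X ∂μ, φ ((f' : SLR n)⁻¹ • (f : SLR n)⁻¹ • x) =
        (f' : SLR n)⁻¹ • φ ((f : SLR n)⁻¹ • x) :=
      ae_smul (f : SLR n)⁻¹ (hcomm _ (F'.inv_mem (Subgroup.mem_subgroupOf.1 hf')))
    filter_upwards [hF, ae_smul κ hF] with x h1 h2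
    refine propext (and_congr_right fun _ => ?_)
    simp only [Function.comp_apply, hout, Subgroup.coe_mul, _root_.mul_inv_rev, mul_smul, one_smul]
    rw [mem_ofPred_eq, h1, h2, smul_inv_smul, smul_inv_smul]
  equiv ω := by
    obtain ⟨⟨f', hf'⟩, hout⟩ :=
      QuotientGroup.mk_out_eq_mul (F'.subgroupOf F'') (u * ω.out)
    have he : ((u * ω.out : F'') : F'' ⧸ F'.subgroupOf F'') = u • ω := by
      conv_rhs => rw [← ω.out_eq']
      rfl
    rw [he] at hout
    filter_upwards [ae_smul (X := X) (μ := μ) (ω.out : SLR n)⁻¹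
      (hcomm _ (F'.inv_mem (Subgroup.mem_subgroupOf.1 hf')))] with x h1
    simp only [hout, Subgroup.coe_mul, _root_.mul_inv_rev, mul_smul, inv_smul_smul, h1,
      smul_inv_smul]

/-- A map commuting with a lattice of a subgroup containing a nontrivial unipotent intertwines some
root subgroup with a unipotent one-parameter subgroup. -/
theorem exists_isR1_isUPG_of_lattice (hn : 2 ≤ n) (hφ : MeasurePreserving φ μ μ)
    (hcomm : ∀ f ∈ F', Intw μ φ f f) (ν : Measure (F'' ⧸ F'.subgroupOf F''))
    [IsProbabilityMeasure ν] (hν : ∀ g : F'', Measure.map (fun x => g • x) ν = ν)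
    {u : SLR n} (hu : u ∈ F'') (hun : Unip u) (hu1 : u ≠ 1) :
    ∃ Y : Matrix (Fin n) (Fin n) ℝ, IsR1 Y ∧ ∃ P, IsUPG P ∧ ∀ t : ℝ, Intw μ φ (toSL (1 + t • Y)) (P t) := by
  obtain ⟨X₀, Y, hY, hX, huY⟩ := hun.exists_shear hu1
  have hT : MeasurePreserving (fun ω : F'' ⧸ F'.subgroupOf F'' => (⟨u, hu⟩ : F'') • ω) ν ν := by
    refine ⟨QuotientGroup.measurable_from_quotient.2 ?_, hν _⟩
    have h1 : Measurable fun f : F'' => (⟨u, hu⟩ : F'') * f :=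
      (measurable_const_mul u |>.comp measurable_subtype_coe).subtype_mk
    exact QuotientGroup.measurable_coe.comp h1
  obtain ⟨ω, P, hP, hPI⟩ := ((fam_of_lattice hφ hcomm ⟨u, hu⟩).ae_exists_isUPG hn hun hu1 hun hT hX
    huY hY).exists
  refine ⟨cnj (ω.out : SLR n)⁻¹ Y, hY.cnj _, _, hP.conj (ω.out : SLR n)⁻¹, fun t => ?_⟩
  have := (hPI t).of_conj
  have h2 := mul_toSL_mul_inv (ω.out : SLR n)⁻¹ (1 + t • Y)
  rw [inv_inv] at h2 ⊢
  rwa [h2, cnj_add, cnj_one, cnj_smul] at this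

end Lattice

/-- The root element `Y` is *good* for `φ` if its root subgroup is intertwined by `φ` with a
unipotent one-parameter subgroup. -/
def GoodR1 (μ : Measure X) (φ : X → X) (Y : Matrix (Fin n) (Fin n) ℝ) : Prop :=
  ∃ P, IsUPG P ∧ ∀ t : ℝ, Intw μ φ (toSL (1 + t • Y)) (P t)

theorem fam_unit (hφ : MeasurePreserving φ μ μ) {c c' : SLR n} (h : Intw μ φ c c') :
    Fam c c' μ (id : Unit → Unit) fun _ => φ where
  mp _ := hφ
  meas_param _ _ _ _ _ := measurable_const
  equiv _ := h

theorem IsR1.unip {Y : Matrix (Fin n) (Fin n) ℝ} (hY : IsR1 Y) : Unip (toSL (1 + (1 : ℝ) • Y)) := by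
  refine ⟨2, ?_⟩
  rw [hY.coe_toSL, one_smul, add_sub_cancel_left, pow_two, hY.mul_self]

theorem IsR1.toSL_ne_one {Y : Matrix (Fin n) (Fin n) ℝ} (hY : IsR1 Y) :
    toSL (1 + (1 : ℝ) • Y) ≠ 1 := by
  intro h
  have := hY.coe_toSL 1
  rw [h, Matrix.SpecialLinearGroup.coe_one, one_smul] at this
  obtain ⟨h0, -⟩ := hY
  exact h0 (left_eq_add.1 this)

/-- In rank at least two, one good root element makes all of them good. -/
theorem GoodR1.all (hn : 3 ≤ n) (hφ : MeasurePreserving φ μ μ) {Y Y' : Matrix (Fin n) (Fin n) ℝ}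
    (hY : IsR1 Y) (hY' : IsR1 Y') (h : GoodR1 μ φ Y) : GoodR1 μ φ Y' := by
  refine IsR1.chain hn (GoodR1 μ φ) (fun Y X₀ Y' hY hY' hYY' hY'Y hX hg => ?_) hY hY' h
  obtain ⟨P, hP, hPI⟩ := hg
  have hu : (toSL (1 + (1 : ℝ) • Y) : Matrix (Fin n) (Fin n) ℝ) = 1 + Y := by
    rw [hY.coe_toSL, one_smul]
  have hX' : cnj (toSL (1 + (1 : ℝ) • Y)) X₀ = X₀ + Y' := by
    rw [cnj_eq_iff, hu]; exact hX
  have huY : cnj (toSL (1 + (1 : ℝ) • Y)) Y' = Y' := by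
    rw [cnj_eq_iff, hu, add_mul, mul_add, hYY', hY'Y, one_mul, mul_one]
  have : ∀ᵐ ω ∂(Measure.dirac () : Measure Unit), GoodR1 μ φ Y' :=
    (fam_unit hφ (hPI 1)).ae_exists_isUPG (by omega) hY.unip hY.toSL_ne_one (hP.unip 1)
      (MeasurePreserving.id _) hX' huY hY'
  exact this.exists.choose_spec

variable {n : ℕ} {Λ : Subgroup (SLR n)} [DiscreteTopology Λ] {μ : Measure (SLR n ⧸ Λ)}
  [IsProbabilityMeasure μ] [SMulInvariantMeasure (SLR n) (SLR n ⧸ Λ) μ]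
  {φ : SLR n ⧸ Λ → SLR n ⧸ Λ}

theorem ae_haar_smul_mk {p : SLR n ⧸ Λ → Prop} (h : ∀ᵐ x ∂μ, p x) (k : SLR n) :
    ∀ᵐ g : SLR n ∂(Measure.haar : Measure (SLR n)), p ((g * k : SLR n) : SLR n ⧸ Λ) := by
  have h1 := (haar_smul_mem_eq_zero_iff (n := n) μ (k : SLR n ⧸ Λ)
    (measurableSet_toMeasurable μ {x | ¬ p x})).2 (by rw [measure_toMeasurable]; exact h)
  refine measure_mono_null (fun g hg => ?_) h1
  exact subset_toMeasurable μ {x | ¬ p x} hg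

/-- A map intertwining translations through an automorphism `A` is given almost everywhere by
`gΛ ↦ A g m Λ`. -/
theorem exists_ae_haar_eq (hφ : Measurable φ) {A : SLR n ≃* SLR n} (hA : Continuous A)
    (hI : ∀ g, Intw μ φ g (A g)) : ∃ m : SLR n, ∀ᵐ g : SLR n ∂(Measure.haar : Measure (SLR n)),
      φ (g : SLR n ⧸ Λ) = ((A g * m : SLR n) : SLR n ⧸ Λ) := by
  have : BorelSpace (SLR n ⧸ Λ) := HomSpace.toBorelSpace n
  have : SecondCountableTopology (SLR n ⧸ Λ) := HomSpace.toSecondCountableTopology n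
  have : T2Space (SLR n ⧸ Λ) := HomSpace.toT2Space n
  have hm : MeasurableSet {p : SLR n × (SLR n ⧸ Λ) | φ (p.1 • p.2) = A p.1 • φ p.2} := by
    refine measurableSet_eq_fun (hφ.comp measurable_smul_prod) ?_
    exact measurable_smul_prod.comp
      ((hA.measurable.comp measurable_fst).prodMk (hφ.comp measurable_snd))
  have h1 : ∀ᵐ p ∂((Measure.haar : Measure (SLR n)).prod μ), φ (p.1 • p.2) = A p.1 • φ p.2 :=
    (Measure.ae_prod_iff_ae_ae hm).2 (Eventually.of_forall fun g => hI g)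
  have h2 : ∀ᵐ x ∂μ, ∀ᵐ g : SLR n ∂(Measure.haar : Measure (SLR n)), φ (g • x) = A g • φ x := by
    have := (Measure.measurePreserving_swap (μ := μ)
      (ν := (Measure.haar : Measure (SLR n)))).quasiMeasurePreserving.ae h1
    exact Measure.ae_ae_of_ae_prod this
  obtain ⟨x, hx⟩ := h2.exists
  induction x using QuotientGroup.induction_on with | H k
  obtain ⟨m, hm⟩ := QuotientGroup.mk_surjective (φ (k : SLR n ⧸ Λ))
  refine ⟨A k⁻¹ * m, ?_⟩
  rw [ae_iff] at hx ⊢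
  rw [← measure_mul_right_null _ k]
  convert hx using 2
  ext g
  rw [mem_preimage, mem_ofPred_eq, mem_ofPred_eq, ← hm, map_mul, mul_assoc, ← mul_assoc (A k),
    ← map_mul A k, mul_inv_cancel, map_one, one_mul]
  rfl

theorem exists_affine_of_intw (hφ : Measurable φ)
    (hinj : ∃ s : Set (SLR n ⧸ Λ), μ sᶜ = 0 ∧ Set.InjOn φ s) {F' : Subgroup (SLR n)}
    (hcomm : ∀ f ∈ F', ∀ᵐ x ∂μ, φ (f • x) = f • φ x) {A : SLR n ≃* SLR n} (hA : Continuous A)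
    (hI : ∀ g, Intw μ φ g (A g)) :
    ∃ (A : SLR n ≃* SLR n) (h : SLR n), Continuous A ∧ Λ.map A.toMonoidHom = Λ ∧
      ∃ ψ : SLR n ⧸ Λ → SLR n ⧸ Λ,
        (∀ g : SLR n, ψ (QuotientGroup.mk g) = QuotientGroup.mk (h * A g)) ∧
        (∀ᵐ x ∂μ, φ x = ψ x) ∧
        (∀ f ∈ F', ∀ x, ψ (f • x) = f • ψ x) := by
  have : BorelSpace (SLR n ⧸ Λ) := HomSpace.toBorelSpace n
  have : SecondCountableTopology (SLR n ⧸ Λ) := HomSpace.toSecondCountableTopology n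
  have : T2Space (SLR n ⧸ Λ) := HomSpace.toT2Space n
  obtain ⟨m, hm⟩ := exists_ae_haar_eq hφ hA hI
  let B : SLR n ≃* SLR n := A.trans (MulAut.conj m⁻¹)
  have hB : ∀ g, m * B g = A g * m := fun g => by simp [B, mul_assoc]
  have hBc : Continuous B := by
    have : (B : SLR n → SLR n) = fun g => m⁻¹ * A g * m := by ext1 g; simp [B]
    rw [this]; fun_prop
  have hm' : ∀ᵐ g : SLR n ∂(Measure.haar : Measure (SLR n)),
      φ (g : SLR n ⧸ Λ) = ((m * B g : SLR n) : SLR n ⧸ Λ) := by simpa only [hB] using hm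
  have hmr : ∀ k, ∀ᵐ g : SLR n ∂(Measure.haar : Measure (SLR n)),
      φ ((g * k : SLR n) : SLR n ⧸ Λ) = ((m * B g * B k : SLR n) : SLR n ⧸ Λ) := fun k => by
    rw [ae_iff, ← measure_mul_right_null _ k] at hm'
    rw [ae_iff]
    convert hm' using 2
    ext g
    simp [mul_assoc]
  have hΛ : ∀ l, l ∈ Λ ↔ B l ∈ Λ := by
    intro l
    obtain ⟨s, hs, hsinj⟩ := hinj
    have hs' : ∀ᵐ x ∂μ, x ∈ s := hs
    constructor
    · intro hl
      obtain ⟨g, h1, h2⟩ := (hm'.and (hmr l)).exists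
      rw [QuotientGroup.mk_mul_of_mem _ hl, h1] at h2
      have := QuotientGroup.eq.1 h2
      have e : (m * B g)⁻¹ * (m * B g * B l) = B l := inv_mul_cancel_left _ _
      rwa [e] at this
    · intro hl
      obtain ⟨g, ⟨h1, h2⟩, h3, h4⟩ := ((hm'.and (hmr l)).and
        ((ae_haar_smul_mk hs' 1).and (ae_haar_smul_mk hs' l))).exists
      rw [QuotientGroup.mk_mul_of_mem _ hl, ← h1] at h2
      rw [mul_one] at h3
      have := QuotientGroup.eq.1 (hsinj h4 h3 h2)
      simpa using this
  let ψ : SLR n ⧸ Λ → SLR n ⧸ Λ := fun x => ((m * B x.out : SLR n) : SLR n ⧸ Λ)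
  have hψ : ∀ g : SLR n, ψ g = ((m * B g : SLR n) : SLR n ⧸ Λ) := by
    intro g
    obtain ⟨⟨l, hl⟩, h⟩ := QuotientGroup.mk_out_eq_mul Λ g
    simp only [ψ, h, map_mul, ← mul_assoc]
    exact QuotientGroup.mk_mul_of_mem _ ((hΛ l).1 hl)
  refine ⟨B, m, hBc, ?_, ψ, hψ, ?_, ?_⟩
  · ext x
    rw [Subgroup.mem_map]
    constructor
    · rintro ⟨l, hl, rfl⟩
      exact (hΛ l).1 hl
    · intro hx
      exact ⟨B.symm x, (hΛ _).2 (by simpa using hx), by simp⟩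
  · have hψm : Measurable ψ := by
      refine QuotientGroup.measurable_from_quotient.2 ?_
      have : ψ ∘ (QuotientGroup.mk : SLR n → SLR n ⧸ Λ) = fun g => ((m * B g : SLR n) : SLR n ⧸ Λ) :=
        funext hψ
      rw [this]
      exact QuotientGroup.measurable_coe.comp (by fun_prop : Continuous fun g => m * B g).measurable
    have hS : MeasurableSet {x | ¬ φ x = ψ x} := (measurableSet_eq_fun hφ hψm).compl
    refine (haar_smul_mem_eq_zero_iff (n := n) μ ((1 : SLR n) : SLR n ⧸ Λ) hS).1 ?_
    rw [ae_iff] at hm'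
    convert hm' using 2
    ext g
    have : g • ((1 : SLR n) : SLR n ⧸ Λ) = g := by
      show ((g * 1 : SLR n) : SLR n ⧸ Λ) = g
      rw [mul_one]
    rw [mem_ofPred_eq, mem_ofPred_eq, mem_ofPred_eq, this, hψ]
  · intro f hf
    have h0 : ∀ᵐ g : SLR n ∂(Measure.haar : Measure (SLR n)),
        φ ((f * g : SLR n) : SLR n ⧸ Λ) = f • φ (g : SLR n ⧸ Λ) := by
      have h3 := ae_haar_smul_mk (hcomm f hf) 1
      simp only [mul_one] at h3
      exact h3
    have h1 : (fun g : SLR n => ((m * B (f * g) : SLR n) : SLR n ⧸ Λ)) =ᵐ[Measure.haar]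
        fun g : SLR n => ((f * (m * B g) : SLR n) : SLR n ⧸ Λ) := by
      have h2 : ∀ᵐ g : SLR n ∂(Measure.haar : Measure (SLR n)),
          φ ((f * g : SLR n) : SLR n ⧸ Λ) = ((m * B (f * g) : SLR n) : SLR n ⧸ Λ) := by
        rw [ae_iff, ← measure_preimage_mul _ f] at hm'
        exact hm'
      filter_upwards [h0, hm', h2] with g h0 h1 h2
      rw [← h2, h0, h1]
      rfl
    have h2 := (Continuous.ae_eq_iff_eq _
      (QuotientGroup.continuous_mk.comp (by fun_prop : Continuous fun g => m * B (f * g)))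
      (QuotientGroup.continuous_mk.comp (by fun_prop : Continuous fun g => f * (m * B g)))).1 h1
    intro x
    induction x using QuotientGroup.induction_on with | H g
    rw [hψ]
    exact (hψ (f * g)).trans (congrFun h2 g)

theorem polishSpace_of_compactSpace {K : Type*} [TopologicalSpace K] [T2Space K] [CompactSpace K]
    [SecondCountableTopology K] : PolishSpace K := by
  let := TopologicalSpace.metrizableSpaceMetric K
  infer_instance

/-- The Lusin–Souslin theorem on a locally compact second countable space. -/
theorem measurableEmbedding_of_injOn {X Y : Type*} [TopologicalSpace X] [T2Space X]
    [SecondCountableTopology X] [LocallyCompactSpace X] [MeasurableSpace X] [BorelSpace X]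
    [MeasurableSpace Y] [MeasurableSpace.CountablySeparated Y] {φ : X → Y} (hφ : Measurable φ)
    {s : Set X} (hs : MeasurableSet s) (hinj : InjOn φ s) :
    MeasurableEmbedding (fun x : s => φ x) where
  injective x y h := Subtype.ext (hinj x.2 y.2 h)
  measurable := hφ.comp measurable_subtype_coe
  measurableSet_image' := by
    intro B hB
    let K := compactCovering X
    have hK : ∀ i, MeasurableSet ((fun x : K i => φ x) '' ((↑) ⁻¹' (((↑) : s → X) '' B))) := by
      intro i
      have : CompactSpace (K i) := isCompact_iff_compactSpace.1 (isCompact_compactCovering X i)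
      have : PolishSpace (K i) := polishSpace_of_compactSpace
      have hBm : MeasurableSet ((((↑) : s → X) '' B)) := hs.subtype_image hB
      have hBm' : MeasurableSet ((((↑) : K i → X) ⁻¹' (((↑) : s → X) '' B))) :=
        measurable_subtype_coe hBm
      refine hBm'.image_of_measurable_injOn (hφ.comp measurable_subtype_coe) ?_
      rintro x ⟨a, ha, hax⟩ y ⟨b, hb, hby⟩ hxy
      refine Subtype.ext (hinj ?_ ?_ hxy)
      · rw [← hax]; exact a.2
      · rw [← hby]; exact b.2
    have : (fun x : s => φ x) '' B =
        ⋃ i, (fun x : K i => φ x) '' ((↑) ⁻¹' (((↑) : s → X) '' B)) := by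
      ext y
      simp only [mem_iUnion, mem_image, mem_preimage]
      constructor
      · rintro ⟨x, hx, rfl⟩
        obtain ⟨i, hi⟩ := mem_iUnion.1 (iUnion_compactCovering X ▸ mem_univ (x : X))
        exact ⟨i, ⟨x, hi⟩, ⟨x, hx, rfl⟩, rfl⟩
      · rintro ⟨i, x, ⟨a, ha, hax⟩, rfl⟩
        exact ⟨a, ha, by rw [hax]⟩
    rw [this]
    exact MeasurableSet.iUnion hK

variable {n : ℕ} {X : Type*} [TopologicalSpace X] [MeasurableSpace X] [MulAction (SLR n) X]
  [HomSpace n X] {μ : Measure X} [IsProbabilityMeasure μ] [SMulInvariantMeasure (SLR n) X μ]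
  {φ ψ : X → X}

theorem exists_measurable_inverse (n : ℕ) {X : Type*} [TopologicalSpace X] [MeasurableSpace X]
    [MulAction (SLR n) X] [HomSpace n X] {μ : Measure X} [IsProbabilityMeasure μ] {φ : X → X}
    (hφ : MeasurePreserving φ μ μ)
    (hinj : ∃ s : Set X, μ sᶜ = 0 ∧ Set.InjOn φ s) :
    ∃ ψ : X → X, MeasurePreserving ψ μ μ ∧ (∀ᵐ x ∂μ, ψ (φ x) = x) ∧ ∀ᵐ x ∂μ, φ (ψ x) = x := by
  have : BorelSpace X := HomSpace.toBorelSpace n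
  have : SecondCountableTopology X := HomSpace.toSecondCountableTopology n
  have : T2Space X := HomSpace.toT2Space n
  have : LocallyCompactSpace X := HomSpace.toLocallyCompactSpace n
  obtain ⟨s, hs, hinj⟩ := hinj
  set t := (toMeasurable μ sᶜ)ᶜ
  have ht : MeasurableSet t := (measurableSet_toMeasurable _ _).compl
  have hts : t ⊆ s := compl_subset_comm.1 (subset_toMeasurable μ sᶜ)
  have hμt : ∀ᵐ x ∂μ, x ∈ t := by
    show μ tᶜ = 0
    rw [compl_compl, measure_toMeasurable, hs]
  have he := measurableEmbedding_of_injOn hφ.measurable ht (hinj.mono hts)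
  have : Nonempty X := nonempty_of_isProbabilityMeasure μ
  obtain ⟨ψ, hψ, hψφ⟩ := he.exists_measurable_extend measurable_subtype_coe fun _ => this
  have h1 : ∀ᵐ x ∂μ, ψ (φ x) = x := by
    filter_upwards [hμt] with x hx
    exact congrFun hψφ ⟨x, hx⟩
  refine ⟨ψ, ⟨hψ, ?_⟩, h1, ?_⟩
  · conv_lhs => rw [← hφ.map_eq]
    rw [Measure.map_map hψ hφ.measurable]
    exact (Measure.map_congr h1).trans Measure.map_id
  · have h2 : MeasurableSet {x | φ (ψ x) = x} :=
      measurableSet_eq_fun (hφ.measurable.comp hψ) measurable_id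
    rw [← hφ.map_eq, ae_map_iff hφ.aemeasurable h2]
    filter_upwards [h1] with x hx
    rw [hx]

theorem Intw.symm (hψ : MeasurePreserving ψ μ μ) (h1 : ∀ᵐ x ∂μ, ψ (φ x) = x)
    (h2 : ∀ᵐ x ∂μ, φ (ψ x) = x) {g g' : SLR n} (h : Intw μ φ g g') : Intw μ ψ g' g := by
  filter_upwards [h2, hψ.quasiMeasurePreserving.ae h,
    hψ.quasiMeasurePreserving.ae (ae_smul g h1)] with y hy1 hy2 hy3
  rw [hy1] at hy2
  rw [← hy2, hy3]

theorem exists_dotProduct_ne_zero_two {n : ℕ} {α α' : Fin n → ℝ} (h : α ≠ 0) (h' : α' ≠ 0) :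
    ∃ δ : Fin n → ℝ, δ ⬝ᵥ α ≠ 0 ∧ δ ⬝ᵥ α' ≠ 0 := by
  have h1 : α ⬝ᵥ α ≠ 0 := fun h' => h (dotProduct_self_eq_zero.1 h')
  have h2 : α' ⬝ᵥ α' ≠ 0 := fun h => h' (dotProduct_self_eq_zero.1 h)
  by_cases h3 : α ⬝ᵥ α' = 0
  · refine ⟨α + α', ?_, ?_⟩
    · rwa [add_dotProduct, dotProduct_comm α' α, h3, add_zero]
    · rwa [add_dotProduct, h3, zero_add]
  · exact ⟨α, h1, h3⟩

section Transitive
variable {n : ℕ} {Q : Matrix (Fin n) (Fin n) ℝ → Prop}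

theorem vecMulVec_induction_left (hs : ∀ (c : ℝ) Y, c ≠ 0 → IsR1 Y → Q Y → Q (c • Y))
    (hc : ∀ g Y, IsR1 Y → Q Y → Q (cnj g Y)) {α α' β : Fin n → ℝ} (hα : α ≠ 0) (hα' : α' ≠ 0)
    (hβ : β ≠ 0) (h : β ⬝ᵥ α = 0) (h' : β ⬝ᵥ α' = 0) (hQ : Q (vecMulVec α β)) :
    Q (vecMulVec α' β) := by
  obtain ⟨δ, h1, h2⟩ := exists_dotProduct_ne_zero_two hα hα'
  set c := (δ ⬝ᵥ α) / (δ ⬝ᵥ α')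
  have hc0 : c ≠ 0 := div_ne_zero h1 h2
  have hδ : (δ ⬝ᵥ (c • α' - α)) = 0 := by
    rw [dotProduct_sub, dotProduct_smul, smul_eq_mul, div_mul_cancel₀ _ h2, sub_self]
  set δ' := (δ ⬝ᵥ α)⁻¹ • δ
  have hδ' : δ' ⬝ᵥ α = 1 := by rw [smul_dotProduct, smul_eq_mul, inv_mul_cancel₀ h1]
  have hd : (1 + vecMulVec (c • α' - α) δ').det = 1 := by
    rw [det_one_add_vecMulVec, smul_dotProduct, hδ, smul_zero, add_zero]
  have key : cnj (SLR.of _ hd) (vecMulVec α β) = vecMulVec (c • α') β := by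
    rw [cnj_eq_iff, SLR.coe_of, add_mul, mul_add, one_mul, mul_one, vecMulVec_mul_vecMulVec,
      vecMulVec_mul_vecMulVec, hδ', one_smul, dotProduct_sub, dotProduct_smul, h', h,
      smul_zero, sub_zero, zero_smul, vecMulVec_zero, add_zero, ← add_vecMulVec,
      add_sub_cancel]
  have hQ1 := hc (SLR.of _ hd) _ (isR1_vecMulVec hα hβ h) hQ
  have hR := (isR1_vecMulVec hα hβ h).cnj (SLR.of _ hd)
  rw [key] at hQ1 hR
  have := hs c⁻¹ _ (inv_ne_zero hc0) hR hQ1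
  rwa [smul_vecMulVec, inv_smul_smul₀ hc0] at this

theorem vecMulVec_induction_right (hs : ∀ (c : ℝ) Y, c ≠ 0 → IsR1 Y → Q Y → Q (c • Y))
    (hc : ∀ g Y, IsR1 Y → Q Y → Q (cnj g Y)) {α β β' : Fin n → ℝ} (hα : α ≠ 0) (hβ : β ≠ 0)
    (hβ' : β' ≠ 0) (h : β ⬝ᵥ α = 0) (h' : β' ⬝ᵥ α = 0) (hQ : Q (vecMulVec α β)) :
    Q (vecMulVec α β') := by
  obtain ⟨δ, h1, h2⟩ := exists_dotProduct_ne_zero_two hβ hβ'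
  rw [dotProduct_comm] at h1 h2
  set c := (β ⬝ᵥ δ) / (β' ⬝ᵥ δ)
  have hc0 : c ≠ 0 := div_ne_zero h1 h2
  have hδ : ((β - c • β') ⬝ᵥ δ) = 0 := by
    rw [sub_dotProduct, smul_dotProduct, smul_eq_mul, div_mul_cancel₀ _ h2, sub_self]
  set δ' := (β ⬝ᵥ δ)⁻¹ • δ
  have hδ' : β ⬝ᵥ δ' = 1 := by rw [dotProduct_smul, smul_eq_mul, inv_mul_cancel₀ h1]
  have hδ2 : β' ⬝ᵥ δ' = c⁻¹ := by
    rw [dotProduct_smul, smul_eq_mul, inv_div, div_eq_mul_inv, mul_comm]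
  have hd : (1 + vecMulVec δ' (β - c • β')).det = 1 := by
    rw [det_one_add_vecMulVec, dotProduct_smul, hδ, smul_zero, add_zero]
  have key : cnj (SLR.of _ hd) (vecMulVec α β) = vecMulVec α (c • β') := by
    rw [cnj_eq_iff, SLR.coe_of, add_mul, mul_add, one_mul, mul_one, vecMulVec_mul_vecMulVec,
      vecMulVec_mul_vecMulVec, smul_dotProduct, hδ2, smul_eq_mul, mul_inv_cancel₀ hc0, one_smul,
      sub_dotProduct, smul_dotProduct, h', h, smul_zero, sub_zero, zero_smul, vecMulVec_zero,
      add_zero, ← vecMulVec_add, add_sub_cancel]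
  have hQ1 := hc (SLR.of _ hd) _ (isR1_vecMulVec hα hβ h) hQ
  have hR := (isR1_vecMulVec hα hβ h).cnj (SLR.of _ hd)
  rw [key] at hQ1 hR
  have := hs c⁻¹ _ (inv_ne_zero hc0) hR hQ1
  rwa [vecMulVec_smul, inv_smul_smul₀ hc0] at this

/-- For `3 ≤ n` the group `SL(n,ℝ)` acts transitively on root elements up to scalars. -/
theorem IsR1.induction_conj (hn : 3 ≤ n)
    (hs : ∀ (c : ℝ) Y, c ≠ 0 → IsR1 Y → Q Y → Q (c • Y))
    (hc : ∀ g Y, IsR1 Y → Q Y → Q (_root_.cnj g Y)) {Y Y' : Matrix (Fin n) (Fin n) ℝ}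
    (hY : IsR1 Y) (hY' : IsR1 Y') (hQ : Q Y) : Q Y' := by
  obtain ⟨h0, α, β, h, rfl⟩ := hY
  obtain ⟨h0', α', β', h', rfl⟩ := hY'
  rw [Ne, vecMulVec_eq_zero, not_or] at h0 h0'
  obtain ⟨γ, hγ, hγ1, hγ2⟩ := exists_dotProduct_eq_zero_two hn β β'
  rw [dotProduct_comm] at hγ1 hγ2
  exact vecMulVec_induction_left hs hc hγ h0'.1 h0'.2 hγ2 h' <|
    vecMulVec_induction_right hs hc hγ h0.2 h0'.2 hγ1 hγ2 <|
    vecMulVec_induction_left hs hc h0.1 hγ h0.2 h hγ1 hQ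

end Transitive

section Closed
variable {n : ℕ}

theorem isR1_or_eq_zero_iff {M : Matrix (Fin n) (Fin n) ℝ} :
    (M = 0 ∨ IsR1 M) ↔ (∀ i j k l, M i j * M k l = M i l * M k j) ∧ M.trace = 0 := by
  constructor
  · rintro (rfl | ⟨-, α, β, h, rfl⟩)
    · simp
    · refine ⟨fun i j k l => ?_, ?_⟩
      · simp only [vecMulVec_apply]; ring
      · rw [trace_vecMulVec, dotProduct_comm, h]
  · rintro ⟨h1, h2⟩
    refine or_iff_not_imp_left.2 fun h0 => ?_
    obtain ⟨p, q, hpq⟩ : ∃ p q, M p q ≠ 0 := by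
      by_contra! hc
      exact h0 (Matrix.ext hc)
    have hM : M = vecMulVec (fun i => M i q) fun j => (M p q)⁻¹ * M p j := by
      ext i j
      have := h1 i j p q
      rw [vecMulVec_apply]
      field_simp
      linarith
    refine ⟨h0, _, _, ?_, hM⟩
    rw [hM, trace_vecMulVec, dotProduct_comm] at h2
    exact h2

theorem isClosed_isR1_or_zero :
    IsClosed {M : Matrix (Fin n) (Fin n) ℝ | M = 0 ∨ IsR1 M} := by
  simp only [isR1_or_eq_zero_iff, ofPred_and, ofPred_forall]
  refine IsClosed.inter ?_ (isClosed_eq (by fun_prop) continuous_const)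
  refine isClosed_iInter fun i => isClosed_iInter fun j => isClosed_iInter fun k =>
    isClosed_iInter fun l => isClosed_eq ?_ ?_
  · exact (continuous_id.matrix_elem i j).mul (continuous_id.matrix_elem k l)
  · exact (continuous_id.matrix_elem i l).mul (continuous_id.matrix_elem k j)

theorem exists_isR1_mul_mul (hn : 2 ≤ n) {W : Matrix (Fin n) (Fin n) ℝ} (hW : W ≠ 0)
    (htr : W.trace = 0) : ∃ (X : Matrix (Fin n) (Fin n) ℝ) (c : ℝ), IsR1 X ∧ c ≠ 0 ∧
      X * W * X = c • X := by
  suffices h : ∃ α β : Fin n → ℝ, α ≠ 0 ∧ β ≠ 0 ∧ β ⬝ᵥ α = 0 ∧ β ⬝ᵥ W *ᵥ α ≠ 0 by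
    obtain ⟨α, β, hα, hβ, h, hc⟩ := h
    refine ⟨vecMulVec α β, _, isR1_vecMulVec hα hβ h, hc, ?_⟩
    rw [vecMulVec_mul, vecMulVec_mul_vecMulVec, vecMulVec_smul, dotProduct_mulVec]
  by_cases h : ∃ i j, i ≠ j ∧ W i j ≠ 0
  · obtain ⟨i, j, hij, hW⟩ := h
    refine ⟨Pi.single j 1, Pi.single i 1, by simp, by simp, by simp [hij.symm, hij], ?_⟩
    simpa using hW
  · push Not at h
    obtain ⟨i, j, hij⟩ : ∃ i j, W i i ≠ W j j := by
      by_contra! hc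
      have : NeZero n := ⟨by omega⟩
      have h0 : W 0 0 = 0 := by
        have : W.trace = n * W 0 0 := by
          rw [Matrix.trace, Finset.sum_congr rfl fun i _ => show W.diag i = W 0 0 from hc i 0]
          simp
        rw [htr] at this
        have hn : (n : ℝ) ≠ 0 := by positivity
        simpa [hn] using this.symm
      refine hW (Matrix.ext fun i j => ?_)
      by_cases hij : i = j
      · rw [hij, hc j 0, h0]; rfl
      · rw [h i j hij]; rfl
    have hne : i ≠ j := fun h => hij (by rw [h])
    refine ⟨Pi.single i 1 + Pi.single j 1, Pi.single i 1 - Pi.single j 1, fun h => ?_, fun h => ?_,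
      ?_, ?_⟩
    · simpa [hne] using congrFun h i
    · simpa [hne] using congrFun h i
    · simp [sub_dotProduct, dotProduct_add, hne, hne.symm]
    · have : W i i + -W j j ≠ 0 := fun h => hij (by linarith)
      simpa [sub_dotProduct, mulVec_add, dotProduct_add, h i j hne, h j i hne.symm] using this

end Closed

section Algebra
variable {n : ℕ} {P : ℝ → SLR n} {Y : Matrix (Fin n) (Fin n) ℝ}

/-- A nontrivial polynomial one-parameter subgroup has nonzero traceless derivative at `0`. -/
theorem IsUPG.exists_deriv (hP : IsUPG P) (h1 : P 1 ≠ 1) :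
    ∃ W : Matrix (Fin n) (Fin n) ℝ, W ≠ 0 ∧ W.trace = 0 ∧
      Tendsto (fun t : ℝ => t⁻¹ • ((P t : Matrix (Fin n) (Fin n) ℝ) - 1)) (𝓝[≠] 0) (𝓝 W) := by
  choose p hp' using hP.poly
  have hp : ∀ a b t, (P t : Matrix (Fin n) (Fin n) ℝ) a b = (p a b).eval t := hp'
  have h0 : (P 0 : Matrix (Fin n) (Fin n) ℝ) = 1 := by
    rw [hP.zero, Matrix.SpecialLinearGroup.coe_one]
  have hlim : Tendsto (fun t : ℝ => t⁻¹ • ((P t : Matrix (Fin n) (Fin n) ℝ) - 1)) (𝓝[≠] 0)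
      (𝓝 (Matrix.of fun i j => (p i j).derivative.eval 0)) := by
    refine tendsto_pi_nhds.2 fun i => tendsto_pi_nhds.2 fun j => ?_
    have := hasDerivAt_iff_tendsto_slope_zero.1 ((p i j).hasDerivAt 0)
    refine this.congr fun t => ?_
    rw [zero_add, ← hp i j, ← hp i j, h0]
    rfl
  refine ⟨_, fun hW => h1 ?_, ?_, hlim⟩
  · have hd : ∀ t i j, (p i j).derivative.eval t = 0 := by
      intro t i j
      have h2 : HasDerivAt (fun s => ∑ k, (p i k).eval t * (p k j).eval s)
          (∑ k, (p i k).eval t * (p k j).derivative.eval 0) 0 :=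
        HasDerivAt.fun_sum fun k _ => ((p k j).hasDerivAt 0).const_mul _
      have h3 : (fun s => ∑ k, (p i k).eval t * (p k j).eval s) = fun s => (p i j).eval (t + s) := by
        funext s
        rw [← hp i j, hP.add, Matrix.SpecialLinearGroup.coe_mul, Matrix.mul_apply]
        simp only [hp]
      have h4 : ∑ k, (p i k).eval t * (p k j).derivative.eval 0 = 0 :=
        Finset.sum_eq_zero fun k _ => by
          rw [show (p k j).derivative.eval 0 = 0 from congrFun (congrFun hW k) j, mul_zero]
      rw [h3, h4] at h2
      have h5 : HasDerivAt (fun s => (p i j).eval (t + s)) ((p i j).derivative.eval (t + 0)) 0 :=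
        ((p i j).hasDerivAt (t + 0)).comp_const_add t 0
      rw [add_zero] at h5
      exact h5.unique h2
    refine SL_ext ?_
    rw [Matrix.SpecialLinearGroup.coe_one, ← h0]
    ext i j
    rw [hp i j, hp i j]
    exact is_const_of_deriv_eq_zero (p i j).differentiable
      (fun t => by rw [(p i j).deriv, hd]) 1 0
  · have h2 := (Continuous.matrix_trace (continuous_id (X := Matrix (Fin n) (Fin n) ℝ))).tendsto
      (Matrix.of fun i j => (p i j).derivative.eval 0) |>.comp hlim
    refine tendsto_nhds_unique h2 ?_
    refine tendsto_const_nhds.congr fun t => ?_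
    rw [Function.comp_apply, id, trace_smul, trace_sub, (hP.unip t).trace_eq, trace_one,
      Fintype.card_fin, sub_self, smul_zero]

theorem mul_toSL_one_add_mul_inv (g : SLR n) (Y : Matrix (Fin n) (Fin n) ℝ) (t : ℝ) :
    g * toSL (1 + t • Y) * g⁻¹ = toSL (1 + t • cnj g Y) := by
  rw [mul_toSL_mul_inv, cnj_add, cnj_smul, cnj_one]

theorem IsR1.isUPG (hY : IsR1 Y) : IsUPG fun t => toSL (1 + t • Y) where
  add := hY.toSL_add
  poly a b := by
    refine ⟨Polynomial.C ((1 : Matrix (Fin n) (Fin n) ℝ) a b) + Polynomial.C (Y a b) *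
      Polynomial.X, fun t => ?_⟩
    simp only [hY.coe_toSL, Matrix.add_apply, Matrix.smul_apply, smul_eq_mul, Polynomial.eval_add,
      Polynomial.eval_mul, Polynomial.eval_C, Polynomial.eval_X]
    ring

theorem one_add_mul_one_sub {X M : Matrix (Fin n) (Fin n) ℝ} (hX : X * X = 0) {s : ℝ} (hs : s ≠ 0) :
    (1 + s⁻¹ • X) * M * (1 + (-s⁻¹) • X) =
      1 + (s • 1 + X) * ((s ^ 2)⁻¹ • (M - 1)) * (s • 1 - X) := by
  obtain ⟨V, rfl⟩ : ∃ V, M = 1 + s ^ 2 • V :=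
    ⟨(s ^ 2)⁻¹ • (M - 1), by rw [smul_inv_smul₀ (pow_ne_zero 2 hs), add_sub_cancel]⟩
  rw [add_sub_cancel_left, inv_smul_smul₀ (pow_ne_zero 2 hs)]
  have h1 : (1 + s⁻¹ • X) * (1 + (-s⁻¹) • X) = 1 := by
    simp [mul_add, add_mul, hX]
  have h2 : s • (1 + s⁻¹ • X) = s • 1 + X := by rw [smul_add, smul_inv_smul₀ hs]
  have h3 : s • (1 + (-s⁻¹) • X) = s • 1 - X := by
    rw [smul_add, neg_smul, smul_neg, smul_inv_smul₀ hs, sub_eq_add_neg]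
  rw [mul_add _ (1 : Matrix (Fin n) (Fin n) ℝ) (s ^ 2 • V), mul_one,
    add_mul _ _ (1 + (-s⁻¹) • X), h1, ← h2, ← h3]
  simp only [smul_mul_assoc, mul_smul_comm, pow_two, mul_smul]

end Algebra

variable {n : ℕ} {X : Type*} [TopologicalSpace X] [MeasurableSpace X] [MulAction (SLR n) X]
  [HomSpace n X] {μ : Measure X} [IsProbabilityMeasure μ] [SMulInvariantMeasure (SLR n) X μ]
  {φ ψ : X → X}

theorem Intw.eq_of_unip (hn : 2 ≤ n) (hφ : MeasurePreserving φ μ μ) {g v v' : SLR n}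
    (h : Intw μ φ g v) (h' : Intw μ φ g v') (hv : Unip v) (hv' : Unip v') : v = v' := by
  have hz : IsPM (v * v'⁻¹) := Intw.isPM_of_one hn hφ (by simpa using h.mul h'.inv)
  have h1 := Unip.eq_of_isPM_mul hn hz hv' (by rwa [inv_mul_cancel_right])
  exact mul_inv_eq_one.1 h1

theorem exists_intw_of_forall_goodR1 (hn : 2 ≤ n)
    (hg : ∀ Y : Matrix (Fin n) (Fin n) ℝ, IsR1 Y → GoodR1 μ φ Y) (g : SLR n) :
    ∃ g', Intw μ φ g g' := by
  let S : Subgroup (SLR n) :=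
    { carrier := {g | ∃ g', Intw μ φ g g'}
      mul_mem' := fun ⟨a', ha⟩ ⟨b', hb⟩ => ⟨a' * b', ha.mul hb⟩
      one_mem' := ⟨1, Intw.one⟩
      inv_mem' := fun ⟨a', ha⟩ => ⟨a'⁻¹, ha.inv⟩ }
  have hS : S = ⊤ := SLR.eq_top_of_transvection_mem hn S fun i j hij a => by
    obtain ⟨P, -, hP⟩ := hg _ (isR1_single hij (one_ne_zero (α := ℝ)))
    refine ⟨P a, ?_⟩
    have := hP a
    rwa [smul_single, smul_eq_mul, mul_one, toSL_one_add_single hij] at this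
  have : g ∈ S := by rw [hS]; exact Subgroup.mem_top g
  exact this


/-- If `b` is the limit of `b_k` and `a_k` are partners of `b_k`, with `a_k - 1` of rank one, then
every partner of `b` is, up to sign, of the form `1 + Y`. -/
theorem Intw.isR1_or_of_tendsto (hn : 2 ≤ n) (hφ : MeasurePreserving φ μ μ) {a b : ℕ → SLR n}
    {a' b' : SLR n} (hab : ∀ k, Intw μ φ (b k) (a k)) (h : Intw μ φ b' a')
    (hb : Tendsto b atTop (𝓝 b'))
    (ha : ∀ k, IsR1 ((a k : Matrix (Fin n) (Fin n) ℝ) - 1)) :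
    ∃ Y : Matrix (Fin n) (Fin n) ℝ, (Y = 0 ∨ IsR1 Y) ∧
      (a' * a' : SLR n) = (1 + (2 : ℝ) • Y : Matrix (Fin n) (Fin n) ℝ) := by
  have h1 : ∀ m : ℕ, ∃ k z, IsPM z ∧ z * (a k * a'⁻¹) ∈ bal n (1 / ((m : ℝ) + 1)) := by
    intro m
    obtain ⟨ρ, hρ, hρc⟩ := Intw.exists_isPM hn hφ (η := 1 / ((m : ℝ) + 1)) (by positivity)
    have hlim : Tendsto (fun k => b k * b'⁻¹) atTop (𝓝 1) := by
      simpa using hb.mul_const b'⁻¹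
    obtain ⟨k, hk⟩ := (hlim.eventually_mem (bal_mem_nhds n hρ)).exists
    exact ⟨k, hρc _ _ hk ((hab k).mul h.inv)⟩
  choose k z hz hzc using h1
  have hlim : Tendsto (fun m => z m * (a (k m) * a'⁻¹)) atTop (𝓝 1) := by
    refine hasBasis_nhds_one_bal.tendsto_right_iff.2 fun r hr => ?_
    filter_upwards [(tendsto_one_div_add_atTop_nhds_zero_nat (𝕜 := ℝ)).eventually_le_const hr]
      with m hm
    exact bal_mono hm (hzc m)
  have hlim2 : Tendsto (fun m => z m * a (k m)) atTop (𝓝 a') := by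
    simpa [mul_assoc] using hlim.mul_const a'
  have hlim3 := ((SLR.continuous_val n).tendsto a').comp hlim2
  have hcl : IsClosed {M : Matrix (Fin n) (Fin n) ℝ |
      (M - 1 = 0 ∨ IsR1 (M - 1)) ∨ (-M - 1 = 0 ∨ IsR1 (-M - 1))} :=
    (isClosed_isR1_or_zero.preimage (by fun_prop)).union
      (isClosed_isR1_or_zero.preimage (f := fun M => -M - 1) (by fun_prop))
  have hmem := hcl.mem_of_tendsto hlim3 <| Eventually.of_forall fun m => by
    rcases hz m with h | h
    · refine Or.inl (Or.inr ?_)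
      simpa [h] using ha (k m)
    · refine Or.inr (Or.inr ?_)
      simpa [h] using ha (k m)
  have hsq : ∀ M : Matrix (Fin n) (Fin n) ℝ, (M - 1 = 0 ∨ IsR1 (M - 1)) →
      M * M = 1 + (2 : ℝ) • (M - 1) := by
    intro M h
    have h0 : (M - 1) * (M - 1) = 0 := by
      rcases h with h | h
      · rw [h, mul_zero]
      · exact h.mul_self
    rw [sub_mul, mul_sub, one_mul, mul_one, sub_eq_zero, sub_eq_iff_eq_add] at h0
    rw [h0, two_smul]
    abel
  rcases hmem with h | h
  · exact ⟨_, h, hsq _ h⟩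
  · refine ⟨_, h, ?_⟩
    rw [← hsq _ h, neg_mul_neg]
    rfl

theorem exists_isR1_intw_aux (hn : 2 ≤ n) (hφ : MeasurePreserving φ μ μ)
    (hψ : MeasurePreserving ψ μ μ) (h1 : ∀ᵐ x ∂μ, ψ (φ x) = x) (h2 : ∀ᵐ x ∂μ, φ (ψ x) = x)
    (hg : ∀ Y : Matrix (Fin n) (Fin n) ℝ, IsR1 Y → GoodR1 μ φ Y)
    (hon : ∀ g : SLR n, ∃ g', Intw μ φ g' g) :
    ∃ X Y : Matrix (Fin n) (Fin n) ℝ, IsR1 X ∧ IsR1 Y ∧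
      ∀ t : ℝ, Intw μ φ (toSL (1 + t • Y)) (toSL (1 + t • X)) := by
  have hsymm : ∀ {g g' : SLR n}, Intw μ φ g g' → Intw μ ψ g' g := fun h => h.symm hψ h1 h2
  have hE := isR1_single (n := n) (i := ⟨0, by omega⟩) (j := ⟨1, by omega⟩) (by simp)
    (one_ne_zero (α := ℝ))
  set E : Matrix (Fin n) (Fin n) ℝ := single ⟨0, by omega⟩ ⟨1, by omega⟩ 1
  obtain ⟨P, hP, hPI⟩ := hg E hE
  have hP1 : P 1 ≠ 1 := fun h => by
    have h3 := hPI 1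
    rw [h] at h3
    have h4 := Intw.isPM_of_one hn hψ (hsymm h3)
    have h5 : Unip (1 : SLR n) := by
      refine ⟨1, ?_⟩
      rw [Matrix.SpecialLinearGroup.coe_one, sub_self, zero_pow one_ne_zero]
    exact hE.toSL_ne_one (Unip.eq_of_isPM_mul hn h4 h5 (by rw [mul_one]; exact hE.unip))
  obtain ⟨W, hW, htr, hlim⟩ := hP.exists_deriv hP1
  obtain ⟨X, c, hX, hc, hXW⟩ := exists_isR1_mul_mul hn hW htr
  let s : ℕ → ℝ := fun k => 1 / ((k : ℝ) + 1)
  have hs0 : ∀ k, s k ≠ 0 := fun k => by positivity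
  have hs : Tendsto s atTop (𝓝 0) := tendsto_one_div_add_atTop_nhds_zero_nat
  let g : ℕ → SLR n := fun k => toSL (1 + (s k)⁻¹ • X)
  let b : ℕ → SLR n := fun k => g k * P (s k ^ 2) * (g k)⁻¹
  choose h hh using fun k => hon (g k)
  let a : ℕ → SLR n := fun k => h k * toSL (1 + (s k ^ 2) • E) * (h k)⁻¹
  have hab : ∀ k, Intw μ φ (a k) (b k) := fun k => ((hh k).mul (hPI _)).mul (hh k).inv
  have hcX : IsR1 (-c • X) := hX.smul (neg_ne_zero.2 hc)
  have hb : Tendsto b atTop (𝓝 (toSL (1 + (1 : ℝ) • (-c • X)))) := by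
    refine (SLR.isClosedEmbedding_val n).isInducing.tendsto_nhds_iff.2 ?_
    rw [hcX.coe_toSL, one_smul]
    have h3 : Tendsto (fun k => (s k ^ 2)⁻¹ • ((P (s k ^ 2) : Matrix (Fin n) (Fin n) ℝ) - 1))
        atTop (𝓝 W) := by
      refine hlim.comp (tendsto_nhdsWithin_iff.2 ⟨?_, Eventually.of_forall fun k => ?_⟩)
      · simpa using hs.pow 2
      · exact pow_ne_zero 2 (hs0 k)
    have h4 : Tendsto (fun k => s k • (1 : Matrix (Fin n) (Fin n) ℝ)) atTop (𝓝 0) := by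
      simpa using hs.smul_const (1 : Matrix (Fin n) (Fin n) ℝ)
    have h5 := (((h4.add_const X).mul h3).mul (h4.sub_const X)).const_add 1
    rw [zero_add, zero_sub, mul_neg, hXW, ← neg_smul] at h5
    refine h5.congr fun k => ?_
    show _ = ((g k * P (s k ^ 2) * (g k)⁻¹ : SLR n) : Matrix (Fin n) (Fin n) ℝ)
    rw [Matrix.SpecialLinearGroup.coe_mul, Matrix.SpecialLinearGroup.coe_mul, ← hX.toSL_neg,
      hX.coe_toSL, hX.coe_toSL, one_add_mul_one_sub hX.mul_self (hs0 k)]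
  obtain ⟨a', ha'⟩ := hon (toSL (1 + (1 : ℝ) • (-c • X)))
  obtain ⟨Y, hY, haY⟩ := Intw.isR1_or_of_tendsto hn hψ (fun k => hsymm (hab k)) (hsymm ha') hb
    fun k => by
      show IsR1 (((h k * toSL (1 + (s k ^ 2) • E) * (h k)⁻¹ : SLR n) :
        Matrix (Fin n) (Fin n) ℝ) - 1)
      rw [← cnj_sub_one, hE.coe_toSL, add_sub_cancel_left]
      exact (hE.smul (pow_ne_zero 2 (hs0 k))).cnj _
  have hX1 : IsR1 ((2 : ℝ) • (-c • X)) := hcX.smul two_ne_zero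
  have hI := ha'.mul ha'
  rw [← hcX.toSL_add, show (1 : ℝ) + 1 = 1 * 2 by norm_num, mul_smul] at hI
  have hY0 : IsR1 Y := hY.resolve_left fun h0 => by
    rw [h0, smul_zero, add_zero] at haY
    rw [show a' * a' = 1 from SL_ext haY] at hI
    exact hX1.toSL_ne_one (Intw.eq_of_unip hn hφ Intw.one hI
      ⟨1, by simp⟩ hX1.unip).symm
  have hY1 := hY0.smul (two_ne_zero (α := ℝ))
  have hIY : Intw μ φ (toSL (1 + (1 : ℝ) • (2 : ℝ) • Y)) (toSL (1 + (1 : ℝ) • (2 : ℝ) • (-c • X))) := by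
    rwa [show a' * a' = toSL (1 + (1 : ℝ) • (2 : ℝ) • Y) from
      SL_ext (by rw [haY, hY1.coe_toSL, one_smul])] at hI
  refine ⟨_, _, hX1, hY1, ?_⟩
  obtain ⟨Q, hQ, hQI⟩ := hg _ hY1
  have := hQ.eq_of_one hX1.isUPG (Intw.eq_of_unip hn hφ (hQI 1) hIY (hQ.unip 1) hX1.unip)
  rwa [this] at hQI

/-- In rank at least two, every root subgroup is the partner of a root subgroup. -/
theorem exists_isR1_intw (hn : 3 ≤ n) (hφ : MeasurePreserving φ μ μ)
    (hψ : MeasurePreserving ψ μ μ) (h1 : ∀ᵐ x ∂μ, ψ (φ x) = x) (h2 : ∀ᵐ x ∂μ, φ (ψ x) = x)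
    (hg : ∀ Y : Matrix (Fin n) (Fin n) ℝ, IsR1 Y → GoodR1 μ φ Y)
    (hon : ∀ g : SLR n, ∃ g', Intw μ φ g' g) {X : Matrix (Fin n) (Fin n) ℝ} (hX : IsR1 X) :
    ∃ Y, IsR1 Y ∧ ∀ t : ℝ, Intw μ φ (toSL (1 + t • Y)) (toSL (1 + t • X)) := by
  obtain ⟨X₀, Y₀, hX₀, hY₀, h0⟩ := exists_isR1_intw_aux (by omega) hφ hψ h1 h2 hg hon
  refine IsR1.induction_conj hn (Q := fun X => ∃ Y, IsR1 Y ∧ ∀ t : ℝ,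
    Intw μ φ (toSL (1 + t • Y)) (toSL (1 + t • X))) ?_ ?_ hX₀ hX ⟨Y₀, hY₀, h0⟩
  · rintro c X hc - ⟨Y, hY, h⟩
    refine ⟨c • Y, hY.smul hc, fun t => ?_⟩
    rw [smul_smul, smul_smul]
    exact h _
  · rintro g X - ⟨Y, hY, h⟩
    obtain ⟨g', hg'⟩ := hon g
    refine ⟨cnj g' Y, hY.cnj _, fun t => ?_⟩
    rw [← mul_toSL_one_add_mul_inv, ← mul_toSL_one_add_mul_inv]
    exact (hg'.mul (h t)).mul hg'.inv

theorem IsR1.mul_eq_zero_or {n : ℕ} {W V : Matrix (Fin n) (Fin n) ℝ} (hW : IsR1 W) (hV : IsR1 V)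
    (h : W * V * W = 0) : W * V = 0 ∨ V * W = 0 := by
  obtain ⟨h0, α, β, h1, rfl⟩ := hW
  obtain ⟨-, γ, δ, h2, rfl⟩ := hV
  simp only [vecMulVec_mul_vecMulVec, vecMulVec_smul, smul_mul_assoc, smul_smul] at h ⊢
  rcases mul_eq_zero.1 ((smul_eq_zero.1 h).resolve_right h0) with h3 | h3
  · exact Or.inl (by rw [h3, zero_smul])
  · exact Or.inr (by rw [h3, zero_smul])

theorem IsR1.neg_transpose {n : ℕ} {W : Matrix (Fin n) (Fin n) ℝ} (hW : IsR1 W) : IsR1 (-Wᵀ) := by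
  obtain ⟨h0, α, β, h1, rfl⟩ := hW
  refine ⟨fun h => h0 ?_, -β, α, ?_, ?_⟩
  · rw [neg_eq_zero] at h
    rw [← transpose_transpose (vecMulVec α β), h, transpose_zero]
  · rw [dotProduct_neg, dotProduct_comm, h1, neg_zero]
  · rw [transpose_vecMulVec, neg_vecMulVec]

/-- Rank one matrices satisfying the commutation relations of the matrix units. -/
structure RootSys {n : ℕ} (W : Fin n → Fin n → Matrix (Fin n) (Fin n) ℝ) : Prop where
  isR1 : ∀ i j, i ≠ j → IsR1 (W i j)
  bracket : ∀ i j k, i ≠ j → j ≠ k → i ≠ k → W i j * W j k = W j k * W i j + W i k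
  or_zero : ∀ i j k, i ≠ j → j ≠ k → i ≠ k → W i j * W j k = 0 ∨ W j k * W i j = 0
  row : ∀ i j k, i ≠ j → j ≠ k → i ≠ k → W i j * W i k = 0
  col : ∀ i j k, i ≠ j → j ≠ k → i ≠ k → W i k * W j k = 0
  comm : ∀ i j k l, i ≠ j → k ≠ l → j ≠ k → i ≠ l → W i j * W k l = W k l * W i j

namespace RootSys
variable {n : ℕ} {W : Fin n → Fin n → Matrix (Fin n) (Fin n) ℝ}

theorem neg_transpose (h : RootSys W) : RootSys fun i j => -(W i j)ᵀ where
  isR1 i j hij := (h.isR1 i j hij).neg_transpose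
  bracket i j k h1 h2 h3 := by
    have := congrArg transpose (h.bracket i j k h1 h2 h3)
    rw [transpose_add, transpose_mul, transpose_mul] at this
    rw [neg_mul_neg, neg_mul_neg, this]
    abel
  or_zero i j k h1 h2 h3 := by
    rw [neg_mul_neg, neg_mul_neg, ← transpose_mul, ← transpose_mul, transpose_eq_zero,
      transpose_eq_zero]
    exact (h.or_zero i j k h1 h2 h3).symm
  row i j k h1 h2 h3 := by
    rw [neg_mul_neg, ← transpose_mul, h.row i k j h3 h2.symm h1, transpose_zero]
  col i j k h1 h2 h3 := by
    rw [neg_mul_neg, ← transpose_mul, h.col j i k h1.symm h3 h2, transpose_zero]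
  comm i j k l h1 h2 h3 h4 := by
    rw [neg_mul_neg, neg_mul_neg, ← transpose_mul, ← transpose_mul, h.comm i j k l h1 h2 h3 h4]

/-- The triple `i, j, k` multiplies like matrix units. -/
def Tri (W : Fin n → Fin n → Matrix (Fin n) (Fin n) ℝ) (i j k : Fin n) : Prop :=
  i ≠ j ∧ j ≠ k ∧ i ≠ k ∧ W j k * W i j = 0

variable {i j k l : Fin n}

theorem Tri.mul (h : RootSys W) (ht : Tri W i j k) : W i j * W j k = W i k := by
  obtain ⟨h1, h2, h3, h4⟩ := ht
  rw [h.bracket i j k h1 h2 h3, h4, zero_add]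

theorem Tri.of_mul_ne_zero (h : RootSys W) (h1 : i ≠ j) (h2 : j ≠ k) (h3 : i ≠ k)
    (h4 : W i j * W j k = 0 → False) : Tri W i j k :=
  ⟨h1, h2, h3, (h.or_zero i j k h1 h2 h3).resolve_left h4⟩

theorem Tri.swap_right (h : RootSys W) (ht : Tri W i j k) : Tri W i k j := by
  have hm := ht.mul h
  obtain ⟨h1, h2, h3, h4⟩ := ht
  refine Tri.of_mul_ne_zero h h3 h2.symm h1 fun h5 => (h.isR1 i k h3).1 ?_
  have h6 := h.bracket i k j h3 h2.symm h1
  rw [h5, eq_comm, add_comm, add_eq_zero_iff_eq_neg] at h6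
  rw [← hm, h6, neg_mul, mul_assoc, h.col i j k h1 h2 h3, mul_zero, neg_zero]

theorem Tri.swap_left (h : RootSys W) (ht : Tri W i j k) : Tri W j i k := by
  have hm := ht.mul h
  obtain ⟨h1, h2, h3, h4⟩ := ht
  refine Tri.of_mul_ne_zero h h1.symm h3 h2 fun h5 => (h.isR1 i k h3).1 ?_
  have h6 := h.bracket j i k h1.symm h3 h2
  rw [h5, eq_comm, add_comm, add_eq_zero_iff_eq_neg] at h6
  rw [← hm, h6, mul_neg, ← mul_assoc, h.row i j k h1 h2 h3, zero_mul, neg_zero]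

theorem Tri.replace (h : RootSys W) (ht : Tri W i j k) (h5 : i ≠ l) (h6 : j ≠ l) :
    Tri W i j l := by
  by_cases hkl : k = l
  · rwa [← hkl]
  have hm := ht.mul h
  obtain ⟨h1, h2, h3, h4⟩ := ht
  refine Tri.of_mul_ne_zero h h1 h6 h5 fun h7 => (h.isR1 i k h3).1 ?_
  have h8 := h.bracket j l k h6 (Ne.symm hkl) h2
  have h9 : W i j * (W j l * W l k) = W i j * (W l k * W j l) + W i k := by
    rw [h8, mul_add, hm]
  rwa [← mul_assoc, ← mul_assoc, h7, zero_mul, h.comm i j l k h1 (Ne.symm hkl) h6 h3, mul_assoc, h7,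
    mul_zero, zero_add, eq_comm] at h9

theorem Tri.all (h : RootSys W) (ht : Tri W i j k) {a b c : Fin n} (hab : a ≠ b) (hbc : b ≠ c)
    (hac : a ≠ c) : Tri W a b c := by
  have s1 : ∃ x y, Tri W a x y := by
    by_cases h1 : i = a
    · exact h1 ▸ ⟨_, _, ht⟩
    by_cases h2 : j = a
    · exact h2 ▸ ⟨_, _, ht.swap_left h⟩
    · exact ⟨_, _, ((ht.replace h h1 h2).swap_right h).swap_left h⟩
  obtain ⟨x, y, hxy⟩ := s1
  have s2 : ∃ y, Tri W a b y := by
    by_cases h1 : x = b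
    · exact h1 ▸ ⟨_, hxy⟩
    · exact ⟨_, (hxy.replace h hab h1).swap_right h⟩
  obtain ⟨y, hy⟩ := s2
  exact hy.replace h hac hbc

section Units
variable (h : RootSys W) (hT : ∀ a b c : Fin n, a ≠ b → b ≠ c → a ≠ c → Tri W a b c)
include h hT

theorem mul_eq_zero (hij : i ≠ j) (hkl : k ≠ l) (hjk : j ≠ k) : W i j * W k l = 0 := by
  by_cases hli : l = i
  · subst hli
    exact (hT k l j hkl hij hjk.symm).2.2.2
  by_cases hki : k = i
  · subst hki
    by_cases hlj : l = j
    · rw [hlj]; exact (h.isR1 _ _ hij).mul_self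
    · exact h.row _ _ _ hij (Ne.symm hlj) hkl
  by_cases hlj : l = j
  · subst hlj
    exact h.col i k l (Ne.symm hki) hkl hij
  · rw [← (hT k i l hki (Ne.symm hli) hkl).mul h, ← mul_assoc,
      (hT k i j hki hij hjk.symm).2.2.2, zero_mul]

theorem mul_mul_eq (hij : i ≠ j) (hjk : j ≠ k) (hik : i ≠ k) : W i j * W j i * W i j = W i j := by
  have e1 := (hT i k j hik hjk.symm hij).mul h
  calc W i j * W j i * W i j = W i k * (W k j * W j i) * W i j := by
        rw [← mul_assoc (W i k), e1]
    _ = W i j := by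
        rw [(hT k j i hjk.symm hij.symm hik.symm).mul h, mul_assoc,
          (hT k i j hik.symm hij hjk.symm).mul h, e1]

theorem exists_intertwiner (hn : 3 ≤ n) : ∃ D : Matrix (Fin n) (Fin n) ℝ, D.det ≠ 0 ∧
    ∀ i j, i ≠ j → W i j * D = D * single i j 1 := by
  let z : Fin n := ⟨0, by omega⟩
  let o : Fin n := ⟨1, by omega⟩
  let t : Fin n := ⟨2, by omega⟩
  have hzo : z ≠ o := by simp [z, o]
  have hot : o ≠ t := by simp [t, o]
  have hzt : z ≠ t := by simp [z, t]
  obtain ⟨x, hx⟩ : ∃ x, W z o *ᵥ x ≠ 0 := by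
    by_contra! hc
    exact (h.isR1 z o hzo).1 (Matrix.ext_of_mulVec_single fun i => by rw [hc, zero_mulVec])
  let d : Fin n → Fin n → ℝ := fun j => if j = z then W z o *ᵥ x else W j z *ᵥ W z o *ᵥ x
  have hd0 : d z = W z o *ᵥ x := if_pos rfl
  have hd : ∀ j, j ≠ z → d j = W j z *ᵥ d z := fun j hj => by rw [hd0]; exact if_neg hj
  have hne : ∀ i j k, i ≠ j → j ≠ k → W i j *ᵥ d k = 0 := by
    intro i j k hij hjk
    by_cases hk : k = z
    · rw [hk, hd0, mulVec_mulVec, h.mul_eq_zero hT hij hzo (hk ▸ hjk), zero_mulVec]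
    · rw [hd k hk, mulVec_mulVec, h.mul_eq_zero hT hij hk hjk, zero_mulVec]
  have heq : ∀ i j, i ≠ j → W i j *ᵥ d j = d i := by
    intro i j hij
    by_cases hj : j = z
    · rw [hj, hd i (hj ▸ hij)]
    rw [hd j hj, mulVec_mulVec]
    by_cases hi : i = z
    · rw [hi, hd0, mulVec_mulVec]
      congr 1
      by_cases hjo : j = o
      · rw [hjo, h.mul_mul_eq hT hzo hot hzt]
      · rw [mul_assoc, (hT j z o hj hzo hjo).mul h, (hT z j o (Ne.symm hj) hjo hzo).mul h]
    · rw [(hT i j z hij hj hi).mul h, hd i hi]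
  have hd_ne : ∀ i, d i ≠ 0 := by
    intro i hi
    by_cases hiz : i = z
    · exact hx (by rw [← hd0, ← hiz, hi])
    · have := heq z i (Ne.symm hiz)
      rw [hi, mulVec_zero] at this
      exact hx (by rw [← hd0, ← this])
  have hD : ∀ i j, i ≠ j → W i j * (Matrix.of fun a k => d k a) =
      (Matrix.of fun a k => d k a) * single i j 1 := by
    intro i j hij
    ext a k
    have h1 : (W i j * (Matrix.of fun a k => d k a)) a k = (W i j *ᵥ d k) a := rfl
    rw [h1]
    by_cases hk : j = k
    · subst hk
      rw [heq i j hij, mul_single_apply_same, mul_one, of_apply]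
    · rw [hne i j k hij hk, mul_single_apply_of_ne _ _ _ _ _ (Ne.symm hk)]
      rfl
  refine ⟨Matrix.of fun a k => d k a, fun hdet => ?_, hD⟩
  obtain ⟨v, hv, hDv⟩ := Matrix.exists_mulVec_eq_zero_iff.2 hdet
  obtain ⟨k, hk⟩ := Function.ne_iff.1 hv
  obtain ⟨i, hik⟩ : ∃ i, i ≠ k := by
    by_cases hz : z = k
    · exact ⟨o, hz ▸ hzo.symm⟩
    · exact ⟨z, hz⟩
  have h1 := congrArg (· *ᵥ v) (hD i k hik)
  simp only [← mulVec_mulVec, hDv, mulVec_zero, single_mulVec] at h1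
  refine hd_ne i (funext fun a => ?_)
  have h2 := congrFun h1 a
  rw [one_mul] at h2
  simp only [mulVec, dotProduct, Function.update_apply] at h2
  simpa [show v k ≠ 0 from hk] using h2.symm

end Units

/-- A root system of rank one matrices is conjugate to the matrix units, or to their negative
transposes. -/
theorem exists_or (h : RootSys W) (hn : 3 ≤ n) :
    (∃ D : Matrix (Fin n) (Fin n) ℝ, D.det ≠ 0 ∧ ∀ i j, i ≠ j → W i j * D = D * single i j 1) ∨
    ∃ D : Matrix (Fin n) (Fin n) ℝ, D.det ≠ 0 ∧
      ∀ i j, i ≠ j → -(W i j)ᵀ * D = D * single i j 1 := by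
  let z : Fin n := ⟨0, by omega⟩
  let o : Fin n := ⟨1, by omega⟩
  let t : Fin n := ⟨2, by omega⟩
  have hzo : z ≠ o := by simp [z, o]
  have hot : o ≠ t := by simp [t, o]
  have hzt : z ≠ t := by simp [z, t]
  rcases h.or_zero z o t hzo hot hzt with h0 | h0
  · refine Or.inr (h.neg_transpose.exists_intertwiner (fun a b c h1 h2 h3 => ?_) hn)
    refine Tri.all h.neg_transpose (i := z) (j := o) (k := t) ⟨hzo, hot, hzt, ?_⟩ h1 h2 h3
    rw [neg_mul_neg, ← transpose_mul, h0, transpose_zero]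
  · exact Or.inl (h.exists_intertwiner (fun a b c h1 h2 h3 =>
      Tri.all h (i := z) (j := o) (k := t) ⟨hzo, hot, hzt, h0⟩ h1 h2 h3) hn)

end RootSys

section Aut
variable {n : ℕ}

theorem SLR.continuous_of_coe {ι : Type*} [TopologicalSpace ι] {f : ι → SLR n}
    (h : Continuous fun x => (f x : Matrix (Fin n) (Fin n) ℝ)) : Continuous f :=
  (SLR.isClosedEmbedding_val n).isInducing.continuous_iff.2 h

theorem exists_conj_aut {D : Matrix (Fin n) (Fin n) ℝ} (hD : D.det ≠ 0) :
    ∃ A : SLR n ≃* SLR n, Continuous A ∧ Continuous A.symm ∧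
      ∀ g, (A g : Matrix (Fin n) (Fin n) ℝ) = D * g * D⁻¹ := by
  have hu : IsUnit D.det := isUnit_iff_ne_zero.2 hD
  have h1 : ∀ g : SLR n, (D * g * D⁻¹).det = 1 := fun g => by
    rw [det_mul, det_mul, g.det_coe, mul_one, ← det_mul, mul_nonsing_inv _ hu, det_one]
  have h2 : ∀ g : SLR n, (D⁻¹ * g * D).det = 1 := fun g => by
    rw [det_mul, det_mul, g.det_coe, mul_one, ← det_mul, nonsing_inv_mul _ hu, det_one]
  refine ⟨{ toFun := fun g => SLR.of _ (h1 g), invFun := fun g => SLR.of _ (h2 g),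
            left_inv := fun g => SL_ext ?_, right_inv := fun g => SL_ext ?_,
            map_mul' := fun g g' => SL_ext ?_ }, SLR.continuous_of_coe ?_, SLR.continuous_of_coe ?_,
          fun g => rfl⟩
  · simp only [SLR.coe_of]
    rw [← mul_assoc, ← mul_assoc, nonsing_inv_mul _ hu, one_mul, mul_assoc, nonsing_inv_mul _ hu,
      mul_one]
  · simp only [SLR.coe_of]
    rw [← mul_assoc, ← mul_assoc, mul_nonsing_inv _ hu, one_mul, mul_assoc, mul_nonsing_inv _ hu,
      mul_one]
  · simp only [SLR.coe_of, Matrix.SpecialLinearGroup.coe_mul]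
    simp only [mul_assoc]
    rw [← mul_assoc D⁻¹ D, nonsing_inv_mul _ hu, one_mul]
  · exact (continuous_const.mul (SLR.continuous_val n)).mul continuous_const
  · exact (continuous_const.mul (SLR.continuous_val n)).mul continuous_const

theorem exists_inv_transpose_aut (n : ℕ) :
    ∃ A : SLR n ≃* SLR n, Continuous A ∧
      ∀ g, (A g : Matrix (Fin n) (Fin n) ℝ) = ((g⁻¹ : SLR n) : Matrix (Fin n) (Fin n) ℝ)ᵀ := by
  have h1 : ∀ g : SLR n, ((g⁻¹).transpose⁻¹).transpose = g := fun g => by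
    have h2 : (g⁻¹).transpose⁻¹ = g.transpose := by
      rw [inv_eq_iff_mul_eq_one]
      refine SL_ext ?_
      rw [Matrix.SpecialLinearGroup.coe_mul, Matrix.SpecialLinearGroup.coe_transpose,
        Matrix.SpecialLinearGroup.coe_transpose, ← transpose_mul, SLR.coe_mul_coe_inv,
        transpose_one, Matrix.SpecialLinearGroup.coe_one]
    rw [h2]
    exact SL_ext (transpose_transpose _)
  refine ⟨{ toFun := fun g => (g⁻¹).transpose, invFun := fun g => (g⁻¹).transpose,
            left_inv := h1, right_inv := h1, map_mul' := fun g g' => SL_ext ?_ },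
          SLR.continuous_of_coe ?_, fun g => rfl⟩
  · rw [_root_.mul_inv_rev, Matrix.SpecialLinearGroup.coe_mul,
      Matrix.SpecialLinearGroup.coe_transpose, Matrix.SpecialLinearGroup.coe_transpose,
      Matrix.SpecialLinearGroup.coe_transpose, Matrix.SpecialLinearGroup.coe_mul, transpose_mul]
  · exact ((SLR.continuous_val n).comp continuous_inv).matrix_transpose

end Aut

variable {n : ℕ} {X : Type*} [TopologicalSpace X] [MeasurableSpace X] [MulAction (SLR n) X]
  [HomSpace n X] {μ : Measure X} [IsProbabilityMeasure μ] [SMulInvariantMeasure (SLR n) X μ]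
  {φ : X → X}

/-- An equivariance on transvections extends to all of `SL(n,ℝ)`. -/
theorem intw_of_transvection (hn : 2 ≤ n) (A : SLR n →* SLR n)
    (h : ∀ (i j : Fin n) (hij : i ≠ j) (a : ℝ),
      Intw μ φ (SpecialLinearGroup.transvection hij a) (A (SpecialLinearGroup.transvection hij a)))
    (g : SLR n) : Intw μ φ g (A g) := by
  let S : Subgroup (SLR n) :=
    { carrier := {g | Intw μ φ g (A g)}
      mul_mem' := fun {a b} ha hb => by
        show Intw μ φ (a * b) (A (a * b))
        rw [map_mul]; exact Intw.mul ha hb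
      one_mem' := by
        show Intw μ φ 1 (A 1)
        rw [map_one]; exact Intw.one
      inv_mem' := fun {a} ha => by
        show Intw μ φ a⁻¹ (A a⁻¹)
        rw [map_inv]; exact Intw.inv ha }
  have hS : S = ⊤ := SLR.eq_top_of_transvection_mem hn S h
  have : g ∈ S := by rw [hS]; exact Subgroup.mem_top g
  exact this

/-- The root subgroups of `Y` and `Z` are intertwined by `φ`. -/
def RPair (μ : Measure X) (φ : X → X) (Y Z : Matrix (Fin n) (Fin n) ℝ) : Prop :=
  IsR1 Y ∧ IsR1 Z ∧ ∀ t : ℝ, Intw μ φ (toSL (1 + t • Y)) (toSL (1 + t • Z))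

namespace RPair
variable {Y Z Y' Z' : Matrix (Fin n) (Fin n) ℝ}

theorem eq (hn : 2 ≤ n) (hφ : MeasurePreserving φ μ μ) (h : RPair μ φ Y Z) (h' : RPair μ φ Y Z') :
    Z = Z' := by
  have h1 := congrArg (fun g : SLR n => (g : Matrix (Fin n) (Fin n) ℝ))
    (Intw.eq_of_unip hn hφ (h.2.2 1) (h'.2.2 1) h.2.1.unip h'.2.1.unip)
  rw [h.2.1.coe_toSL, h'.2.1.coe_toSL, one_smul, one_smul] at h1
  exact add_left_cancel h1

theorem smul (h : RPair μ φ Y Z) {c : ℝ} (hc : c ≠ 0) : RPair μ φ (c • Y) (c • Z) :=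
  ⟨h.1.smul hc, h.2.1.smul hc, fun t => by rw [smul_smul, smul_smul]; exact h.2.2 _⟩

theorem conj (h : RPair μ φ Y Z) {g g' : SLR n} (hg : Intw μ φ g g') :
    RPair μ φ (cnj g Y) (cnj g' Z) :=
  ⟨h.1.cnj g, h.2.1.cnj g', fun t => by
    rw [← mul_toSL_one_add_mul_inv, ← mul_toSL_one_add_mul_inv]
    exact (hg.mul (h.2.2 t)).mul hg.inv⟩

theorem comm (hn : 2 ≤ n) (hφ : MeasurePreserving φ μ μ) (h : RPair μ φ Y Z)
    (h' : RPair μ φ Y' Z') (hYY : Y * Y' = Y' * Y) : Z * Z' = Z' * Z := by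
  have h1 := h'.conj (h.2.2 1)
  have h2 : _root_.cnj (toSL (1 + (1 : ℝ) • Y)) Y' = Y' := by
    rw [cnj_eq_iff, h.1.coe_toSL, one_smul, add_mul, mul_add, hYY, one_mul, mul_one]
  rw [h2] at h1
  have h3 := h1.eq hn hφ h'
  rw [cnj_eq_iff, h.2.1.coe_toSL, one_smul, add_mul, mul_add, one_mul, mul_one] at h3
  exact add_left_cancel h3

theorem add (hn : 2 ≤ n) (hφ : MeasurePreserving φ μ μ) (h : RPair μ φ Y Z)
    (h' : RPair μ φ Y' Z') (h1 : Y * Y' = 0) (h2 : Y' * Y = 0) {V : Matrix (Fin n) (Fin n) ℝ}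
    (hV : RPair μ φ (Y + Y') V) : Z * Z' = 0 ∧ V = Z + Z' := by
  have hc := h.comm hn hφ h' (h1.trans h2.symm)
  have key : ∀ t : ℝ, t • V = t • Z + t • Z' + (t * t) • (Z * Z') := by
    intro t
    have e1 : toSL (1 + t • Y) * toSL (1 + t • Y') = toSL (1 + t • (Y + Y')) := by
      refine SL_ext ?_
      rw [Matrix.SpecialLinearGroup.coe_mul, h.1.coe_toSL, h'.1.coe_toSL, hV.1.coe_toSL, mul_add,
        mul_one, add_mul _ _ (t • Y'), one_mul, smul_mul_smul_comm, h1, smul_zero, add_zero, smul_add,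
        add_assoc]
    have e2 := (h.2.2 t).mul (h'.2.2 t)
    rw [e1] at e2
    have e3 : ((toSL (1 + t • Z) * toSL (1 + t • Z') : SLR n) : Matrix (Fin n) (Fin n) ℝ) =
        1 + (t • Z + t • Z' + (t * t) • (Z * Z')) := by
      rw [Matrix.SpecialLinearGroup.coe_mul, h.2.1.coe_toSL, h'.2.1.coe_toSL, mul_add,
        mul_one, add_mul _ _ (t • Z'), one_mul, smul_mul_smul_comm]
      abel
    have e4 : Unip (toSL (1 + t • Z) * toSL (1 + t • Z')) := by
      have hc' : Commute Z Z' := hc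
      have n1 : IsNilpotent Z := ⟨2, by rw [pow_two, h.2.1.mul_self]⟩
      have n2 : IsNilpotent Z' := ⟨2, by rw [pow_two, h'.2.1.mul_self]⟩
      have n3 : IsNilpotent (Z + Z') := hc'.isNilpotent_add n1 n2
      have n4 : IsNilpotent (Z * Z') := hc'.isNilpotent_mul_right n1
      have c1 : Commute (Z + Z') (Z * Z') :=
        ((Commute.refl Z).mul_right hc').add_left (hc'.symm.mul_right (Commute.refl Z'))
      rw [Unip, e3, add_sub_cancel_left, ← smul_add]
      exact ((c1.smul_left t).smul_right (t * t)).isNilpotent_add (n3.smul t) (n4.smul (t * t))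
    have e5 := congrArg (fun g : SLR n => (g : Matrix (Fin n) (Fin n) ℝ))
      (Intw.eq_of_unip hn hφ (hV.2.2 t) e2 (hV.2.1.isUPG.unip t) e4)
    simp only [e3, hV.2.1.coe_toSL] at e5
    exact add_left_cancel e5
  have k1 := key 1
  have k2 := key (-1)
  simp only [one_smul, mul_one, neg_smul, mul_neg, neg_neg] at k1 k2
  have k3 : Z * Z' = 0 := by
    have : (2 : ℝ) • (Z * Z') = 0 := by
      rw [two_smul]
      rw [k1] at k2
      have := congrArg (· + (Z + Z' + Z * Z')) k2
      simp only [neg_add_cancel] at this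
      rw [this]
      abel
    exact (smul_eq_zero.1 this).resolve_left two_ne_zero
  exact ⟨k3, by rw [k1, k3, add_zero]⟩

theorem bracket (hn : 2 ≤ n) (hφ : MeasurePreserving φ μ μ)
    {V V' : Matrix (Fin n) (Fin n) ℝ} (h : RPair μ φ Y Z)
    (h' : RPair μ φ Y' Z') (hV : RPair μ φ V V') (h1 : Y * Y' = V) (h2 : Y' * Y = 0)
    (h3 : Y' * V = 0) (h4 : V * Y' = 0) :
    Z * Z' = Z' * Z + V' ∧ V' * Z = 0 := by
  have h5 : V * Y = 0 := by rw [← h1, mul_assoc, h2, mul_zero]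
  have key : ∀ s : ℝ, s ≠ 0 → s • (Z * Z') = s • V' + (s • (Z' * Z) + (s * s) • (V' * Z)) := by
    intro s hs
    have hsV := hV.smul hs
    have e1 : _root_.cnj (toSL (1 + s • Y)) Y' = Y' + s • V := by
      rw [cnj_eq_iff, h.1.coe_toSL, add_mul, mul_add, one_mul, mul_one, smul_mul_assoc, h1,
        add_mul, mul_smul_comm, h2, smul_mul_smul_comm, h5, smul_zero, smul_zero, add_zero,
        add_zero]
    have e2 := h'.conj (h.2.2 s)
    rw [e1] at e2
    have e3 := (h'.add hn hφ hsV (by rw [mul_smul_comm, h3, smul_zero])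
      (by rw [smul_mul_assoc, h4, smul_zero]) e2).2
    rw [cnj_eq_iff, h.2.1.coe_toSL, add_mul, mul_add, one_mul, mul_one, smul_mul_assoc,
      add_mul, mul_smul_comm, smul_mul_smul_comm, add_assoc] at e3
    exact add_left_cancel e3
  have k1 := key 1 one_ne_zero
  have k2 := key (-1) (by norm_num)
  simp only [one_smul, mul_one, neg_smul, mul_neg, neg_neg] at k1 k2
  have k3 : V' * Z = 0 := by
    have : (2 : ℝ) • (V' * Z) = 0 := by
      rw [two_smul]
      rw [k1] at k2
      have := congrArg (· + (V' + (Z' * Z + V' * Z))) k2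
      simp only [neg_add_cancel] at this
      rw [this]
      abel
    exact (smul_eq_zero.1 this).resolve_left two_ne_zero
  exact ⟨by rw [k1, k3, add_zero, add_comm], k3⟩

end RPair

theorem rootSys_of_rpair (hn : 2 ≤ n) (hφ : MeasurePreserving φ μ μ)
    (hF : ∀ Y : Matrix (Fin n) (Fin n) ℝ, IsR1 Y → ∃ Z, RPair μ φ Y Z)
    {W : Fin n → Fin n → Matrix (Fin n) (Fin n) ℝ}
    (hW : ∀ i j, i ≠ j → RPair μ φ (single i j 1) (W i j)) : RootSys W where
  isR1 i j hij := (hW i j hij).2.1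
  bracket i j k h1 h2 h3 := (RPair.bracket hn hφ (hW i j h1) (hW j k h2) (hW i k h3)
    (by simp) (by simp [h3.symm]) (by simp [h3.symm]) (by simp [h2.symm])).1
  or_zero i j k h1 h2 h3 := by
    have hb := RPair.bracket hn hφ (hW i j h1) (hW j k h2) (hW i k h3)
      (by simp) (by simp [h3.symm]) (by simp [h3.symm]) (by simp [h2.symm])
    refine (hW i j h1).2.1.mul_eq_zero_or (hW j k h2).2.1 ?_
    rw [hb.1, add_mul, hb.2, mul_assoc, (hW i j h1).2.1.mul_self, mul_zero, add_zero]
  row i j k h1 h2 h3 := by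
    have hR : IsR1 (single i j 1 + single i k 1 : Matrix (Fin n) (Fin n) ℝ) := by
      refine ⟨fun h => ?_, Pi.single i 1, Pi.single j 1 + Pi.single k 1, ?_, ?_⟩
      · have := congrFun (congrFun h i) j
        simp [h2.symm] at this
      · simp [h1, h3, h1.symm, h3.symm]
      · rw [vecMulVec_add, single_eq_single_vecMulVec_single, single_eq_single_vecMulVec_single]
    obtain ⟨V, hV⟩ := hF _ hR
    exact ((hW i j h1).add hn hφ (hW i k h3) (by simp [h1.symm]) (by simp [h3.symm]) hV).1
  col i j k h1 h2 h3 := by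
    have hR : IsR1 (single i k 1 + single j k 1 : Matrix (Fin n) (Fin n) ℝ) := by
      refine ⟨fun h => ?_, Pi.single i 1 + Pi.single j 1, Pi.single k 1, ?_, ?_⟩
      · have := congrFun (congrFun h i) k
        simp [h1.symm] at this
      · simp [h2, h3, h2.symm, h3.symm]
      · rw [add_vecMulVec, single_eq_single_vecMulVec_single, single_eq_single_vecMulVec_single]
    obtain ⟨V, hV⟩ := hF _ hR
    exact ((hW i k h3).add hn hφ (hW j k h2) (by simp [h2.symm]) (by simp [h3.symm]) hV).1
  comm i j k l h1 h2 h3 h4 := (hW i j h1).comm hn hφ (hW k l h2) (by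
    rw [single_mul_single_of_ne _ _ _ _ h3, single_mul_single_of_ne _ _ _ _ h4.symm])

/-- In rank at least two, a map intertwining all root subgroups with root subgroups is equivariant
with respect to an automorphism. -/
theorem exists_aut_of_rpair (hn : 3 ≤ n) (hφ : MeasurePreserving φ μ μ)
    (hF : ∀ Y : Matrix (Fin n) (Fin n) ℝ, IsR1 Y → ∃ Z, RPair μ φ Y Z) :
    ∃ A : SLR n ≃* SLR n, Continuous A ∧ ∀ g, Intw μ φ g (A g) := by
  have hn2 : 2 ≤ n := by omega
  have hex : ∀ i j : Fin n, ∃ Z, i ≠ j → RPair μ φ (single i j 1) Z := by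
    intro i j
    by_cases hij : i = j
    · exact ⟨0, fun h => absurd hij h⟩
    · obtain ⟨Z, hZ⟩ := hF _ (isR1_single hij one_ne_zero)
      exact ⟨Z, fun _ => hZ⟩
  choose W hW using hex
  have hS := rootSys_of_rpair hn2 hφ hF hW
  suffices h : ∃ A : SLR n ≃* SLR n, Continuous A ∧ ∀ i j (hij : i ≠ j) (a : ℝ),
      A (SpecialLinearGroup.transvection hij a) = toSL (1 + a • W i j) by
    obtain ⟨A, hA, h⟩ := h
    refine ⟨A, hA, intw_of_transvection hn2 A.toMonoidHom fun i j hij a => ?_⟩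
    have h1 := (hW i j hij).2.2 a
    rw [← h i j hij, smul_single, smul_eq_mul, mul_one, toSL_one_add_single hij] at h1
    exact h1
  have htr : ∀ (i j : Fin n) (hij : i ≠ j) (a : ℝ),
      (SpecialLinearGroup.transvection hij a : Matrix (Fin n) (Fin n) ℝ) = 1 + a • single i j 1 := by
    intro i j hij a
    rw [← toSL_one_add_single hij a, ← (isR1_single hij one_ne_zero).coe_toSL, smul_single,
      smul_eq_mul, mul_one]
  rcases hS.exists_or hn with ⟨D, hD, hWD⟩ | ⟨D, hD, hWD⟩
  · have hu : IsUnit D.det := isUnit_iff_ne_zero.2 hD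
    obtain ⟨A, hA, -, hAg⟩ := exists_conj_aut hD
    refine ⟨A, hA, fun i j hij a => SL_ext ?_⟩
    rw [hAg, htr, (hW i j hij).2.1.coe_toSL, mul_add, mul_one, mul_smul_comm, ← hWD i j hij,
      add_mul, mul_nonsing_inv _ hu, smul_mul_assoc, mul_assoc, mul_nonsing_inv _ hu, mul_one]
  · have hu : IsUnit D.det := isUnit_iff_ne_zero.2 hD
    obtain ⟨A, hA, -, hAg⟩ := exists_conj_aut hD
    obtain ⟨B, hB, hBg⟩ := exists_inv_transpose_aut n
    refine ⟨A.trans B, hB.comp hA, fun i j hij a => SL_ext ?_⟩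
    have hinv : (SpecialLinearGroup.transvection hij a)⁻¹ =
        SpecialLinearGroup.transvection hij (-a) := by
      rw [← toSL_one_add_single hij, ← toSL_one_add_single hij]
      have := (isR1_single hij (one_ne_zero (α := ℝ))).toSL_neg a
      rw [← single_neg]
      simpa [smul_single] using this.symm
    rw [MulEquiv.trans_apply, hBg, ← map_inv, hinv, hAg, htr, (hW i j hij).2.1.coe_toSL, mul_add,
      mul_one, mul_smul_comm, ← hWD i j hij, add_mul, mul_nonsing_inv _ hu, smul_mul_assoc,
      mul_assoc, mul_nonsing_inv _ hu, mul_one, transpose_add, transpose_one, transpose_smul,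
      transpose_neg, transpose_transpose, neg_smul_neg]

/-- Equivariance of `φ` when `n ≥ 3`, from one shear for `φ` and one for its inverse. -/
theorem exists_aut_of_goodR1 {ψ : X → X} (hn : 3 ≤ n) (hφ : MeasurePreserving φ μ μ)
    (hψ : MeasurePreserving ψ μ μ) (h1 : ∀ᵐ x ∂μ, ψ (φ x) = x) (h2 : ∀ᵐ x ∂μ, φ (ψ x) = x)
    {Y Z : Matrix (Fin n) (Fin n) ℝ} (hY : IsR1 Y) (hZ : IsR1 Z) (hφY : GoodR1 μ φ Y)
    (hψZ : GoodR1 μ ψ Z) : ∃ A : SLR n ≃* SLR n, Continuous A ∧ ∀ g, Intw μ φ g (A g) := by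
  have hn2 : 2 ≤ n := by omega
  have hgφ : ∀ Y : Matrix (Fin n) (Fin n) ℝ, IsR1 Y → GoodR1 μ φ Y :=
    fun Y' hY' => GoodR1.all hn hφ hY hY' hφY
  have hgψ : ∀ Y : Matrix (Fin n) (Fin n) ℝ, IsR1 Y → GoodR1 μ ψ Y :=
    fun Y' hY' => GoodR1.all hn hψ hZ hY' hψZ
  have hon : ∀ g : SLR n, ∃ g', Intw μ ψ g' g := fun g => by
    obtain ⟨g', hg'⟩ := exists_intw_of_forall_goodR1 hn2 hgφ g
    exact ⟨g', Intw.symm hψ h1 h2 hg'⟩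
  refine exists_aut_of_rpair hn hφ fun Y' hY' => ?_
  obtain ⟨Z', hZ', h⟩ := exists_isR1_intw hn hψ hφ h2 h1 hgψ hon hY'
  exact ⟨Z', hY', hZ', fun t => Intw.symm hφ h2 h1 (h t)⟩

variable {n : ℕ} {X : Type*} [TopologicalSpace X] [MeasurableSpace X] [MulAction (SLR n) X]
  [HomSpace n X] {μ : Measure X} [IsProbabilityMeasure μ] [SMulInvariantMeasure (SLR n) X μ]
  {φ : X → X}

/-- Elements near the identity are nearly intertwined with their images under a continuous
homomorphism. -/
theorem eventually_near_hom (hφ : Measurable φ) {A : SLR n →* SLR n} (hA : Continuous A) {δ : ℝ}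
    (hδ : 0 < δ) {ε : ENNReal} (hε : 0 < ε) :
    ∀ᶠ κ in 𝓝 (1 : SLR n), μ {z | (A κ • φ z, φ (κ • z)) ∉ GRel X (bal n δ)} ≤ ε := by
  obtain ⟨U, hU, h⟩ := exists_nhds_one_mul_inv_mem (bal_mem_nhds n hδ)
  obtain ⟨η, hη, hηU⟩ := exists_bal_subset hU
  have h1 : ∀ᶠ κ in 𝓝 (1 : SLR n), A κ ∈ U := hA.tendsto' 1 1 (map_one A) hU
  filter_upwards [h1, (near_continuous μ hφ hη).eventually_le_const hε] with κ h1 h2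
  refine (measure_mono fun z hz => ?_).trans h2
  rintro ⟨b, hb, hbz⟩
  refine hz ⟨b * (A κ)⁻¹, h _ h1 _ (hηU hb), ?_⟩
  rw [mul_smul, inv_smul_smul]
  exact hbz

theorem mem_GRel_inv_smul {F : Set (SLR n)} {a b : SLR n} {y z : X} (hab : a⁻¹ * b ∈ F)
    (h : b • y = z) : (y, a⁻¹ • z) ∈ GRel X F :=
  ⟨a⁻¹ * b, hab, by rw [← h, mul_smul]⟩

theorem eventually_near_hom_inv (hφ : Measurable φ) {A : SLR n →* SLR n} (hA : Continuous A)
    {δ : ℝ} (hδ : 0 < δ) {ε : ENNReal} (hε : 0 < ε) :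
    ∀ᶠ κ in 𝓝 (1 : SLR n), μ {z | (φ z, (A κ)⁻¹ • φ (κ • z)) ∉ GRel X (bal n δ)} ≤ ε := by
  obtain ⟨η, hη, h⟩ := exists_bal_inv_mul_mem (n := n) hδ
  have h1 : ∀ᶠ κ in 𝓝 (1 : SLR n), A κ ∈ bal n η :=
    (hA.tendsto' 1 1 (map_one A)).eventually_mem (bal_mem_nhds n hη)
  filter_upwards [h1, (near_continuous μ hφ hη).eventually_le_const hε] with κ h1 h2
  refine (measure_mono fun z hz => ?_).trans h2
  rintro ⟨b, hb, hbz⟩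
  exact hz (mem_GRel_inv_smul (h _ h1 _ hb) hbz)

theorem exists_measure_cnjBal_le (hφ : MeasurePreserving φ μ μ) {A : SLR n →* SLR n}
    (hA : Continuous A) {u : SLR n} (hu : Unip (A u)) (huI : Intw μ φ u (A u)) {δ₀ : ℝ}
    (hδ₀ : 0 < δ₀) {ε : ENNReal} (hε : 0 < ε) : ∃ η > 0, ∀ (v : SLR n) (N : ℕ), 0 < N →
    (∀ j < N, ∃ κ ∈ bal n η, ∃ c, u ^ j * v = κ * c ∧ Intw μ φ c (A c)) →
    μ {y | (A v • φ y, φ (v • y)) ∉ GRel X (cnjBal (A u) δ₀ N)} ≤ ε := by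
  have : BorelSpace X := HomSpace.toBorelSpace n
  have : SecondCountableTopology X := HomSpace.toSecondCountableTopology n
  have : T2Space X := HomSpace.toT2Space n
  have hε' : 0 < ε / 16 := ENNReal.div_pos hε.ne' (by simp)
  obtain ⟨r, hr, hrε⟩ := exists_Inj_compl_le (n := n) μ hε'
  obtain ⟨δ, hδ, hδN⟩ := exists_cnjBal X hu hr hδ₀
  obtain ⟨η, hη, hηε⟩ := hasBasis_nhds_one_bal.eventually_iff.1
    (eventually_near_hom (μ := μ) hφ.measurable hA hδ hε')
  refine ⟨η, hη, fun v N hN hκ => ?_⟩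
  let G : Set (X × X) := GRel X (bal n δ)
  have hG : MeasurableSet G := measurableSet_GRel (isCompact_bal n δ)
  have hI : MeasurableSet (Inj n X r) := measurableSet_Inj r
  let bad : ℕ → Set X := fun j => {y | ¬ ((A u) ^ j • A v • φ y ∈ Inj n X r ∧
    ((A u) ^ j • A v • φ y, (A u) ^ j • φ (v • y)) ∈ G)}
  have m1 : ∀ g h : SLR n, Measurable fun y : X => g • φ (h • y) := fun g h =>
    (hφ.measurable.comp (measurable_const_smul h)).const_smul g
  have m2 : ∀ g : SLR n, Measurable fun y : X => g • φ y := fun g => hφ.measurable.const_smul g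
  have hbad : ∀ j, MeasurableSet (bad j) := fun j => by
    have e1 : Measurable fun y : X => (A u) ^ j • A v • φ y := (m2 _).const_smul _
    exact ((e1 hI).inter ((e1.prodMk (m1 _ _)) hG)).compl
  have hsum : ∑ j ∈ Finset.range N, μ (bad j) ≤ (ε / 8) * N := by
    have hj : ∀ j ∈ Finset.range N, μ (bad j) ≤ ε / 8 := by
      intro j hj
      obtain ⟨κ, hκη, c, huv, hc⟩ := hκ j (Finset.mem_range.1 hj)
      let B : Set X := {z | A κ • φ z ∈ (Inj n X r)ᶜ} ∪ {z | (A κ • φ z, φ (κ • z)) ∈ Gᶜ}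
      have hBm : MeasurableSet B :=
        ((m2 _) hI.compl).union (((m2 _).prodMk (hφ.measurable.comp (measurable_const_smul κ))) hG.compl)
      have hB : μ B ≤ ε / 16 + ε / 16 := by
        refine (measure_union_le _ _).trans (add_le_add ?_ (hηε hκη))
        refine le_trans (le_of_eq ?_) hrε
        exact ((measurePreserving_smul (A κ) μ).comp hφ).measure_preimage
          hI.compl.nullMeasurableSet
      have hle : bad j ≤ᵐ[μ] (fun y => c • y) ⁻¹' B := by
        filter_upwards [hc, ae_smul v (Intw.pow huI j)] with y h1 h2 hy
        have h3 : A u ^ j * A v = A κ * A c := by rw [← map_pow, ← map_mul, huv, map_mul]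
        have h4 : A u ^ j • A v • φ y = A κ • φ (c • y) := by
          rw [h1, ← mul_smul, h3, mul_smul]
        have h5 : A u ^ j • φ (v • y) = φ (κ • c • y) := by
          rw [← h2, ← mul_smul, ← mul_smul, huv]
        by_contra hcon
        refine hy ?_
        rw [h4, h5]
        constructor
        · by_contra h6
          exact hcon (Or.inl h6)
        · by_contra h6
          exact hcon (Or.inr h6)
      calc μ (bad j) ≤ μ ((fun y => c • y) ⁻¹' B) := measure_mono_ae hle
        _ = μ B := (measurePreserving_smul c μ).measure_preimage hBm.nullMeasurableSet
        _ ≤ ε / 16 + ε / 16 := hB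
        _ = ε / 8 := by
          rw [← ENNReal.mul_div_mul_left ε 8 (c := 2) (by simp) (by simp), two_mul,
            ENNReal.add_div]
          norm_num
    calc ∑ j ∈ Finset.range N, μ (bad j) ≤ ∑ _j ∈ Finset.range N, ε / 8 := Finset.sum_le_sum hj
      _ = (ε / 8) * N := by rw [Finset.sum_const, Finset.card_range, nsmul_eq_mul, mul_comm]
  have hfin := measure_many_bad_le μ hbad hN hsum
  rw [ENNReal.mul_div_cancel (by simp) (by simp)] at hfin
  refine (measure_mono fun y hy => ?_).trans hfin
  by_contra hcon
  rw [Set.mem_ofPred_eq, not_lt] at hcon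
  refine hy (hδN N hN _ _ (fun j => y ∉ bad j) (fun j hj => ?_) hcon)
  exact not_not.1 hj

theorem intw_of_renormalization (hφ : MeasurePreserving φ μ μ) {A : SLR n ≃* SLR n}
    (hA : Continuous A) (hA' : Continuous A.symm) {u a v : SLR n} (hu : Unip (A u))
    (huI : Intw μ φ u (A u)) (haI : Intw μ φ a (A a)) {N : ℕ → ℕ} {δ₀ : ℝ} (hδ₀ : 0 < δ₀)
    (h1 : ∀ η > 0, ∀ᶠ k in atTop, 0 < N k ∧ ∀ j < N k, ∃ κ ∈ bal n η, ∃ c,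
      u ^ j * (a ^ k * v * (a ^ k)⁻¹) = κ * c ∧ Intw μ φ c (A c))
    (h2 : ∀ ρ > 0, ∀ᶠ k in atTop, ∀ g ∈ cnjBal u δ₀ (N k), (a ^ k)⁻¹ * g * a ^ k ∈ bal n ρ) :
    Intw μ φ v (A v) := by
  obtain ⟨δ, hδ, hδA⟩ : ∃ δ > 0, ∀ g ∈ bal n δ, A.symm g ∈ bal n δ₀ := by
    have : ∀ᶠ g in 𝓝 (1 : SLR n), A.symm g ∈ bal n δ₀ :=
      (hA'.tendsto' 1 1 (map_one A.symm)).eventually_mem (bal_mem_nhds n hδ₀)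
    exact hasBasis_nhds_one_bal.eventually_iff.1 this
  have key : ∀ ρ > 0, ∀ ε : ENNReal, 0 < ε →
      μ {x | (A v • φ x, φ (v • x)) ∉ GRel X (bal n ρ)} ≤ ε := by
    intro ρ hρ ε hε
    obtain ⟨ρ', hρ', hρA⟩ : ∃ ρ' > 0, ∀ g ∈ bal n ρ', A g ∈ bal n ρ := by
      have : ∀ᶠ g in 𝓝 (1 : SLR n), A g ∈ bal n ρ :=
        (hA.tendsto' 1 1 (map_one A)).eventually_mem (bal_mem_nhds n hρ)
      exact hasBasis_nhds_one_bal.eventually_iff.1 this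
    obtain ⟨η, hη, hηN⟩ := exists_measure_cnjBal_le (A := A.toMonoidHom) hφ hA hu huI hδ hε
    obtain ⟨k, ⟨hN, hk1⟩, hk2⟩ := ((h1 η hη).and (h2 ρ' hρ')).exists
    have hm := hηN _ (N k) hN hk1
    let v' : SLR n := a ^ k * v * (a ^ k)⁻¹
    have hle : {x | (A v • φ x, φ (v • x)) ∉ GRel X (bal n ρ)} ≤ᵐ[μ]
        (fun x => a ^ k • x) ⁻¹' {y | (A v' • φ y, φ (v' • y)) ∉ GRel X (cnjBal (A u) δ (N k))} := by
      filter_upwards [Intw.pow haI k, ae_smul v (Intw.pow haI k)] with x hx1 hx2 hx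
      rintro ⟨g, hg, hgx⟩
      refine hx ⟨A ((a ^ k)⁻¹ * A.symm g * a ^ k), hρA _ (hk2 _ fun j hj => ?_), ?_⟩
      · have := hδA _ (hg j hj)
        simpa only [map_mul, map_inv, map_pow, MulEquiv.symm_apply_apply] using this
      · have e1 : v' • a ^ k • x = a ^ k • v • x := by
          rw [← mul_smul, ← mul_smul, inv_mul_cancel_right]
        dsimp only at hgx
        rw [e1, hx1, hx2] at hgx
        have e2 : φ (v • x) = (A a ^ k)⁻¹ • g • A v' • A a ^ k • φ x := by
          rw [hgx, inv_smul_smul]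
        rw [e2]
        simp only [← mul_smul]
        congr 1
        simp only [v', map_mul, map_inv, map_pow, MulEquiv.apply_symm_apply]
        group
    refine (measure_mono_ae hle).trans (le_trans ?_ hm)
    exact ((measurePreserving_smul (a ^ k) μ).measure_preimage_le _)
  have hae : ∀ᵐ x ∂μ, ∀ k : ℕ, (A v • φ x, φ (v • x)) ∈ GRel X (bal n (1 / ((k : ℝ) + 1))) := by
    rw [ae_all_iff]
    intro k
    rw [ae_iff]
    refine le_antisymm (le_of_forall_gt fun ε hε => ?_) (zero_le)
    obtain ⟨ε', h1, h2⟩ := exists_between hε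
    exact (key _ (by positivity) ε' h1).trans_lt h2
  filter_upwards [hae] with x hx
  exact (eq_of_forall_mem_GRel (p := (A v • φ x, φ (v • x))) hx).symm

/-- Elements `a` near the identity normalizing an intertwined direction are intertwined up to the
centralizer. -/
theorem eventually_exists_commute_intw (hn : 2 ≤ n) (hφ : MeasurePreserving φ μ μ)
    {A : SLR n ≃* SLR n} (hA : Continuous A) {u : SLR n} (hu : Unip u) (hu1 : u ≠ 1)
    (hAu : Unip (A u)) (huI : Intw μ φ u (A u)) : ∀ᶠ a in 𝓝 (1 : SLR n),
    Intw μ φ (a * u * a⁻¹) (A (a * u * a⁻¹)) → ∃ c, Commute u c ∧ Intw μ φ a (A (a * c)) := by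
  have : BorelSpace X := HomSpace.toBorelSpace n
  obtain ⟨δ, hδ, h⟩ := PairFam.exists_commute_of_frequently (X := X) hn hu hu1 hAu μ one_pos
  filter_upwards [eventually_near_hom_inv (μ := μ) (A := A.toMonoidHom) hφ.measurable hA hδ
    (ε := 64⁻¹) (by simp)] with a ha haI
  let Ψ : Unit → X → X × X := fun _ x => (φ x, (A a)⁻¹ • φ (a • x))
  have hΨm : Measurable (Ψ ()) :=
    hφ.measurable.prodMk ((hφ.measurable.comp (measurable_const_smul a)).const_smul _)
  have hΨ : PairFam u (A u) μ id Ψ :=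
    { meas := fun _ => hΨm
      meas_param := fun _ _ _ _ => measurable_of_countable _
      mp := fun _ => hφ.map_eq
      equiv := fun _ => by
        filter_upwards [huI, ae_smul a haI] with x h1 h2
        refine Prod.ext h1 ?_
        show (A a)⁻¹ • φ (a • u • x) = A u • (A a)⁻¹ • φ (a • x)
        have e : a • u • x = (a * u * a⁻¹) • a • x := by
          rw [← mul_smul, ← mul_smul, inv_mul_cancel_right]
        rw [e, h2, ← mul_smul, ← mul_smul, map_mul, map_mul, map_inv]
        congr 1
        group }
  have h3 := h (Measure.dirac ()) (MeasurePreserving.id _) hΨ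
  obtain ⟨_, h3⟩ := h3.exists
  obtain ⟨c, -, hc, hcx⟩ := h3 (Frequently.of_forall fun N => by
    refine (Finset.sum_le_sum fun j _ => (show _ ≤ (64 : ENNReal)⁻¹ from ha)).trans ?_
    rw [Finset.sum_const, Finset.card_range, nsmul_eq_mul, mul_comm])
  refine ⟨A.symm c, ?_, ?_⟩
  · have := hc.map A.symm
    rwa [A.symm_apply_apply] at this
  · filter_upwards [hcx] with x hx
    rw [map_mul, A.apply_symm_apply, mul_smul, ← hx, smul_inv_smul]

namespace SLTwo

/-- Elements of `SL(2,ℝ)` given by their entries. -/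
def mk (p q s d : ℝ) (h : p * d - q * s = 1) : SLR 2 := SLR.of !![p, q; s, d] (by rw [det_fin_two_of, h])

theorem coe_mk {p q s d : ℝ} (h : p * d - q * s = 1) :
    (mk p q s d h : Matrix (Fin 2) (Fin 2) ℝ) = !![p, q; s, d] := SLR.coe_of _ _

theorem mk_mul {p q s d p' q' s' d' : ℝ} (h : p * d - q * s = 1) (h' : p' * d' - q' * s' = 1) :
    mk p q s d h * mk p' q' s' d' h' = mk (p * p' + q * s') (p * q' + q * d') (s * p' + d * s')
      (s * q' + d * d') (by linear_combination h + (p * d - q * s) * h' ) := by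
  refine SL_ext ?_
  rw [Matrix.SpecialLinearGroup.coe_mul, coe_mk, coe_mk, coe_mk, mul_fin_two]

theorem mk_one : mk 1 0 0 1 (by norm_num) = 1 := by
  refine SL_ext ?_
  rw [coe_mk, Matrix.SpecialLinearGroup.coe_one, one_fin_two]

theorem mk_congr {p q s d p' q' s' d' : ℝ} (h : p * d - q * s = 1) (h' : p' * d' - q' * s' = 1)
    (h1 : p = p') (h2 : q = q') (h3 : s = s') (h4 : d = d') : mk p q s d h = mk p' q' s' d' h' := by
  subst h1 h2 h3 h4; rfl

theorem mk_inv {p q s d : ℝ} (h : p * d - q * s = 1) :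
    (mk p q s d h)⁻¹ = mk d (-q) (-s) p (by linear_combination h) := by
  rw [inv_eq_iff_mul_eq_one, mk_mul, ← mk_one]
  refine mk_congr _ _ ?_ ?_ ?_ ?_
  · linear_combination h
  · ring
  · ring
  · linear_combination h

theorem exists_mk (g : SLR 2) : ∃ p q s d h, g = mk p q s d h := by
  refine ⟨g.1 0 0, g.1 0 1, g.1 1 0, g.1 1 1, ?_, SL_ext ?_⟩
  · rw [← det_fin_two]; exact g.2
  · rw [coe_mk]; exact eta_fin_two g.1

theorem mk_mem_bal {p q s d ρ : ℝ} (h : p * d - q * s = 1) (hp : |p - 1| ≤ ρ / 2)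
    (hq : |q| ≤ ρ / 2) (hs : |s| ≤ ρ / 2) (hd : |d - 1| ≤ ρ / 2) : mk p q s d h ∈ bal 2 ρ := by
  show dst _ ≤ ρ
  rw [dst, coe_mk]
  have h0 : 0 ≤ ρ / 2 := (abs_nonneg _).trans hp
  refine (norm_le_of_entries h0 fun i j => ?_).trans (by push_cast; linarith)
  fin_cases i <;> fin_cases j <;> simpa

theorem abs_le_of_mk_mem_bal {p q s d ρ : ℝ} (h : p * d - q * s = 1) (hm : mk p q s d h ∈ bal 2 ρ) :
    |p - 1| ≤ ρ ∧ |q| ≤ ρ ∧ |s| ≤ ρ ∧ |d - 1| ≤ ρ := by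
  have h1 : ‖(!![p, q; s, d] - 1 : Matrix (Fin 2) (Fin 2) ℝ)‖ ≤ ρ := by
    rw [← coe_mk h]; exact hm
  have h2 := fun i j => (abs_entry_le_norm (!![p, q; s, d] - 1 : Matrix (Fin 2) (Fin 2) ℝ) i j).trans h1
  refine ⟨?_, ?_, ?_, ?_⟩
  · simpa using h2 0 0
  · simpa using h2 0 1
  · simpa using h2 1 0
  · simpa using h2 1 1

/-- The upper unipotent subgroup. -/
def up (t : ℝ) : SLR 2 := mk 1 t 0 1 (by ring)

/-- The lower unipotent subgroup. -/
def lo (t : ℝ) : SLR 2 := mk 1 0 t 1 (by ring)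

/-- The diagonal subgroup. -/
noncomputable def dia (a : ℝ) (ha : 0 < a) : SLR 2 := mk a 0 0 a⁻¹ (by rw [mul_inv_cancel₀ ha.ne']; ring)

theorem up_pow (t : ℝ) (j : ℕ) : up t ^ j = up (j * t) := by
  induction j with
  | zero => rw [pow_zero, Nat.cast_zero, zero_mul, up, mk_one]
  | succ j ih =>
    rw [pow_succ, ih, up, up, mk_mul, up]
    refine mk_congr _ _ ?_ ?_ ?_ ?_ <;> push_cast <;> ring

theorem dia_pow {a : ℝ} (ha : 0 < a) (k : ℕ) : dia a ha ^ k = dia (a ^ k) (by positivity) := by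
  induction k with
  | zero =>
    rw [pow_zero, ← mk_one, dia]
    refine mk_congr _ _ ?_ ?_ ?_ ?_ <;> simp
  | succ j ih =>
    rw [pow_succ, ih, dia, dia, mk_mul, dia]
    refine mk_congr _ _ ?_ ?_ ?_ ?_
    · ring
    · ring
    · ring
    · rw [pow_succ, _root_.mul_inv]; ring

theorem up_eq (t : ℝ) : up t = SpecialLinearGroup.transvection (zero_ne_one : (0 : Fin 2) ≠ 1) t := by
  rw [← toSL_one_add_single]
  refine SL_ext ?_
  have h := (isR1_single (zero_ne_one : (0 : Fin 2) ≠ 1) (one_ne_zero (α := ℝ))).coe_toSL t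
  rw [smul_single, smul_eq_mul, mul_one] at h
  rw [h, up, coe_mk]
  ext i j
  fin_cases i <;> fin_cases j <;> simp

theorem lo_eq (t : ℝ) : lo t = SpecialLinearGroup.transvection (one_ne_zero : (1 : Fin 2) ≠ 0) t := by
  rw [← toSL_one_add_single]
  refine SL_ext ?_
  have h := (isR1_single (one_ne_zero : (1 : Fin 2) ≠ 0) (one_ne_zero (α := ℝ))).coe_toSL t
  rw [smul_single, smul_eq_mul, mul_one] at h
  rw [h, lo, coe_mk]
  ext i j
  fin_cases i <;> fin_cases j <;> simp

/-- Elements commuting with `up 1` are `±` upper unipotent. -/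
theorem exists_of_commute_up {c : SLR 2} (hc : Commute (up 1) c) :
    ∃ e b h, c = mk e b 0 e h := by
  obtain ⟨p, q, s, d, h, rfl⟩ := exists_mk c
  have h1 : (up 1 : Matrix (Fin 2) (Fin 2) ℝ) * !![p, q; s, d] = !![p, q; s, d] * up 1 := by
    rw [← coe_mk h, ← Matrix.SpecialLinearGroup.coe_mul, hc, Matrix.SpecialLinearGroup.coe_mul]
  rw [up, coe_mk, mul_fin_two, mul_fin_two] at h1
  have h2 := congrFun (congrFun h1 0) 0
  have h3 := congrFun (congrFun h1 0) 1
  simp at h2 h3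
  have hs : s = 0 := by linarith
  have hd : d = p := by linarith
  subst hs hd
  exact ⟨_, _, h, rfl⟩

/-- Shearing decomposition `u_j v_s = κ u_t` with `κ` near `1` as long as `j s` is small. -/
theorem exists_up_mul_lo {θ j s : ℝ} (hθ : θ ≤ 1 / 2) (hj : |j * s| ≤ θ) (hs : |s| ≤ θ) :
    ∃ κ ∈ bal 2 (4 * θ), ∃ t, up j * lo s = κ * up t := by
  have hx := abs_le.1 hj
  have h0 : 0 < 1 + j * s := by linarith
  have hinv : (1 + j * s) * (1 + j * s)⁻¹ = 1 := mul_inv_cancel₀ h0.ne'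
  refine ⟨mk (1 + j * s) 0 s (1 + j * s)⁻¹ (by rw [hinv]; ring), mk_mem_bal _ ?_ ?_ ?_ ?_,
    j * (1 + j * s)⁻¹, ?_⟩
  · rw [add_sub_cancel_left]; linarith [abs_nonneg (j * s)]
  · rw [abs_zero]; linarith [abs_nonneg (j * s)]
  · linarith [abs_nonneg s]
  · have e : (1 + j * s)⁻¹ - 1 = -(j * s) * (1 + j * s)⁻¹ := by
      linear_combination hinv
    have h2 : (1 + j * s)⁻¹ ≤ 2 := by
      rw [inv_le_comm₀ h0 two_pos]; linarith
    rw [e, abs_mul, abs_neg, abs_of_pos (inv_pos.2 h0)]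
    nlinarith [abs_nonneg (j * s), inv_pos.2 h0]
  · rw [up, lo, up, mk_mul, mk_mul]
    refine mk_congr _ _ ?_ ?_ ?_ ?_
    · ring
    · linear_combination -j * hinv
    · ring
    · linear_combination -hinv

theorem dia_mul_lo {a : ℝ} (ha : 0 < a) (s : ℝ) :
    dia a ha * lo s * (dia a ha)⁻¹ = lo (s * (a⁻¹) ^ 2) := by
  have h := mul_inv_cancel₀ ha.ne'
  rw [dia, lo, mk_mul, mk_inv, mk_mul, lo]
  refine mk_congr _ _ ?_ ?_ ?_ ?_
  · linear_combination h
  · ring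
  · ring
  · linear_combination h

/-- An element staying bounded under conjugation by `u^j`, `j ≤ 2 m`, is contracted by conjugation
by a diagonal element of size smaller than `m`. -/
theorem mem_bal_of_mem_cnjBal {m : ℕ} {a σ : ℝ} (ha : 0 < a) (hm : 0 < m) {g : SLR 2}
    (hg : g ∈ cnjBal (up 1) (1 / 2) (2 * m + 1)) (h1 : 6 / m ≤ σ) (h2 : (a⁻¹) ^ 2 ≤ σ)
    (h3 : a ^ 2 / m ^ 2 ≤ σ) : (dia a ha)⁻¹ * g * dia a ha ∈ bal 2 (2 * σ) := by
  obtain ⟨p, q, s, d, h, rfl⟩ := exists_mk g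
  have hm0 : (0 : ℝ) < m := by exact_mod_cast hm
  have hj : ∀ j : ℕ, j < 2 * m + 1 → |p + j * s - 1| ≤ 1 / 2 ∧
      |q + j * (d - p) - j ^ 2 * s| ≤ 1 / 2 ∧ |d - j * s - 1| ≤ 1 / 2 := by
    intro j hj
    have h4 := hg j hj
    rw [up_pow, mul_one, up, mk_mul, mk_inv, mk_mul] at h4
    obtain ⟨h5, h6, -, h7⟩ := abs_le_of_mk_mem_bal _ h4
    refine ⟨le_of_eq_of_le ?_ h5, le_of_eq_of_le ?_ h6, le_of_eq_of_le ?_ h7⟩ <;> congr 1 <;> ring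
  obtain ⟨p0, q0, d0⟩ := hj 0 (by omega)
  obtain ⟨-, q1, -⟩ := hj m (by omega)
  obtain ⟨-, q2, -⟩ := hj (2 * m) (by omega)
  simp only [Nat.cast_zero, zero_mul, add_zero, sub_zero, ne_eq, OfNat.ofNat_ne_zero,
    not_false_eq_true, zero_pow, Nat.cast_mul, Nat.cast_ofNat] at p0 q0 d0 q2
  rw [abs_le] at p0 q0 d0 q1 q2
  have hs : |m ^ 2 * s| ≤ 1 := by
    rw [abs_le]; constructor <;> nlinarith
  have hs' : |s| ≤ 1 / m ^ 2 := by
    rw [le_div_iff₀ (by positivity), mul_comm]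
    rwa [abs_mul, abs_of_pos (by positivity : (0 : ℝ) < m ^ 2)] at hs
  have hd : |m * (d - p)| ≤ 2 := by
    rw [abs_le] at hs ⊢; constructor <;> nlinarith
  have hd' : |d - p| ≤ 2 / m := by
    rw [le_div_iff₀ hm0, mul_comm]
    rwa [abs_mul, abs_of_pos hm0] at hd
  have hm1 : (1 : ℝ) ≤ m := by exact_mod_cast hm
  have hsm : |s| ≤ 1 / m := hs'.trans (by
    rw [div_le_div_iff₀ (by positivity) hm0]; nlinarith)
  have hp : |p - 1| ≤ 4 / m := by
    have e : (p - 1) * (p + 1) = p * (p - d) + q * s := by linear_combination h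
    have h4 : |p - 1| * (p + 1) ≤ 3 / 2 * (2 / m) + 1 / 2 * (1 / m) := by
      rw [← abs_of_pos (by linarith : 0 < p + 1), ← abs_mul, e]
      refine (abs_add_le _ _).trans (add_le_add ?_ ?_)
      · rw [abs_mul, abs_sub_comm]
        exact mul_le_mul (abs_le.2 ⟨by linarith, by linarith⟩) hd' (abs_nonneg _) (by norm_num)
      · rw [abs_mul]
        exact mul_le_mul (abs_le.2 ⟨by linarith, by linarith⟩) hsm (abs_nonneg _) (by norm_num)
    have h5 : |p - 1| * 1 ≤ |p - 1| * (p + 1) :=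
      mul_le_mul_of_nonneg_left (by linarith) (abs_nonneg _)
    have h6 : 3 / 2 * (2 / (m : ℝ)) + 1 / 2 * (1 / m) ≤ 4 / m := by
      have : 0 < 1 / (m : ℝ) := by positivity
      have e1 : 2 / (m : ℝ) = 2 * (1 / m) := by ring
      have e2 : 4 / (m : ℝ) = 4 * (1 / m) := by ring
      rw [e1, e2]; linarith
    linarith
  have e6 : 6 / (m : ℝ) = 4 / m + 2 / m := by ring
  have hpos : 0 < 2 / (m : ℝ) := by positivity
  have hinv := mul_inv_cancel₀ ha.ne'
  have hga : (dia a ha)⁻¹ * mk p q s d h * dia a ha =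
      mk p (q * (a⁻¹) ^ 2) (a ^ 2 * s) d
        (by linear_combination h - q * s * (a * a⁻¹ + 1) * hinv) := by
    rw [dia, mk_inv, mk_mul, mk_mul]
    refine mk_congr _ _ ?_ ?_ ?_ ?_
    · linear_combination p * hinv
    · ring
    · ring
    · linear_combination d * hinv
  rw [hga]
  refine mk_mem_bal _ ?_ ?_ ?_ ?_ <;> rw [mul_div_cancel_left₀ _ two_ne_zero]
  · linarith
  · rw [abs_mul, abs_of_nonneg (sq_nonneg a⁻¹)]
    have : |q| ≤ 1 := abs_le.2 ⟨by linarith, by linarith⟩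
    nlinarith [sq_nonneg a⁻¹]
  · rw [abs_mul, abs_of_nonneg (sq_nonneg a)]
    refine le_trans ?_ h3
    rw [div_eq_mul_one_div]
    exact mul_le_mul_of_nonneg_left hs' (sq_nonneg a)
  · have := abs_add_le (d - p) (p - 1)
    rw [sub_add_sub_cancel] at this
    linarith

end SLTwo

namespace SLTwo
variable {X : Type*} [TopologicalSpace X] [MeasurableSpace X] [MulAction (SLR 2) X]
  [HomSpace 2 X] {μ : Measure X} [IsProbabilityMeasure μ] [SMulInvariantMeasure (SLR 2) X μ]
  {φ : X → X}

theorem unip_up (t : ℝ) : Unip (up t) := by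
  rw [up_eq, ← toSL_one_add_single]
  have h := (isR1_single (zero_ne_one : (0 : Fin 2) ≠ 1) (one_ne_zero (α := ℝ))).isUPG.unip t
  rwa [smul_single, smul_eq_mul, mul_one] at h

theorem up_one_ne_one : up 1 ≠ 1 := by
  intro h
  have h1 := congrArg (fun g : SLR 2 => (g : Matrix (Fin 2) (Fin 2) ℝ) 0 1) h
  simp [up, coe_mk] at h1

/-- Equivariance along the upper triangular group forces equivariance along the lower unipotents. -/
theorem intw_lo (hφ : MeasurePreserving φ μ μ) {A : SLR 2 ≃* SLR 2} (hA : Continuous A)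
    (hA' : Continuous A.symm) (hu : ∀ t, Intw μ φ (up t) (A (up t))) (hAu : Unip (A (up 1)))
    {l : ℝ} (hl : 1 < l) (ha : Intw μ φ (dia l (by linarith)) (A (dia l (by linarith)))) (S : ℝ) :
    Intw μ φ (lo S) (A (lo S)) := by
  have hl0 : 0 < l := by linarith
  have hlk : ∀ k : ℕ, 1 ≤ l ^ k := fun k => one_le_pow₀ hl.le
  let M : ℕ → ℕ := fun k => k * ⌈l ^ k⌉₊
  have hM1 : ∀ k : ℕ, (k : ℝ) * l ^ k ≤ M k := fun k => by
    simp only [M]; push_cast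
    exact mul_le_mul_of_nonneg_left (Nat.le_ceil _) (Nat.cast_nonneg k)
  have hM2 : ∀ k : ℕ, (M k : ℝ) ≤ 2 * k * l ^ k := fun k => by
    simp only [M]; push_cast
    have := (Nat.ceil_lt_add_one (by linarith [hlk k] : 0 ≤ l ^ k)).le
    have h2 : (⌈l ^ k⌉₊ : ℝ) ≤ 2 * l ^ k := by linarith [hlk k]
    calc (k : ℝ) * ⌈l ^ k⌉₊ ≤ k * (2 * l ^ k) := mul_le_mul_of_nonneg_left h2 (Nat.cast_nonneg k)
      _ = _ := by ring
  have t1 : Tendsto (fun k : ℕ => (k : ℝ) * (l⁻¹) ^ k) atTop (𝓝 0) :=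
    tendsto_self_mul_const_pow_of_lt_one (by positivity) (inv_lt_one_of_one_lt₀ hl)
  have t2 : Tendsto (fun k : ℕ => ((l⁻¹) ^ k)) atTop (𝓝 0) :=
    tendsto_pow_atTop_nhds_zero_of_lt_one (by positivity) (inv_lt_one_of_one_lt₀ hl)
  have t3 : Tendsto (fun k : ℕ => 1 / (k : ℝ)) atTop (𝓝 0) := tendsto_one_div_atTop_nhds_zero_nat
  have hinv : ∀ k : ℕ, l ^ k * (l⁻¹) ^ k = 1 := fun k => by
    rw [← mul_pow, mul_inv_cancel₀ hl0.ne', one_pow]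
  have hlp : ∀ k : ℕ, 0 < (l⁻¹) ^ k := fun k => by positivity
  refine intw_of_renormalization (u := up 1) (a := dia l hl0) (N := fun k => 2 * M k + 1) hφ hA hA'
    hAu (hu 1) ha (δ₀ := 1 / 2) (by norm_num) ?_ ?_
  · intro η hη
    let θ := min (1 / 2) (η / 4)
    have hθ : 0 < θ := by positivity
    have e1 : ∀ᶠ k : ℕ in atTop, |S| * (4 * (k * (l⁻¹) ^ k)) < θ := by
      refine Tendsto.eventually_lt_const hθ ?_
      have := (t1.const_mul 4).const_mul |S|
      simpa using this
    have e2 : ∀ᶠ k : ℕ in atTop, |S| * (l⁻¹) ^ k < θ := by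
      refine Tendsto.eventually_lt_const hθ ?_
      simpa using t2.const_mul |S|
    filter_upwards [e1, e2] with k h1 h2
    refine ⟨Nat.succ_pos _, fun j hj => ?_⟩
    have hjM : (j : ℝ) ≤ 2 * M k := by exact_mod_cast Nat.lt_succ_iff.1 hj
    rw [dia_pow, dia_mul_lo, up_pow, mul_one, ← inv_pow]
    have hle1 : (l⁻¹) ^ k ≤ 1 := pow_le_one₀ (by positivity) (inv_lt_one_of_one_lt₀ hl).le
    have hs : |S * ((l⁻¹) ^ k) ^ 2| ≤ |S| * (l⁻¹) ^ k := by
      rw [abs_mul, abs_of_nonneg (sq_nonneg ((l⁻¹) ^ k))]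
      refine mul_le_mul_of_nonneg_left ?_ (abs_nonneg _)
      nlinarith [hlp k]
    have hjs : |j * (S * ((l⁻¹) ^ k) ^ 2)| ≤ θ := by
      refine le_trans ?_ h1.le
      rw [abs_mul, abs_mul, Nat.abs_cast, abs_of_nonneg (sq_nonneg ((l⁻¹) ^ k))]
      have h3 : (j : ℝ) * (l⁻¹) ^ k ≤ 4 * k := by
        have h4 : (j : ℝ) ≤ 4 * k * l ^ k := by linarith [hM2 k]
        calc (j : ℝ) * (l⁻¹) ^ k ≤ 4 * k * l ^ k * (l⁻¹) ^ k :=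
              mul_le_mul_of_nonneg_right h4 (hlp k).le
          _ = 4 * k := by rw [mul_assoc, hinv, mul_one]
      calc (j : ℝ) * (|S| * ((l⁻¹) ^ k) ^ 2) = |S| * ((j * (l⁻¹) ^ k) * (l⁻¹) ^ k) := by ring
        _ ≤ |S| * ((4 * k) * (l⁻¹) ^ k) :=
          mul_le_mul_of_nonneg_left (mul_le_mul_of_nonneg_right h3 (hlp k).le) (abs_nonneg _)
        _ = _ := by ring
    obtain ⟨κ, hκ, t, ht⟩ := exists_up_mul_lo (min_le_left _ _) hjs (hs.trans h2.le)
    refine ⟨κ, bal_mono ?_ hκ, up t, ht, hu t⟩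
    have : θ ≤ η / 4 := min_le_right _ _
    linarith
  · intro ρ hρ
    have e1 : ∀ᶠ k : ℕ in atTop, 6 * (1 / (k : ℝ)) < ρ / 2 := by
      refine Tendsto.eventually_lt_const (half_pos hρ) ?_
      simpa using t3.const_mul 6
    filter_upwards [e1, t2.eventually_lt_const (half_pos hρ), t3.eventually_lt_const (half_pos hρ),
      eventually_ge_atTop 1] with k h1 h2 h3 hk g hg
    have hk1 : (1 : ℝ) ≤ k := by exact_mod_cast hk
    have hMk : (k : ℝ) ≤ M k := by nlinarith [hM1 k, hlk k]
    have hM0 : (0 : ℝ) < M k := by linarith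
    have hle1 : (l⁻¹) ^ k ≤ 1 := pow_le_one₀ (by positivity) (inv_lt_one_of_one_lt₀ hl).le
    rw [dia_pow]
    have h4 := mem_bal_of_mem_cnjBal (a := l ^ k) (σ := ρ / 2) (by positivity)
      (by exact_mod_cast hM0) hg ?_ ?_ ?_
    · rwa [mul_div_cancel₀ _ two_ne_zero] at h4
    · refine le_trans ?_ h1.le
      rw [mul_one_div]
      exact div_le_div_of_nonneg_left (by norm_num) (by linarith) hMk
    · rw [← inv_pow]
      nlinarith [hlp k]
    · refine le_trans ?_ h3.le
      rw [div_le_div_iff₀ (by positivity) (by positivity), one_mul]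
      have h5 : (k * l ^ k) ^ 2 ≤ (M k : ℝ) ^ 2 :=
        pow_le_pow_left₀ (by positivity) (hM1 k) 2
      nlinarith [sq_nonneg (l ^ k)]

/-- A unipotently equivariant map is equivariant for a diagonal element, after twisting `A` by an
upper unipotent. -/
theorem exists_intw_dia (hφ : MeasurePreserving φ μ μ) {A : SLR 2 ≃* SLR 2} (hA : Continuous A)
    (hu : ∀ t, Intw μ φ (up t) (A (up t))) (hAu : Unip (A (up 1))) :
    ∃ (l : ℝ) (hl : 1 < l) (x : ℝ), Intw μ φ (dia l (by linarith))
      (A (up x * dia l (by linarith) * (up x)⁻¹)) := by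
  have h1 := eventually_exists_commute_intw (X := X) (le_refl 2) hφ hA (unip_up 1) up_one_ne_one
    hAu (hu 1)
  obtain ⟨η, hη, h⟩ := hasBasis_nhds_one_bal.eventually_iff.1 h1
  obtain ⟨l, hl, hlη⟩ : ∃ l : ℝ, 1 < l ∧ l - 1 ≤ η / 2 := ⟨1 + η / 2, by linarith, by linarith⟩
  have hl0 : 0 < l := by linarith
  have hinv := mul_inv_cancel₀ hl0.ne'
  have hlinv : l⁻¹ < 1 := inv_lt_one_of_one_lt₀ hl
  have hlp : 0 < l⁻¹ := by positivity
  have hmem : dia l hl0 ∈ bal 2 η := by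
    refine mk_mem_bal _ ?_ ?_ ?_ ?_
    · rw [abs_of_pos (by linarith)]; exact hlη
    · rw [abs_zero]; linarith
    · rw [abs_zero]; linarith
    · rw [abs_sub_comm, abs_of_pos (by linarith)]
      nlinarith
  have hconj : dia l hl0 * up 1 * (dia l hl0)⁻¹ = up (l ^ 2) := by
    rw [dia, up, mk_mul, mk_inv, mk_mul, up]
    refine mk_congr _ _ ?_ ?_ ?_ ?_
    · linear_combination hinv
    · ring
    · ring
    · linear_combination hinv
  obtain ⟨c, hc, hcI⟩ := h hmem (by rw [hconj]; exact hu _)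
  obtain ⟨e, b, he, rfl⟩ := exists_of_commute_up hc
  have hI := hcI.mul hcI
  rw [← map_mul] at hI
  have hl2 : 0 < l ^ 2 - (l⁻¹) ^ 2 := by nlinarith
  have hdd : dia l hl0 * dia l hl0 = dia (l ^ 2) (by positivity) := by
    rw [← pow_two, dia_pow]
  refine ⟨l ^ 2, by nlinarith, -(e * b * (l ^ 2 + 1)) / (l ^ 2 - (l⁻¹) ^ 2), ?_⟩
  rw [hdd] at hI
  convert hI using 2
  rw [dia, dia, up, mk_mul, mk_inv, mk_mul, mk_mul, mk_mul]
  have he' : e * e = 1 := by linear_combination he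
  have hii : (l ^ 2)⁻¹ = (l⁻¹) ^ 2 := by rw [inv_pow]
  refine mk_congr _ _ ?_ ?_ ?_ ?_
  · linear_combination -l ^ 2 * he'
  · rw [hii]
    have hq := div_mul_cancel₀ (-(e * b * (l ^ 2 + 1))) hl2.ne'
    linear_combination -hq - e * b * hinv
  · ring
  · rw [hii]
    linear_combination -(l⁻¹) ^ 2 * he'

theorem exists_aut_of_up (hφ : MeasurePreserving φ μ μ) {A : SLR 2 ≃* SLR 2} (hA : Continuous A)
    (hA' : Continuous A.symm) (hu : ∀ t, Intw μ φ (up t) (A (up t))) (hAu : Unip (A (up 1))) :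
    ∃ A : SLR 2 ≃* SLR 2, Continuous A ∧ ∀ g, Intw μ φ g (A g) := by
  obtain ⟨l, hl, x, hx⟩ := exists_intw_dia hφ hA hu hAu
  let B : SLR 2 ≃* SLR 2 := (MulAut.conj (up x)).trans A
  have hB : ∀ g, B g = A (up x * g * (up x)⁻¹) := fun g => rfl
  have hBc : Continuous B := hA.comp ((continuous_const.mul continuous_id).mul continuous_const)
  have hBc' : Continuous B.symm :=
    ((continuous_const.mul hA').mul continuous_const : Continuous fun g => (up x)⁻¹ * A.symm g * up x)
  have hBu : ∀ t, B (up t) = A (up t) := fun t => by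
    rw [hB]
    congr 1
    rw [up, up, mk_mul, mk_inv, mk_mul]
    refine mk_congr _ _ ?_ ?_ ?_ ?_ <;> ring
  have hu' : ∀ t, Intw μ φ (up t) (B (up t)) := fun t => by rw [hBu]; exact hu t
  have hlo := intw_lo hφ hBc hBc' hu' (by rw [hBu]; exact hAu) hl hx
  refine ⟨B, hBc, intw_of_transvection le_rfl B.toMonoidHom fun i j hij a => ?_⟩
  fin_cases i <;> fin_cases j
  · exact absurd rfl hij
  · have := hu' a
    rw [up_eq] at this
    exact this
  · have := hlo a
    rw [lo_eq] at this
    exact this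
  · exact absurd rfl hij

end SLTwo

theorem isR1_of_isNilpotent_two {W : Matrix (Fin 2) (Fin 2) ℝ} (h : IsNilpotent W) (h0 : W ≠ 0) :
    IsR1 W := by
  refine (isR1_or_eq_zero_iff.2 ⟨?_, (Matrix.isNilpotent_trace_of_isNilpotent h).eq_zero⟩).resolve_left h0
  obtain ⟨k, hk⟩ := h
  have hd : W.det = 0 := by
    have h1 := congrArg Matrix.det hk
    rw [det_pow, det_zero] at h1
    exact eq_zero_of_pow_eq_zero h1
  rw [det_fin_two] at hd
  intro i j k l
  fin_cases i <;> fin_cases j <;> fin_cases k <;> fin_cases l <;> simp only [Fin.zero_eta, Fin.mk_one] <;>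
    first
    | ring1
    | linear_combination hd
    | linear_combination -hd

namespace SLTwo

theorem up_eq_toSL (t : ℝ) : up t = toSL (1 + t • single 0 1 1) := by
  rw [smul_single, smul_eq_mul, mul_one, up_eq, toSL_one_add_single]

/-- Any two unipotent one-parameter groups in `SL(2,ℝ)` are conjugate in `GL(2,ℝ)`. -/
theorem exists_aut_up_eq {W : Matrix (Fin 2) (Fin 2) ℝ} (hW : IsR1 W) :
    ∃ A : SLR 2 ≃* SLR 2, Continuous A ∧ Continuous A.symm ∧ ∀ t, A (up t) = toSL (1 + t • W) := by
  obtain ⟨g, c, hc, h⟩ := hW.conj_two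
  let D : Matrix (Fin 2) (Fin 2) ℝ := g * !![c, 0; 0, 1]
  have hD : D.det = c := by
    simp only [D]
    rw [det_mul, g.det_coe, det_fin_two_of]; ring
  have hDu : IsUnit D.det := by rw [hD]; exact hc.isUnit
  have hE : D * single 0 1 1 = W * D := by
    have e1 : (!![c, 0; 0, 1] : Matrix (Fin 2) (Fin 2) ℝ) * single 0 1 1 = c • single 0 1 1 := by
      ext i j; fin_cases i <;> fin_cases j <;> simp [Matrix.mul_apply, Fin.sum_univ_two]
    have e2 : single 0 1 1 * (!![c, 0; 0, 1] : Matrix (Fin 2) (Fin 2) ℝ) = single 0 1 1 := by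
      ext i j; fin_cases i <;> fin_cases j <;> simp [Matrix.mul_apply, Fin.sum_univ_two]
    have e3 := (cnj_eq_iff g (single 0 1 1) _).1 rfl
    simp only [D]
    rw [mul_assoc, e1, h, ← mul_assoc, smul_mul_assoc, ← e3, smul_mul_assoc, mul_assoc, e2,
      mul_smul_comm]
  clear_value D
  obtain ⟨A, hA, hA', hAg⟩ := exists_conj_aut (D := D) (by rw [hD]; exact hc)
  refine ⟨A, hA, hA', fun t => SL_ext ?_⟩
  rw [hAg, up_eq_toSL, (isR1_single (zero_ne_one : (0 : Fin 2) ≠ 1) (one_ne_zero (α := ℝ))).coe_toSL,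
    hW.coe_toSL, mul_add, mul_one, mul_smul_comm, hE, add_mul, smul_mul_assoc, mul_assoc,
    mul_nonsing_inv _ hDu, mul_one]

variable {X : Type*} [TopologicalSpace X] [MeasurableSpace X] [MulAction (SLR 2) X]
  [HomSpace 2 X] {μ : Measure X} [IsProbabilityMeasure μ] [SMulInvariantMeasure (SLR 2) X μ]
  {φ ψ : X → X}

theorem exists_aut_of_goodR1 (hφ : MeasurePreserving φ μ μ) (hψ : MeasurePreserving ψ μ μ)
    (h1 : ∀ᵐ x ∂μ, ψ (φ x) = x) (h2 : ∀ᵐ x ∂μ, φ (ψ x) = x) {Y : Matrix (Fin 2) (Fin 2) ℝ}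
    (hY : IsR1 Y) (h : GoodR1 μ φ Y) :
    ∃ A : SLR 2 ≃* SLR 2, Continuous A ∧ ∀ g, Intw μ φ g (A g) := by
  obtain ⟨g, c, hc, rfl⟩ := hY.conj_two
  obtain ⟨P, hP, hPI⟩ := h
  have hR : IsR1 (_root_.cnj g (single 0 1 (1 : ℝ))) :=
    (isR1_single (zero_ne_one : (0 : Fin 2) ≠ 1) (one_ne_zero (α := ℝ))).cnj g
  obtain ⟨Q, hQ, hQI⟩ : ∃ Q, IsUPG Q ∧
      ∀ t : ℝ, Intw μ φ (toSL (1 + t • _root_.cnj g (single 0 1 1))) (Q t) := by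
    refine ⟨_, hP.comp_mul c⁻¹, fun t => ?_⟩
    have := hPI (c⁻¹ * t)
    rwa [smul_smul, mul_right_comm, inv_mul_cancel₀ hc, one_mul] at this
  have hQ1 : Q 1 ≠ 1 := fun h => by
    have h3 := hQI 1
    rw [h] at h3
    have h4 := Intw.isPM_of_one le_rfl hψ (h3.symm hψ h1 h2)
    have h5 : Unip (1 : SLR 2) := by
      refine ⟨1, ?_⟩
      rw [Matrix.SpecialLinearGroup.coe_one, sub_self, zero_pow one_ne_zero]
    exact hR.toSL_ne_one (Unip.eq_of_isPM_mul le_rfl h4 h5 (by rw [mul_one]; exact hR.unip))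
  have hW : IsR1 ((Q 1 : Matrix (Fin 2) (Fin 2) ℝ) - 1) :=
    isR1_of_isNilpotent_two (hQ.unip 1) fun h => hQ1 (SL_ext (sub_eq_zero.1 h))
  obtain ⟨A, hA, hA', hAu⟩ := exists_aut_up_eq hW
  have hAQ : ∀ t, A (up t) = Q t := fun t => by
    have h3 : Q 1 = toSL (1 + (1 : ℝ) • ((Q 1 : Matrix (Fin 2) (Fin 2) ℝ) - 1)) := by
      refine SL_ext ?_
      rw [hW.coe_toSL, one_smul, add_sub_cancel]
    rw [hAu, ← congrFun (hQ.eq_of_one hW.isUPG h3) t]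
  have hφ' : MeasurePreserving (fun x => φ (g • x)) μ μ := hφ.comp (measurePreserving_smul g μ)
  have hu : ∀ t, Intw μ (fun x => φ (g • x)) (up t) (A (up t)) := fun t => by
    have h3 := hQI t
    rw [← mul_toSL_one_add_mul_inv, ← up_eq_toSL, ← hAQ] at h3
    filter_upwards [ae_smul g h3] with x hx
    rwa [mul_smul, inv_smul_smul, mul_smul] at hx
  obtain ⟨B, hB, hBI⟩ := exists_aut_of_up hφ' hA hA' hu (by rw [hAQ]; exact hQ.unip 1)
  refine ⟨(MulAut.conj g⁻¹).trans B,
    hB.comp ((continuous_const.mul continuous_id).mul continuous_const), fun x => ?_⟩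
  filter_upwards [ae_smul g⁻¹ (hBI (g⁻¹ * x * g⁻¹⁻¹))] with y hy
  rw [mul_smul, mul_smul, inv_inv, smul_inv_smul, smul_inv_smul] at hy
  rw [hy]
  simp

end SLTwo

section
variable {n : ℕ} {X : Type*} [TopologicalSpace X] [MeasurableSpace X] [MulAction (SLR n) X]
  [HomSpace n X] {μ : Measure X} [IsProbabilityMeasure μ] [SMulInvariantMeasure (SLR n) X μ]

/-- The trivial group does not act ergodically. -/
theorem not_forall_measure_eq_zero_or (hn : 2 ≤ n) :
    ¬ ∀ s : Set X, MeasurableSet s → μ s = 0 ∨ μ sᶜ = 0 := by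
  intro h
  have : BorelSpace X := HomSpace.toBorelSpace n
  have : SecondCountableTopology X := HomSpace.toSecondCountableTopology n
  have : T2Space X := HomSpace.toT2Space n
  have : Nonempty X := nonempty_of_isProbabilityMeasure μ
  obtain ⟨a, ha⟩ : ∃ a, (id : X → X) =ᵐ[μ] Function.const X a := by
    refine exists_eventuallyEq_const_of_forall_separating MeasurableSet fun U hU => ?_
    rcases h U hU with h | h
    · exact Or.inr (measure_eq_zero_iff_ae_notMem.1 h)
    · exact Or.inl (by simpa using measure_eq_zero_iff_ae_notMem.1 h)
  have hfix : ∀ g : SLR n, g • a = a := fun g => by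
    obtain ⟨x, h1, h2⟩ := (ha.and (ae_smul g ha)).exists
    simp only [id, Function.const_apply] at h1 h2
    rwa [h1] at h2
  obtain ⟨r, hr, hst⟩ := HomSpace.discrete_stab (n := n) a
  have hE := isR1_single (n := n) (i := ⟨0, by omega⟩) (j := ⟨1, by omega⟩) (by simp)
    (one_ne_zero (α := ℝ))
  set E : Matrix (Fin n) (Fin n) ℝ := single ⟨0, by omega⟩ ⟨1, by omega⟩ 1
  have hnE : 0 < ‖E‖ := norm_pos_iff.2 hE.1
  have h1 := hst (toSL (1 + (r / ‖E‖) • E)) (by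
    show dst _ ≤ r
    rw [dst, hE.coe_toSL, add_sub_cancel_left, norm_smul, Real.norm_of_nonneg (by positivity),
      div_mul_cancel₀ _ hnE.ne']) (hfix _)
  have h2 := hE.coe_toSL (r / ‖E‖)
  rw [h1, Matrix.SpecialLinearGroup.coe_one, left_eq_add, smul_eq_zero] at h2
  rcases h2 with h2 | h2
  · exact (div_pos hr hnE).ne' h2
  · exact hE.1 h2

end

theorem IsUnipotent.unip {n : ℕ} {u : SLR n} (h : IsUnipotent n u) : Unip u := ⟨n, h⟩

/-- as in Statement 6, but where `F'` is only assumed to be a lattice in a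
subgroup `F''` generated by unipotent elements. -/
theorem commuting_map_is_affine_lattice (n : ℕ) (hn : 2 ≤ n) (Λ : Subgroup (SLR n))
    (hΛ : DiscreteTopology ↥Λ) (μ : Measure (SLR n ⧸ Λ)) [IsProbabilityMeasure μ]
    (hinv : ∀ g : SLR n, Measure.map (fun x => g • x) μ = μ)
    (F'' : Subgroup (SLR n))
    (hF'' : ∃ S : Set (SLR n), (∀ u ∈ S, IsUnipotent n u) ∧ F'' = Subgroup.closure S)
    (F' : Subgroup (SLR n)) (hle : F' ≤ F'')
    (hdisc : DiscreteTopology ↥F')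
    (hlat : ∃ ν : Measure (↥F'' ⧸ F'.subgroupOf F''), IsProbabilityMeasure ν ∧
      ∀ g : ↥F'', Measure.map (fun x => g • x) ν = ν)
    (herg : ∀ s : Set (SLR n ⧸ Λ), MeasurableSet s → (∀ f ∈ F', f • s = s) →
      μ s = 0 ∨ μ sᶜ = 0)
    (φ : SLR n ⧸ Λ → SLR n ⧸ Λ) (hmeas : Measurable φ)
    (hmp : Measure.map φ μ = μ)
    (hinj : ∃ s : Set (SLR n ⧸ Λ), μ sᶜ = 0 ∧ Set.InjOn φ s)
    (hsurj : ∃ t : Set (SLR n ⧸ Λ), μ tᶜ = 0 ∧ t ⊆ Set.range φ)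
    (hcomm : ∀ f ∈ F', ∀ᵐ x ∂μ, φ (f • x) = f • φ x) :
    ∃ (A : SLR n ≃* SLR n) (h : SLR n), Continuous A ∧ Λ.map A.toMonoidHom = Λ ∧
      ∃ ψ : SLR n ⧸ Λ → SLR n ⧸ Λ,
        (∀ g : SLR n, ψ (QuotientGroup.mk g) = QuotientGroup.mk (h * A g)) ∧
        (∀ᵐ x ∂μ, φ x = ψ x) ∧
        (∀ f ∈ F', ∀ x, ψ (f • x) = f • ψ x) := by
  have hinv' : SMulInvariantMeasure (SLR n) (SLR n ⧸ Λ) μ := ⟨fun g s hs => by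
    rw [← Measure.map_apply (measurable_const_smul g) hs, hinv g]⟩
  have hφ : MeasurePreserving φ μ μ := ⟨hmeas, hmp⟩
  obtain ⟨S, hS, rfl⟩ := hF''
  obtain ⟨u, huS, hu1⟩ : ∃ u ∈ S, u ≠ 1 := by
    by_contra! h
    refine not_forall_measure_eq_zero_or (μ := μ) hn fun s hs => herg s hs fun f hf => ?_
    have hf1 : f = 1 := by
      have h1 : Subgroup.closure S ≤ ⊥ :=
        (Subgroup.closure_le _).2 fun v hv => Subgroup.mem_bot.2 (h v hv)
      exact Subgroup.mem_bot.1 (h1 (hle hf))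
    rw [hf1, one_smul]
  have huF : u ∈ Subgroup.closure S := Subgroup.subset_closure huS
  have hun : Unip u := (hS u huS).unip
  obtain ⟨ν, hν, hνinv⟩ := hlat
  obtain ⟨ψ, hψ, h1, h2⟩ := exists_measurable_inverse n hφ hinj
  obtain ⟨Y, hY, hgY⟩ := exists_isR1_isUPG_of_lattice hn hφ hcomm ν hνinv huF hun hu1
  obtain ⟨A, hA, hI⟩ : ∃ A : SLR n ≃* SLR n, Continuous A ∧ ∀ g, Intw μ φ g (A g) := by
    obtain rfl | hn3 := hn.eq_or_lt
    · exact SLTwo.exists_aut_of_goodR1 hφ hψ h1 h2 hY hgY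
    · obtain ⟨Z, hZ, hgZ⟩ := exists_isR1_isUPG_of_lattice hn hψ
        (fun f hf => Intw.symm hψ h1 h2 (hcomm f hf)) ν hνinv huF hun hu1
      exact exists_aut_of_goodR1 hn3 hφ hψ h1 h2 hY hZ hgY hgZ
  exact exists_affine_of_intw hmeas hinj hcomm hA hI
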